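/- arXiv:2205.07932 — 2 statements merged into one kernel-verified Lean document; each statement's English description precedes it below -/
import Mathlib

section
/- Let V be an n×N random real matrix uniformly distributed on the Stiefel manifold V(n, N), and let V_B be the n×b submatrix formed by any fixed set of b columns of V. Suppose N − b ≥ n. Then for any v₁, v₂, v₃ > 0 with √(b/n) + v₁ < 1, √(b/N) + v₂ < 1, and √(b/N) + v₃ < 1/3, one has P[ ‖(N/n)·V_Bᵀ V_B − I_b‖ ≥ (3(√(b/n) + v₁) + 3(√(b/N) + v₂)) / (1 − 3(√(b/N) + v₃)) ] ≤ 2·exp(−n v₁²/2) + 2·exp(−N v₂²/2) + exp(−N v₃²/2). -/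
open MeasureTheory ProbabilityTheory Filter Matrix
open scoped ENNReal NNReal

noncomputable section

/-- Euclidean norm of a finite real vector. -/
def euclNorm {ι : Type*} [Fintype ι] (v : ι → ℝ) : ℝ := Real.sqrt (∑ i, v i ^ 2)

/-- Spectral norm (largest singular value) of a real matrix. -/
def specNorm {m n : Type*} [Fintype m] [Fintype n] [DecidableEq n] (A : Matrix m n ℝ) : ℝ :=
  ‖LinearMap.toContinuousLinearMap (Matrix.toEuclideanLin A)‖

instance {m n α : Type*} [MeasurableSpace α] : MeasurableSpace (Matrix m n α) :=
  inferInstanceAs (MeasurableSpace (m → n → α))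

/-- `V` is uniformly distributed on the Stiefel manifold `V(n, ι)`:
`V Vᵀ = I_n` almost surely and `V·O` has the same distribution as `V` for every
fixed orthogonal matrix `O`. -/
def IsUniformStiefel {Ω ι : Type*} [MeasurableSpace Ω] [Fintype ι] [DecidableEq ι]
    (P : Measure Ω) {n : ℕ} (V : Ω → Matrix (Fin n) ι ℝ) : Prop :=
  Measurable V ∧ (∀ᵐ ω ∂P, V ω * (V ω)ᵀ = 1) ∧
    ∀ O : Matrix ι ι ℝ, O * Oᵀ = 1 →
      Measure.map (fun ω => V ω * O) P = Measure.map V P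

/-- The submatrix of `V` consisting of the columns indexed by `B`. -/
def subCols {n N : ℕ} (V : Matrix (Fin n) (Fin N) ℝ) (B : Finset (Fin N)) :
    Matrix (Fin n) {j // j ∈ B} ℝ :=
  fun i j => V i j.1

/-- Standard Gaussian measure on `κ → ℝ`. -/
def stdG (κ : Type*) [Fintype κ] : Measure (κ → ℝ) := Measure.pi (fun _ : κ => gaussianReal 0 1)

instance stdG_prob (κ : Type*) [Fintype κ] : IsProbabilityMeasure (stdG κ) := by
  unfold stdG; infer_instance

lemma gaussianReal_integrable_iff (f : ℝ → ℝ) :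
    Integrable f (gaussianReal 0 1) ↔ Integrable (fun x => f x * gaussianPDFReal 0 1 x) := by
  rw [gaussianReal_of_var_ne_zero 0 one_ne_zero,
    integrable_withDensity_iff (measurable_gaussianPDF 0 1)
      (ae_of_all _ fun x => gaussianPDF_lt_top)]
  simp [toReal_gaussianPDF]

lemma gaussianPDFReal_hasDerivAt (x : ℝ) :
    HasDerivAt (gaussianPDFReal 0 1) (-x * gaussianPDFReal 0 1 x) x := by
  have h : gaussianPDFReal 0 1 = fun x : ℝ => (Real.sqrt (2 * Real.pi))⁻¹ * Real.exp (-(x^2) / 2) := by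
    funext y; simp [gaussianPDFReal]
  rw [h]
  have h2 : HasDerivAt (fun x : ℝ => -(x^2) / 2) (-x) x := by
    have := ((hasDerivAt_pow 2 x).fun_neg).div_const 2
    refine this.congr_deriv ?_
    simp; ring
  refine (h2.exp.const_mul (Real.sqrt (2 * Real.pi))⁻¹).congr_deriv ?_
  ring

lemma stein_one (f f' : ℝ → ℝ) (hd : ∀ x, HasDerivAt f (f' x) x)
    (h0 : Integrable f (gaussianReal 0 1)) (h1 : Integrable f' (gaussianReal 0 1))
    (h2 : Integrable (fun x => x * f x) (gaussianReal 0 1)) :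
    ∫ x, x * f x ∂(gaussianReal 0 1) = ∫ x, f' x ∂(gaussianReal 0 1) := by
  rw [gaussianReal_integrable_iff] at h0 h1 h2
  rw [integral_gaussianReal_eq_integral_smul one_ne_zero,
    integral_gaussianReal_eq_integral_smul one_ne_zero]
  have := integral_mul_deriv_eq_deriv_mul_of_integrable (u := f) (u' := f')
    (v := gaussianPDFReal 0 1) (v' := fun x => -x * gaussianPDFReal 0 1 x)
    (fun x _ => hd x) (fun x _ => gaussianPDFReal_hasDerivAt x)
    (by
      refine h2.neg.congr (ae_of_all _ fun x => ?_)
      simp; ring) h1 h0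
  have e : ∫ x, gaussianPDFReal 0 1 x • f' x = ∫ x, f' x * gaussianPDFReal 0 1 x := by
    congr 1; funext x; simp [mul_comm]
  rw [e, ← neg_eq_iff_eq_neg.mpr this, ← integral_neg]
  congr 1; funext x; simp; ring

lemma measurePreserving_update {κ : Type*} [Fintype κ] [DecidableEq κ] (c : κ) :
    MeasurePreserving (fun p : ℝ × (κ → ℝ) => Function.update p.2 c p.1)
      ((gaussianReal 0 1).prod (stdG κ)) (stdG κ) := by
  have hm : Measurable (fun p : ℝ × (κ → ℝ) => Function.update p.2 c p.1) := by
    rw [measurable_pi_iff]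
    intro i
    by_cases h : i = c
    · subst h; simpa using measurable_fst
    · simp only [Function.update_of_ne h]; fun_prop
  refine ⟨hm, ?_⟩
  unfold stdG
  refine (Measure.pi_eq fun s hs => ?_).symm
  rw [Measure.map_apply hm (MeasurableSet.univ_pi hs)]
  have : (fun p : ℝ × (κ → ℝ) => Function.update p.2 c p.1) ⁻¹' (Set.univ.pi s)
      = (s c) ×ˢ (Set.univ.pi (Function.update s c Set.univ)) := by
    ext ⟨t, x⟩
    simp only [Set.mem_preimage, Set.mem_pi, Set.mem_univ, true_imp_iff, Set.mem_prod]
    constructor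
    · intro h
      refine ⟨by simpa using h c, fun i => ?_⟩
      by_cases hi : i = c
      · subst hi; simp
      · simpa [Function.update_of_ne hi] using h i
    · rintro ⟨h1, h2⟩ i
      by_cases hi : i = c
      · subst hi; simpa using h1
      · simpa [Function.update_of_ne hi] using h2 i
  rw [this, Measure.prod_prod, Measure.pi_pi, ← Finset.mul_prod_erase Finset.univ _ (Finset.mem_univ c),
    ← Finset.mul_prod_erase Finset.univ (fun i => (gaussianReal 0 1) (s i)) (Finset.mem_univ c)]
  simp only [Function.update_self, measure_univ, one_mul]
  congr 1
  refine Finset.prod_congr rfl fun i hi => ?_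
  rw [Function.update_of_ne (Finset.ne_of_mem_erase hi)]

lemma stein {κ : Type*} [Fintype κ] [DecidableEq κ] (c : κ) (f f' : (κ → ℝ) → ℝ)
    (hd : ∀ x t, HasDerivAt (fun t => f (Function.update x c t)) (f' (Function.update x c t)) t)
    (h0 : Integrable f (stdG κ)) (h1 : Integrable f' (stdG κ))
    (h2 : Integrable (fun x => x c * f x) (stdG κ)) :
    ∫ x, x c * f x ∂(stdG κ) = ∫ x, f' x ∂(stdG κ) := by
  have mp := measurePreserving_update c
  have key : ∀ g : (κ → ℝ) → ℝ, Integrable g (stdG κ) →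
      (∫ x, g x ∂(stdG κ) = ∫ x, ∫ t, g (Function.update x c t) ∂(gaussianReal 0 1) ∂(stdG κ)) ∧
      ∀ᵐ x ∂(stdG κ), Integrable (fun t => g (Function.update x c t)) (gaussianReal 0 1) := by
    intro g hg
    have hi := mp.integrable_comp_of_integrable hg
    refine ⟨?_, hi.prod_left_ae⟩
    have e := integral_prod_symm _ hi
    simp only [Function.comp] at e
    rw [← e]
    conv_lhs => rw [← mp.map_eq, integral_map mp.aemeasurable (by rw [mp.map_eq]; exact hg.aestronglyMeasurable)]
  rw [(key _ h2).1, (key _ h1).1]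
  refine integral_congr_ae ?_
  filter_upwards [(key _ h0).2, (key _ h1).2, (key _ h2).2] with x a0 a1 a2
  have := stein_one (fun t => f (Function.update x c t)) (fun t => f' (Function.update x c t))
    (hd x) a0 a1 (by simpa using a2)
  simpa using this

lemma integrable_exp_abs_gaussian (C : ℝ) :
    Integrable (fun x : ℝ => Real.exp (C * |x|)) (gaussianReal 0 1) := by
  refine ((integrable_exp_mul_gaussianReal (μ := 0) (v := 1) C).add
    (integrable_exp_mul_gaussianReal (μ := 0) (v := 1) (-C))).mono' (by fun_prop)
    (ae_of_all _ fun x => ?_)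
  rw [Real.norm_of_nonneg (Real.exp_pos _).le]
  rcases abs_cases x with ⟨h, _⟩ | ⟨h, _⟩ <;> rw [h] <;> simp only [Pi.add_apply]
  · linarith [Real.exp_pos (-C * x)]
  · have : C * -x = -C * x := by ring
    rw [this]; linarith [Real.exp_pos (C * x)]

lemma integrable_exp_sum_abs {κ : Type*} [Fintype κ] (C : ℝ) :
    Integrable (fun x : κ → ℝ => Real.exp (C * ∑ c, |x c|)) (stdG κ) := by
  have := Integrable.fintype_prod (ι := κ) (f := fun (_ : κ) (x : ℝ) => Real.exp (C * |x|))
    (μ := fun _ => gaussianReal 0 1) (fun _ => integrable_exp_abs_gaussian C)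
  refine this.congr (ae_of_all _ fun x => ?_)
  simp only [← Real.exp_sum, Finset.mul_sum]

/-- Growth-bounded measurable functions are integrable. -/
lemma integrable_of_growth {κ : Type*} [Fintype κ] (f : (κ → ℝ) → ℝ) (hf : Measurable f) (K C : ℝ)
    (h : ∀ x, |f x| ≤ K * Real.exp (C * ∑ c, |x c|)) : Integrable f (stdG κ) :=
  ((integrable_exp_sum_abs C).const_mul K).mono' hf.aestronglyMeasurable (ae_of_all _ h)

lemma abs_coord_le_exp {κ : Type*} [Fintype κ] (x : κ → ℝ) (c : κ) :
    |x c| ≤ Real.exp (1 * ∑ c, |x c|) := by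
  have h1 : |x c| ≤ ∑ c, |x c| :=
    Finset.single_le_sum (f := fun c => |x c|) (fun _ _ => abs_nonneg _) (Finset.mem_univ c)
  have := Real.add_one_le_exp (1 * ∑ c, |x c|)
  linarith

lemma stdG_sum_prod {κ κ' : Type*} [Fintype κ] [Fintype κ'] (f : (κ → ℝ) → ℝ) (g : (κ' → ℝ) → ℝ) :
    ∫ x, f (fun i => x (Sum.inl i)) * g (fun i => x (Sum.inr i)) ∂(stdG (κ ⊕ κ'))
      = (∫ x, f x ∂(stdG κ)) * ∫ x, g x ∂(stdG κ') := by
  have mp := measurePreserving_sumPiEquivProdPi (fun _ : κ ⊕ κ' => gaussianReal 0 1)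
  rw [← integral_prod_mul]
  unfold stdG
  rw [← mp.map_eq, integral_map_equiv]
  rfl

/-- Linear image of a vector under a coefficient family. -/
def linZ {K κ : Type*} [Fintype κ] (A : K → κ → ℝ) (x : κ → ℝ) (k : K) : ℝ := ∑ c, A k c * x c

lemma linZ_sum_abs_le {K κ : Type*} [Fintype K] [Fintype κ] (A M : K → κ → ℝ)
    (hM : ∀ k c, |A k c| ≤ M k c) (x : κ → ℝ) :
    ∑ k, |linZ A x k| ≤ (∑ k, ∑ c, M k c) * ∑ c, |x c| := by
  rw [Finset.sum_mul]
  refine Finset.sum_le_sum fun k _ => ?_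
  unfold linZ
  refine (Finset.abs_sum_le_sum_abs _ _).trans ?_
  rw [Finset.sum_mul]
  refine Finset.sum_le_sum fun c _ => ?_
  rw [abs_mul]
  have : |x c| ≤ ∑ c, |x c| :=
    Finset.single_le_sum (f := fun c => |x c|) (fun _ _ => abs_nonneg _) (Finset.mem_univ c)
  exact mul_le_mul (hM k c) this (abs_nonneg _) ((abs_nonneg _).trans (hM k c))

lemma linZ_abs_le {K κ : Type*} [Fintype K] [Fintype κ] (A M : K → κ → ℝ)
    (hM : ∀ k c, |A k c| ≤ M k c) (x : κ → ℝ) (k : K) :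
    |linZ A x k| ≤ (∑ k, ∑ c, M k c) * ∑ c, |x c| :=
  (Finset.single_le_sum (f := fun k => |linZ A x k|) (fun _ _ => abs_nonneg _)
    (Finset.mem_univ k)).trans (linZ_sum_abs_le A M hM x)

lemma linZ_measurable {K κ : Type*} [Fintype K] [Fintype κ] (A : K → κ → ℝ) :
    Measurable (linZ A) := by
  unfold linZ; fun_prop

lemma linZ_update_hasDerivAt {K κ : Type*} [Fintype K] [Fintype κ] [DecidableEq κ]
    (A : K → κ → ℝ) (x : κ → ℝ) (c : κ) (t : ℝ) :
    HasDerivAt (fun t => linZ A (Function.update x c t)) (fun k => A k c) t := by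
  rw [hasDerivAt_pi]
  intro k
  unfold linZ
  have h := hasDerivAt_pi.1 (hasDerivAt_update x c t)
  have := HasDerivAt.fun_sum (u := Finset.univ) (fun c' _ => (h c').const_mul (A k c'))
  refine this.congr_deriv ?_
  simp [Pi.single_apply]

lemma comp_hasDerivAt {K : Type*} [Fintype K] (f : (K → ℝ) → ℝ) (f1 : K → (K → ℝ) → ℝ)
    (hf : ∀ x, HasFDerivAt f (∑ k, f1 k x • (ContinuousLinearMap.proj k : (K → ℝ) →L[ℝ] ℝ)) x)
    (z : ℝ → K → ℝ) (z' : K → ℝ) (t : ℝ) (hz : HasDerivAt z z' t) :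
    HasDerivAt (fun t => f (z t)) (∑ k, f1 k (z t) * z' k) t := by
  have := (hf (z t)).comp_hasDerivAt t hz
  refine this.congr_deriv ?_
  simp

lemma interp {K κ : Type*} [Fintype K] [Fintype κ] [DecidableEq κ] (A B : K → κ → ℝ)
    (f : (K → ℝ) → ℝ) (f1 : K → (K → ℝ) → ℝ) (f2 : K → K → (K → ℝ) → ℝ)
    (hf : ∀ x, HasFDerivAt f (∑ k, f1 k x • (ContinuousLinearMap.proj k : (K → ℝ) →L[ℝ] ℝ)) x)
    (hf1 : ∀ k x, HasFDerivAt (f1 k)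
      (∑ l, f2 k l x • (ContinuousLinearMap.proj l : (K → ℝ) →L[ℝ] ℝ)) x)
    (mf2 : ∀ k l, Measurable (f2 k l))
    (K0 C : ℝ) (hK0 : 0 ≤ K0) (hC : 0 ≤ C)
    (g0 : ∀ x, |f x| ≤ K0 * Real.exp (C * ∑ k, |x k|))
    (g1 : ∀ k x, |f1 k x| ≤ K0 * Real.exp (C * ∑ k, |x k|))
    (g2 : ∀ k l x, |f2 k l x| ≤ K0 * Real.exp (C * ∑ k, |x k|))
    (orth : ∀ k l, ∑ c, A k c * B l c = 0)
    (sign : ∀ k l x, (∑ c, A k c * A l c - ∑ c, B k c * B l c) * f2 k l x ≤ 0) :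
    ∫ x, f (linZ A x) ∂(stdG κ) ≤ ∫ x, f (linZ B x) ∂(stdG κ) := by
  set M : K → κ → ℝ := fun k c => |A k c| + |B k c| with hMdef
  set L : ℝ := ∑ k, ∑ c, M k c with hL
  have hL0 : 0 ≤ L := Finset.sum_nonneg fun k _ => Finset.sum_nonneg fun c _ => by positivity
  set D : ℝ → K → κ → ℝ := fun θ k c => Real.cos θ * B k c + Real.sin θ * A k c with hD
  set D' : ℝ → K → κ → ℝ := fun θ k c => -Real.sin θ * B k c + Real.cos θ * A k c with hD'
  have bD : ∀ θ k c, |D θ k c| ≤ M k c := by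
    intro θ k c
    refine (abs_add_le _ _).trans ?_
    rw [abs_mul, abs_mul, hMdef]
    nlinarith [Real.abs_cos_le_one θ, Real.abs_sin_le_one θ, abs_nonneg (A k c), abs_nonneg (B k c)]
  have bD' : ∀ θ k c, |D' θ k c| ≤ M k c := by
    intro θ k c
    refine (abs_add_le _ _).trans ?_
    rw [abs_mul, abs_mul, abs_neg, hMdef]
    nlinarith [Real.abs_cos_le_one θ, Real.abs_sin_le_one θ, abs_nonneg (A k c), abs_nonneg (B k c)]
  have cf : Continuous f := continuous_iff_continuousAt.2 fun x => (hf x).continuousAt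
  have cf1 : ∀ k, Continuous (f1 k) :=
    fun k => continuous_iff_continuousAt.2 fun x => (hf1 k x).continuousAt
  have grow : ∀ θ x, K0 * Real.exp (C * ∑ k, |linZ (D θ) x k|) ≤
      K0 * Real.exp ((C * L) * ∑ c, |x c|) := by
    intro θ x
    refine mul_le_mul_of_nonneg_left (Real.exp_le_exp.2 ?_) hK0
    rw [mul_assoc]
    exact mul_le_mul_of_nonneg_left (linZ_sum_abs_le (D θ) M (bD θ) x) hC
  have grow2 : ∀ (x : κ → ℝ), K0 * Real.exp ((C * L) * ∑ c, |x c|) * ∑ c, |x c| ≤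
      K0 * Real.exp ((C * L + 1) * ∑ c, |x c|) := by
    intro x
    rw [mul_assoc, add_mul, Real.exp_add]
    refine mul_le_mul_of_nonneg_left (mul_le_mul_of_nonneg_left ?_ (Real.exp_pos _).le) hK0
    have := Real.add_one_le_exp (1 * ∑ c, |x c|)
    linarith
  have mD : ∀ θ, Measurable (linZ (D θ)) := fun θ => linZ_measurable _
  -- the derivative
  set F' : ℝ → (κ → ℝ) → ℝ := fun θ x => ∑ k, f1 k (linZ (D θ) x) * linZ (D' θ) x k with hF'
  have dz : ∀ x θ, HasDerivAt (fun θ => linZ (D θ) x) (linZ (D' θ) x) θ := by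
    intro x θ
    rw [hasDerivAt_pi]
    intro k
    unfold linZ
    refine HasDerivAt.fun_sum fun c _ => ?_
    refine HasDerivAt.mul_const ?_ _
    exact ((Real.hasDerivAt_cos θ).mul_const _).add ((Real.hasDerivAt_sin θ).mul_const _)
  have bF' : ∀ θ x, |F' θ x| ≤ (Fintype.card K * L) * (K0 * Real.exp ((C * L + 1) * ∑ c, |x c|)) := by
    intro θ x
    refine (Finset.abs_sum_le_sum_abs _ _).trans ?_
    have : ∀ k ∈ Finset.univ, |f1 k (linZ (D θ) x) * linZ (D' θ) x k| ≤
        L * (K0 * Real.exp ((C * L + 1) * ∑ c, |x c|)) := by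
      intro k _
      rw [abs_mul]
      have e1 := (g1 k (linZ (D θ) x)).trans (grow θ x)
      have e2 := linZ_abs_le (D' θ) M (bD' θ) x k
      calc _ ≤ (K0 * Real.exp ((C * L) * ∑ c, |x c|)) * (L * ∑ c, |x c|) :=
            mul_le_mul e1 e2 (abs_nonneg _) (by positivity)
        _ = L * (K0 * Real.exp ((C * L) * ∑ c, |x c|) * ∑ c, |x c|) := by ring
        _ ≤ _ := mul_le_mul_of_nonneg_left (grow2 x) hL0
    refine (Finset.sum_le_sum this).trans ?_
    rw [Finset.sum_const, nsmul_eq_mul, Finset.card_univ, mul_assoc]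
  have iF : ∀ θ, Integrable (fun x => f (linZ (D θ) x)) (stdG κ) := fun θ =>
    integrable_of_growth _ (cf.measurable.comp (mD θ)) K0 (C * L)
      fun x => (g0 _).trans (grow θ x)
  have i1 : ∀ θ k, Integrable (fun x => f1 k (linZ (D θ) x)) (stdG κ) := fun θ k =>
    integrable_of_growth _ ((cf1 k).measurable.comp (mD θ)) K0 (C * L)
      fun x => (g1 k _).trans (grow θ x)
  have i2 : ∀ θ k l, Integrable (fun x => f2 k l (linZ (D θ) x)) (stdG κ) := fun θ k l =>
    integrable_of_growth _ ((mf2 k l).comp (mD θ)) K0 (C * L)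
      fun x => (g2 k l _).trans (grow θ x)
  have i1x : ∀ θ k c, Integrable (fun x => x c * f1 k (linZ (D θ) x)) (stdG κ) := fun θ k c =>
    integrable_of_growth _ ((measurable_pi_apply c).mul ((cf1 k).measurable.comp (mD θ))) K0 (C * L + 1)
      fun x => by
        rw [abs_mul, mul_comm]
        refine le_trans ?_ (grow2 x)
        exact mul_le_mul ((g1 k _).trans (grow θ x))
          (Finset.single_le_sum (f := fun c => |x c|) (fun _ _ => abs_nonneg _) (Finset.mem_univ c))
          (abs_nonneg _) (by positivity)
  have hder : ∀ θ, HasDerivAt (fun θ => ∫ x, f (linZ (D θ) x) ∂(stdG κ)) (∫ x, F' θ x ∂(stdG κ)) θ := by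
    intro θ
    refine (hasDerivAt_integral_of_dominated_loc_of_deriv_le (s := Set.univ) (F' := F')
      (bound := fun x => (Fintype.card K * L) * (K0 * Real.exp ((C * L + 1) * ∑ c, |x c|)))
      Filter.univ_mem
      (Eventually.of_forall fun θ => (iF θ).aestronglyMeasurable) (iF θ) ?_ ?_ ?_ ?_).2
    · refine Measurable.aestronglyMeasurable ?_
      refine Finset.measurable_sum _ fun k _ => ?_
      exact ((cf1 k).measurable.comp (mD θ)).mul
        ((measurable_pi_apply k).comp (linZ_measurable (D' θ)))
    · exact ae_of_all _ fun x θ _ => bF' θ x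
    · exact ((integrable_exp_sum_abs _).const_mul K0).const_mul _
    · exact ae_of_all _ fun x θ _ => comp_hasDerivAt f f1 hf _ _ θ (dz x θ)
  have hval : ∀ θ, ∫ x, F' θ x ∂(stdG κ) = ∑ k, ∑ l, (Real.sin θ * Real.cos θ) *
      ∫ x, (∑ c, A k c * A l c - ∑ c, B k c * B l c) * f2 k l (linZ (D θ) x) ∂(stdG κ) := by
    intro θ
    have e1 : ∀ x, F' θ x = ∑ k, ∑ c, D' θ k c * (x c * f1 k (linZ (D θ) x)) := by
      intro x
      refine Finset.sum_congr rfl fun k _ => ?_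
      rw [linZ, Finset.mul_sum]
      refine Finset.sum_congr rfl fun c _ => ?_
      ring
    simp_rw [e1]
    rw [integral_finsetSum _ fun k _ => integrable_finsetSum _ fun c _ => (i1x θ k c).const_mul _]
    refine Finset.sum_congr rfl fun k _ => ?_
    rw [integral_finsetSum _ fun c _ => (i1x θ k c).const_mul _]
    have e2 : ∀ c, ∫ x, D' θ k c * (x c * f1 k (linZ (D θ) x)) ∂(stdG κ) =
        ∑ l, D' θ k c * D θ l c * ∫ x, f2 k l (linZ (D θ) x) ∂(stdG κ) := by
      intro c
      rw [integral_const_mul, stein c (fun x => f1 k (linZ (D θ) x))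
        (fun x => ∑ l, f2 k l (linZ (D θ) x) * D θ l c) ?_ (i1 θ k) ?_ (i1x θ k c)]
      · rw [integral_finsetSum _ fun l _ => (i2 θ k l).mul_const _, Finset.mul_sum]
        refine Finset.sum_congr rfl fun l _ => ?_
        rw [integral_mul_const]; ring
      · intro x t
        exact comp_hasDerivAt (f1 k) (f2 k) (hf1 k) _ _ t (linZ_update_hasDerivAt (D θ) x c t)
      · exact integrable_finsetSum _ fun l _ => (i2 θ k l).mul_const _
    simp_rw [e2]
    rw [Finset.sum_comm]
    refine Finset.sum_congr rfl fun l _ => ?_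
    rw [← Finset.sum_mul, integral_const_mul, ← mul_assoc]
    congr 1
    have o1 := orth k l
    have o2 := orth l k
    have : ∀ c, D' θ k c * D θ l c = Real.sin θ * Real.cos θ * (A k c * A l c)
        - Real.sin θ * Real.cos θ * (B k c * B l c) + Real.cos θ ^ 2 * (A k c * B l c)
        - Real.sin θ ^ 2 * (A l c * B k c) := by
      intro c; simp only [hD, hD']; ring
    simp_rw [this]
    rw [Finset.sum_sub_distrib, Finset.sum_add_distrib, Finset.sum_sub_distrib]
    simp only [← Finset.mul_sum]
    rw [o1, o2]; ring
  have hanti : AntitoneOn (fun θ => ∫ x, f (linZ (D θ) x) ∂(stdG κ)) (Set.Icc 0 (Real.pi / 2)) := by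
    refine antitoneOn_of_deriv_nonpos (convex_Icc _ _)
      (fun θ _ => (hder θ).continuousAt.continuousWithinAt)
      (fun θ _ => (hder θ).differentiableAt.differentiableWithinAt) ?_
    intro θ hθ
    rw [interior_Icc] at hθ
    rw [(hder θ).deriv, hval]
    refine Finset.sum_nonpos fun k _ => Finset.sum_nonpos fun l _ => ?_
    have s1 : 0 ≤ Real.sin θ := Real.sin_nonneg_of_nonneg_of_le_pi hθ.1.le
      (by linarith [hθ.2, Real.pi_pos])
    have s2 : 0 ≤ Real.cos θ := Real.cos_nonneg_of_mem_Icc ⟨by linarith [hθ.1, Real.pi_pos], hθ.2.le⟩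
    refine mul_nonpos_of_nonneg_of_nonpos (mul_nonneg s1 s2) ?_
    exact integral_nonpos fun x => sign k l _
  have := hanti (Set.left_mem_Icc.2 (by positivity)) (Set.right_mem_Icc.2 (by positivity))
    (by positivity)
  simpa [hD] using this

set_option linter.unusedSectionVars false
/-- `f` has gradient `g` at `x`. -/
def HasGrad {K : Type*} [Fintype K] (f : (K → ℝ) → ℝ) (g : K → ℝ) (x : K → ℝ) : Prop :=
  HasFDerivAt f (∑ k, g k • (ContinuousLinearMap.proj k : (K → ℝ) →L[ℝ] ℝ)) x

lemma HasGrad.congr_grad {K : Type*} [Fintype K] {f : (K → ℝ) → ℝ} {g g' : K → ℝ} {x : K → ℝ}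
    (h : HasGrad f g x) (hg : ∀ k, g k = g' k) : HasGrad f g' x := by
  have : g = g' := funext hg
  exact this ▸ h

lemma HasGrad.comp {K : Type*} [Fintype K] {f : (K → ℝ) → ℝ} {g : K → ℝ} {x : K → ℝ}
    (h : HasGrad f g x) {p : ℝ → ℝ} {p' : ℝ} (hp : HasDerivAt p p' (f x)) :
    HasGrad (fun y => p (f y)) (fun k => p' * g k) x := by
  have := hp.comp_hasFDerivAt x h
  unfold HasGrad
  simp only [← smul_smul, ← Finset.smul_sum]
  exact this

lemma HasGrad.mul {K : Type*} [Fintype K] {f f' : (K → ℝ) → ℝ} {g g' : K → ℝ} {x : K → ℝ}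
    (h : HasGrad f g x) (h' : HasGrad f' g' x) :
    HasGrad (fun y => f y * f' y) (fun k => f x * g' k + f' x * g k) x := by
  have := HasFDerivAt.mul h h'
  unfold HasGrad
  simp only [add_smul, ← smul_smul, ← Finset.smul_sum, Finset.sum_add_distrib]
  exact this

lemma HasGrad.sum {K ι : Type*} [Fintype K] [Fintype ι] {f : ι → (K → ℝ) → ℝ} {g : ι → K → ℝ}
    {x : K → ℝ} (h : ∀ i, HasGrad (f i) (g i) x) :
    HasGrad (fun y => ∑ i, f i y) (fun k => ∑ i, g i k) x := by
  have := HasFDerivAt.fun_sum (u := Finset.univ) (fun i _ => h i)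
  unfold HasGrad
  simp only [Finset.sum_smul]
  rw [Finset.sum_comm]
  exact this

lemma HasGrad.proj {K : Type*} [Fintype K] [DecidableEq K] (k : K) (x : K → ℝ) :
    HasGrad (fun y => y k) (fun l => if l = k then 1 else 0) x := by
  have := (ContinuousLinearMap.proj k : (K → ℝ) →L[ℝ] ℝ).hasFDerivAt (x := x)
  unfold HasGrad
  simp only [ite_smul, one_smul, zero_smul, Finset.sum_ite_eq', Finset.mem_univ, if_true]
  exact this

section soft
variable {I J : Type*} [Fintype I] [Fintype J] [DecidableEq I] [DecidableEq J]

/-- Exponential weight. -/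
def sE (β : ℝ) (k : J × I) (x : J × I → ℝ) : ℝ := Real.exp (β * x k)
/-- Reciprocal block sum. -/
def sR (β : ℝ) (j : J) (x : J × I → ℝ) : ℝ := (∑ i : I, Real.exp (β * x (j, i)))⁻¹
/-- Sum of the reciprocals. -/
def sD (β : ℝ) (x : J × I → ℝ) : ℝ := ∑ j : J, sR β j x

lemma sE_pos (β : ℝ) (k : J × I) (x : J × I → ℝ) : 0 < sE β k x := Real.exp_pos _

variable [Nonempty I] [Nonempty J]

lemma sS_pos (β : ℝ) (j : J) (x : J × I → ℝ) : 0 < ∑ i : I, Real.exp (β * x (j, i)) :=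
  Finset.sum_pos (fun _ _ => Real.exp_pos _) Finset.univ_nonempty

lemma sR_pos (β : ℝ) (j : J) (x : J × I → ℝ) : 0 < sR β j x := inv_pos.2 (sS_pos β j x)

lemma sD_pos (β : ℝ) (x : J × I → ℝ) : 0 < sD β x :=
  Finset.sum_pos (fun _ _ => sR_pos _ _ _) Finset.univ_nonempty

lemma sR_le_sD (β : ℝ) (j : J) (x : J × I → ℝ) : sR β j x ≤ sD β x :=
  Finset.single_le_sum (f := fun j => sR β j x) (fun _ _ => (sR_pos _ _ _).le) (Finset.mem_univ j)

lemma sE_mul_sR_le (β : ℝ) (k : J × I) (x : J × I → ℝ) : sE β k x * sR β k.1 x ≤ 1 := by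
  rw [sR, ← div_eq_mul_inv, div_le_one (sS_pos _ _ _)]
  exact Finset.single_le_sum (f := fun i => Real.exp (β * x (k.1, i)))
    (fun _ _ => (Real.exp_pos _).le) (Finset.mem_univ k.2)

lemma sE_grad (β : ℝ) (k : J × I) (x : J × I → ℝ) :
    HasGrad (sE β k) (fun l => if l = k then β * sE β k x else 0) x := by
  have h : HasDerivAt (fun t : ℝ => Real.exp (β * t)) (Real.exp (β * x k) * β) (x k) := by
    have := ((hasDerivAt_id (x k)).const_mul β).exp
    simpa using this
  refine ((HasGrad.proj k x).comp h).congr_grad fun l => ?_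
  split_ifs <;> simp [sE, mul_comm]

lemma sR_grad (β : ℝ) (j : J) (x : J × I → ℝ) :
    HasGrad (sR β j) (fun l => if l.1 = j then -(β * sE β l x * sR β j x ^ 2) else 0) x := by
  have h := HasGrad.sum (fun i : I => sE_grad β (j, i) x)
  have h2 := h.comp (hasDerivAt_inv (sS_pos β j x).ne')
  refine HasGrad.congr_grad h2 fun l => ?_
  rcases l with ⟨j', i'⟩
  by_cases hj : j' = j
  · subst hj
    have : (∑ i : I, if (j', i') = (j', i) then β * sE β (j', i) x else 0) = β * sE β (j', i') x := by
      simp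
    rw [this]
    simp only [sR, sE, if_true]; ring
  · simp [hj]

lemma sD_grad (β : ℝ) (x : J × I → ℝ) :
    HasGrad (sD β) (fun l => -(β * sE β l x * sR β l.1 x ^ 2)) x := by
  refine (HasGrad.sum (fun j : J => sR_grad β j x)).congr_grad fun l => ?_
  simp

/-- The soft min-max functional. -/
def sF (β q : ℝ) (x : J × I → ℝ) : ℝ := sD β x ^ q
/-- Its first partial derivatives. -/
def sF1 (β q : ℝ) (k : J × I) (x : J × I → ℝ) : ℝ :=
  -(q * β) * (sD β x ^ (q - 1) * (sR β k.1 x ^ 2 * sE β k x))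
/-- Its second partial derivatives. -/
def sF2 (β q : ℝ) (k l : J × I) (x : J × I → ℝ) : ℝ :=
  -(q * β) * (sD β x ^ (q - 1) * (sR β k.1 x ^ 2 * (if l = k then β * sE β k x else 0)
      + sE β k x * (2 * sR β k.1 x * (if l.1 = k.1 then -(β * sE β l x * sR β k.1 x ^ 2) else 0)))
    + (sR β k.1 x ^ 2 * sE β k x) *
      ((q - 1) * sD β x ^ (q - 1 - 1) * (-(β * sE β l x * sR β l.1 x ^ 2))))

lemma sF_grad (β q : ℝ) (x : J × I → ℝ) : HasGrad (sF β q) (fun k => sF1 β q k x) x := by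
  have h := (sD_grad β x).comp (Real.hasDerivAt_rpow_const (p := q) (Or.inl (sD_pos β x).ne'))
  refine HasGrad.congr_grad h fun l => ?_
  simp only [sF1]; ring

lemma sF1_grad (β q : ℝ) (k : J × I) (x : J × I → ℝ) :
    HasGrad (sF1 β q k) (fun l => sF2 β q k l x) x := by
  have h1 := (sD_grad β x).comp
    (Real.hasDerivAt_rpow_const (p := q - 1) (Or.inl (sD_pos β x).ne'))
  have h2 := (sR_grad β k.1 x).comp (hasDerivAt_pow 2 (sR β k.1 x))
  have h3 := (h1.mul (h2.mul (sE_grad β k x))).comp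
    ((hasDerivAt_id _).const_mul (-(q * β)))
  refine HasGrad.congr_grad h3 fun l => ?_
  simp [sF2]

lemma sF2_meas (β q : ℝ) (k l : J × I) : Measurable (sF2 β q k l) := by
  unfold sF2 sD sR sE
  split_ifs <;> fun_prop

lemma sF1_bound (β q : ℝ) (hβ : 0 < β) (hq : 0 < q) (k : J × I) (x : J × I → ℝ) :
    |sF1 β q k x| ≤ (q * β) * sF β q x := by
  have d := sD_pos β x
  have r := sR_pos β k.1 x
  have e := sE_pos β k x
  have hs : sF β q x = sD β x ^ (q - 1) * sD β x := by
    rw [sF, ← Real.rpow_add_one d.ne']; congr 1; ring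
  rw [sF1, abs_mul, abs_neg, abs_of_pos (mul_pos hq hβ), abs_of_pos (by positivity), hs]
  have h1 := sE_mul_sR_le β k x
  have h2 := sR_le_sD β k.1 x
  have : sR β k.1 x ^ 2 * sE β k x ≤ sD β x := by
    calc _ = sR β k.1 x * (sE β k x * sR β k.1 x) := by ring
      _ ≤ sR β k.1 x * 1 := by gcongr
      _ ≤ _ := by simpa using h2
  gcongr

lemma sF2_bound (β q : ℝ) (hβ : 0 < β) (hq : 0 < q) (hq1 : q < 1) (k l : J × I) (x : J × I → ℝ) :
    |sF2 β q k l x| ≤ (4 * q * β ^ 2) * sF β q x := by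
  have d := sD_pos β x
  have r := sR_pos β k.1 x
  have r' := sR_pos β l.1 x
  have e := sE_pos β k x
  have e' := sE_pos β l x
  have hs : sF β q x = sD β x ^ (q - 1) * sD β x := by
    rw [sF, ← Real.rpow_add_one d.ne']; congr 1; ring
  have hs1 : sD β x ^ (q - 1) = sD β x ^ (q - 1 - 1) * sD β x := by
    rw [← Real.rpow_add_one d.ne']; congr 1; ring
  have h1 := sE_mul_sR_le β k x
  have h1' := sE_mul_sR_le β l x
  have h2 := sR_le_sD β k.1 x
  have h2' := sR_le_sD β l.1 x
  have w : sR β k.1 x ^ 2 * sE β k x ≤ sD β x := by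
    calc _ = sR β k.1 x * (sE β k x * sR β k.1 x) := by ring
      _ ≤ sR β k.1 x * 1 := by gcongr
      _ ≤ _ := by simpa using h2
  have w' : sR β l.1 x ^ 2 * sE β l x ≤ sD β x := by
    calc _ = sR β l.1 x * (sE β l x * sR β l.1 x) := by ring
      _ ≤ sR β l.1 x * 1 := by gcongr
      _ ≤ _ := by simpa using h2'
  have t1 : |sR β k.1 x ^ 2 * (if l = k then β * sE β k x else 0)| ≤ β * sD β x := by
    split_ifs
    · rw [abs_of_pos (by positivity)]
      calc _ = β * (sR β k.1 x ^ 2 * sE β k x) := by ring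
        _ ≤ _ := by gcongr
    · simp; positivity
  have t2 : |sE β k x * (2 * sR β k.1 x *
      (if l.1 = k.1 then -(β * sE β l x * sR β k.1 x ^ 2) else 0))| ≤ 2 * β * sD β x := by
    split_ifs with h
    · rw [mul_neg, mul_neg, abs_neg, abs_of_pos (by positivity)]
      rw [h] at h1' h2' w'
      calc _ = 2 * β * ((sE β k x * sR β k.1 x) * (sR β k.1 x ^ 2 * sE β l x)) := by ring
        _ ≤ 2 * β * (1 * sD β x) := by gcongr
        _ = _ := by ring
    · simp; positivity
  have t3 : |(sR β k.1 x ^ 2 * sE β k x) *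
      ((q - 1) * sD β x ^ (q - 1 - 1) * (-(β * sE β l x * sR β l.1 x ^ 2)))| ≤
      β * sF β q x := by
    rw [hs, hs1]
    have : |(sR β k.1 x ^ 2 * sE β k x) *
      ((q - 1) * sD β x ^ (q - 1 - 1) * (-(β * sE β l x * sR β l.1 x ^ 2)))| =
        (1 - q) * (β * (sD β x ^ (q - 1 - 1) * (sR β k.1 x ^ 2 * sE β k x) *
          (sR β l.1 x ^ 2 * sE β l x))) := by
      have h0 : 0 < 1 - q := by linarith
      rw [← abs_of_pos (show 0 < (1 - q) * (β * (sD β x ^ (q - 1 - 1) * (sR β k.1 x ^ 2 * sE β k x) *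
          (sR β l.1 x ^ 2 * sE β l x))) by positivity)]
      congr 1; ring
    rw [this]
    calc _ ≤ 1 * (β * (sD β x ^ (q - 1 - 1) * sD β x * sD β x)) := by
          have h0 : 0 ≤ 1 - q := by linarith
          gcongr; linarith
      _ = _ := by ring
  have dq : 0 < sD β x ^ (q - 1) := by positivity
  rw [sF2, abs_mul, abs_neg, abs_of_pos (mul_pos hq hβ)]
  calc _ ≤ (q * β) * (sD β x ^ (q - 1) * (β * sD β x + 2 * β * sD β x) + β * sF β q x) := by
        refine mul_le_mul_of_nonneg_left ?_ (by positivity)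
        refine (abs_add_le _ _).trans (add_le_add ?_ t3)
        rw [abs_mul, abs_of_pos dq]
        exact mul_le_mul_of_nonneg_left ((abs_add_le _ _).trans (add_le_add t1 t2)) dq.le
    _ = _ := by rw [hs]; ring

lemma sF2_sign (β q : ℝ) (hβ : 0 < β) (hq : 0 < q) (hq1 : q < 1) (k l : J × I) (h : l.1 ≠ k.1)
    (x : J × I → ℝ) : sF2 β q k l x ≤ 0 := by
  have d := sD_pos β x
  have r := sR_pos β k.1 x
  have r' := sR_pos β l.1 x
  have e := sE_pos β k x
  have e' := sE_pos β l x
  have hlk : l ≠ k := fun h' => h (by rw [h'])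
  have : sF2 β q k l x = -((1 - q) * ((q * β) * (sR β k.1 x ^ 2 * sE β k x *
      (sD β x ^ (q - 1 - 1) * (β * sE β l x * sR β l.1 x ^ 2))))) := by
    simp only [sF2, h, hlk, if_false]; ring
  rw [this]
  have h0 : 0 < 1 - q := by linarith
  have : 0 < (1 - q) * ((q * β) * (sR β k.1 x ^ 2 * sE β k x *
      (sD β x ^ (q - 1 - 1) * (β * sE β l x * sR β l.1 x ^ 2)))) := by positivity
  linarith

/-- min over `j` of max over `i`. -/
def minmax (x : J × I → ℝ) : ℝ := ⨅ j : J, ⨆ i : I, x (j, i)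

lemma minmax_le (x : J × I → ℝ) (j : J) : minmax x ≤ ⨆ i : I, x (j, i) :=
  ciInf_le (Finite.bddBelow_range _) j

lemma le_sup (x : J × I → ℝ) (j : J) (i : I) : x (j, i) ≤ ⨆ i : I, x (j, i) :=
  le_ciSup (f := fun i => x (j, i)) (Finite.bddAbove_range _) i

lemma minmax_abs_le (x : J × I → ℝ) : |minmax x| ≤ ∑ k, |x k| := by
  obtain ⟨j, hj⟩ := exists_eq_ciInf_of_finite (f := fun j : J => ⨆ i : I, x (j, i))
  obtain ⟨i, hi⟩ := exists_eq_ciSup_of_finite (f := fun i : I => x (j, i))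
  have : minmax x = x (j, i) := by rw [minmax, ← hj, ← hi]
  rw [this]
  exact Finset.single_le_sum (f := fun k => |x k|) (fun _ _ => abs_nonneg _) (Finset.mem_univ (j, i))

lemma minmax_meas : Measurable (minmax : (J × I → ℝ) → ℝ) := by
  unfold minmax
  exact Measurable.iInf fun j => Measurable.iSup fun i => measurable_pi_apply _

lemma sF_le (β q : ℝ) (hβ : 0 < β) (hq : 0 < q) (x : J × I → ℝ) :
    sF β q x ≤ (Fintype.card J : ℝ) ^ q * Real.exp (-(q * β) * minmax x) := by
  have h : sD β x ≤ Fintype.card J * Real.exp (-β * minmax x) := by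
    have : ∀ j ∈ Finset.univ, sR β j x ≤ Real.exp (-β * minmax x) := by
      intro j _
      rw [sR, neg_mul, Real.exp_neg]
      refine inv_anti₀ (Real.exp_pos _) ?_
      obtain ⟨i, hi⟩ := exists_eq_ciSup_of_finite (f := fun i : I => x (j, i))
      calc _ ≤ Real.exp (β * x (j, i)) := by
            gcongr; rw [hi]; exact minmax_le x j
        _ ≤ _ := Finset.single_le_sum (f := fun i => Real.exp (β * x (j, i)))
            (fun _ _ => (Real.exp_pos _).le) (Finset.mem_univ i)
    refine (Finset.sum_le_sum this).trans ?_
    simp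
  calc sF β q x ≤ (Fintype.card J * Real.exp (-β * minmax x)) ^ q :=
        Real.rpow_le_rpow (sD_pos _ _).le h hq.le
    _ = _ := by
        rw [Real.mul_rpow (by positivity) (by positivity), ← Real.exp_mul]
        congr 2; ring

lemma le_sF (β q : ℝ) (hβ : 0 < β) (hq : 0 < q) (x : J × I → ℝ) :
    Real.exp (-(q * β) * minmax x) ≤ (Fintype.card I : ℝ) ^ q * sF β q x := by
  obtain ⟨j, hj⟩ := exists_eq_ciInf_of_finite (f := fun j : J => ⨆ i : I, x (j, i))
  have h : Real.exp (-β * minmax x) ≤ Fintype.card I * sD β x := by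
    refine le_trans ?_ (mul_le_mul_of_nonneg_left (sR_le_sD β j x) (by positivity))
    rw [sR, ← div_eq_mul_inv, le_div_iff₀ (sS_pos _ _ _), neg_mul, Real.exp_neg,
      inv_mul_le_iff₀ (Real.exp_pos _)]
    have : ∀ i ∈ Finset.univ, Real.exp (β * x (j, i)) ≤ Real.exp (β * minmax x) := by
      intro i _
      gcongr
      rw [minmax, ← hj]; exact le_sup x j i
    refine (Finset.sum_le_sum this).trans ?_
    simp [mul_comm]
  calc _ = Real.exp (-β * minmax x) ^ q := by rw [← Real.exp_mul]; congr 1; ring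
    _ ≤ (Fintype.card I * sD β x) ^ q := Real.rpow_le_rpow (by positivity) h hq.le
    _ = _ := by rw [Real.mul_rpow (by positivity) (sD_pos _ _).le]; rfl

lemma minmax_integrable {κ : Type*} [Fintype κ] (A : J × I → κ → ℝ) (s : ℝ) :
    Integrable (fun x => Real.exp (-s * minmax (linZ A x))) (stdG κ) := by
  refine integrable_of_growth _ ?_ 1 (|s| * ∑ k, ∑ c, |A k c|) fun x => ?_
  · exact Real.measurable_exp.comp ((minmax_meas.comp (linZ_measurable A)).const_mul _)
  · rw [abs_of_pos (Real.exp_pos _), one_mul]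
    refine Real.exp_le_exp.2 ((le_abs_self _).trans ?_)
    rw [abs_mul, abs_neg, mul_assoc]
    exact mul_le_mul_of_nonneg_left ((minmax_abs_le _).trans
      (linZ_sum_abs_le A (fun k c => |A k c|) (fun _ _ => le_rfl) x)) (abs_nonneg _)

theorem gordon {κ : Type*} [Fintype κ] [DecidableEq κ] (A B : J × I → κ → ℝ)
    (orth : ∀ k l, ∑ c, A k c * B l c = 0)
    (same : ∀ k l : J × I, l.1 = k.1 → ∑ c, A k c * A l c = ∑ c, B k c * B l c)
    (diff : ∀ k l : J × I, ∑ c, B k c * B l c ≤ ∑ c, A k c * A l c) (s : ℝ) (hs : 0 < s) :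
    ∫ x, Real.exp (-s * minmax (linZ A x)) ∂(stdG κ) ≤
      ∫ x, Real.exp (-s * minmax (linZ B x)) ∂(stdG κ) := by
  set a := ∫ x, Real.exp (-s * minmax (linZ A x)) ∂(stdG κ) with ha
  set b := ∫ x, Real.exp (-s * minmax (linZ B x)) ∂(stdG κ) with hb
  set cI : ℝ := (Fintype.card I : ℝ)
  set cJ : ℝ := (Fintype.card J : ℝ)
  have hcI : 0 < cI := by simp only [cI]; exact_mod_cast Fintype.card_pos
  have hcJ : 0 < cJ := by simp only [cJ]; exact_mod_cast Fintype.card_pos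
  have key : ∀ β, s < β → a ≤ cI ^ (s / β) * (cJ ^ (s / β) * b) := by
    intro β hsβ
    have hβ : 0 < β := hs.trans hsβ
    set q := s / β with hq'
    have hq : 0 < q := div_pos hs hβ
    have hq1 : q < 1 := (div_lt_one hβ).2 hsβ
    have hqβ : q * β = s := div_mul_cancel₀ _ hβ.ne'
    have gF : ∀ x : J × I → ℝ, sF β q x ≤ cJ ^ q * Real.exp (s * ∑ k, |x k|) := by
      intro x
      refine (sF_le β q hβ hq x).trans ?_
      rw [hqβ]
      refine mul_le_mul_of_nonneg_left (Real.exp_le_exp.2 ?_) (by positivity)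
      have := minmax_abs_le x
      nlinarith [neg_abs_le (minmax x)]
    have sFpos : ∀ x : J × I → ℝ, 0 < sF β q x := fun x => Real.rpow_pos_of_pos (sD_pos _ _) _
    have W : ∀ (r w : ℝ) (x : J × I → ℝ), 0 ≤ w → w ≤ 1 + q * β + 4 * q * β ^ 2 → |r| ≤ w * sF β q x →
        |r| ≤ ((1 + q * β + 4 * q * β ^ 2) * cJ ^ q) * Real.exp (s * ∑ k, |x k|) := by
      intro r w x hw0 hw h
      refine h.trans ?_
      rw [mul_assoc]
      exact mul_le_mul hw (gF x) (sFpos x).le (by positivity)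
    have hi := interp A B (sF β q) (sF1 β q) (sF2 β q) (sF_grad β q) (sF1_grad β q) (sF2_meas β q)
      ((1 + q * β + 4 * q * β ^ 2) * cJ ^ q) s (by positivity) hs.le
      (fun x => W _ 1 x (by norm_num) (by nlinarith [mul_pos hq hβ, mul_pos hq (pow_pos hβ 2)])
        (by rw [abs_of_pos (sFpos x), one_mul]))
      (fun k x => W _ _ x (by positivity) (by nlinarith [mul_pos hq hβ, mul_pos hq (pow_pos hβ 2)])
        (sF1_bound β q hβ hq k x))
      (fun k l x => W _ _ x (by positivity) (by nlinarith [mul_pos hq hβ, mul_pos hq (pow_pos hβ 2)])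
        (sF2_bound β q hβ hq hq1 k l x))
      orth (by
        intro k l x
        by_cases h : l.1 = k.1
        · rw [same k l h]; simp
        · exact mul_nonpos_of_nonneg_of_nonpos (sub_nonneg.2 (diff k l))
            (sF2_sign β q hβ hq hq1 k l h x))
    have mF : Measurable (sF β q : (J × I → ℝ) → ℝ) := by unfold sF sD sR; fun_prop
    have iF : ∀ C : J × I → κ → ℝ, Integrable (fun x => sF β q (linZ C x)) (stdG κ) := by
      intro C
      refine ((minmax_integrable C s).const_mul (cJ ^ q)).mono'
        (mF.comp (linZ_measurable C)).aestronglyMeasurable (ae_of_all _ fun x => ?_)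
      rw [Real.norm_of_nonneg (sFpos _).le]
      simpa [hqβ] using sF_le β q hβ hq (linZ C x)
    calc a ≤ ∫ x, cI ^ q * sF β q (linZ A x) ∂(stdG κ) := by
          refine integral_mono (minmax_integrable A s) ((iF A).const_mul _) fun x => ?_
          simpa [hqβ] using le_sF β q hβ hq (linZ A x)
      _ = cI ^ q * ∫ x, sF β q (linZ A x) ∂(stdG κ) := integral_const_mul _ _
      _ ≤ cI ^ q * ∫ x, sF β q (linZ B x) ∂(stdG κ) := by gcongr
      _ ≤ cI ^ q * ∫ x, cJ ^ q * Real.exp (-s * minmax (linZ B x)) ∂(stdG κ) := by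
          refine mul_le_mul_of_nonneg_left ?_ (by positivity)
          refine integral_mono (iF B) ((minmax_integrable B s).const_mul _) fun x => ?_
          simpa [hqβ] using sF_le β q hβ hq (linZ B x)
      _ = _ := by rw [integral_const_mul]
  have lim : Tendsto (fun β : ℝ => cI ^ (s / β) * (cJ ^ (s / β) * b)) atTop (nhds (1 * (1 * b))) := by
    have h0 : Tendsto (fun β : ℝ => s / β) atTop (nhds 0) := tendsto_const_nhds.div_atTop tendsto_id
    have h1 : ∀ c : ℝ, 0 < c → Tendsto (fun β : ℝ => c ^ (s / β)) atTop (nhds 1) := by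
      intro c hc
      have := (Real.continuousAt_const_rpow hc.ne' (b := 0)).tendsto.comp h0
      rw [Real.rpow_zero] at this
      exact this
    exact (h1 cI hcI).mul ((h1 cJ hcJ).mul tendsto_const_nhds)
  rw [one_mul, one_mul] at lim
  exact ge_of_tendsto lim ((eventually_gt_atTop s).mono key)
end soft

/-- Euclidean length. -/
def rad {κ : Type*} [Fintype κ] (x : κ → ℝ) : ℝ := Real.sqrt (∑ c, x c ^ 2)

lemma rad_nonneg {κ : Type*} [Fintype κ] (x : κ → ℝ) : 0 ≤ rad x := Real.sqrt_nonneg _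

lemma rad_sq {κ : Type*} [Fintype κ] (x : κ → ℝ) : rad x ^ 2 = ∑ c, x c ^ 2 :=
  Real.sq_sqrt (Finset.sum_nonneg fun _ _ => sq_nonneg _)

lemma rad_le {κ : Type*} [Fintype κ] (x : κ → ℝ) : rad x ≤ ∑ c, |x c| := by
  refine Real.sqrt_le_iff.2 ⟨Finset.sum_nonneg fun _ _ => abs_nonneg _, ?_⟩
  have := Finset.sum_sq_le_sq_sum_of_nonneg (s := Finset.univ) (f := fun c => |x c|)
    (fun _ _ => abs_nonneg _)
  simpa using this

lemma rad_meas {κ : Type*} [Fintype κ] : Measurable (rad : (κ → ℝ) → ℝ) := by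
  unfold rad; fun_prop

lemma coord_le_rad {κ : Type*} [Fintype κ] (x : κ → ℝ) (c : κ) : |x c| ≤ rad x := by
  refine Real.le_sqrt_of_sq_le ?_
  rw [sq_abs]
  exact Finset.single_le_sum (f := fun c => x c ^ 2) (fun _ _ => sq_nonneg _) (Finset.mem_univ c)

lemma exp_rad_integrable {κ : Type*} [Fintype κ] (s : ℝ) :
    Integrable (fun x : κ → ℝ => Real.exp (s * rad x)) (stdG κ) := by
  refine integrable_of_growth _ (Real.measurable_exp.comp (rad_meas.const_mul s)) 1 |s| fun x => ?_
  rw [abs_of_pos (Real.exp_pos _), one_mul]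
  refine Real.exp_le_exp.2 ((le_abs_self _).trans ?_)
  rw [abs_mul, abs_of_nonneg (rad_nonneg x)]
  exact mul_le_mul_of_nonneg_left (rad_le x) (abs_nonneg _)

lemma gaussian_exp_sq (t : ℝ) (ht : t < 1 / 2) :
    Integrable (fun x : ℝ => Real.exp (t * x ^ 2)) (gaussianReal 0 1) ∧
    ∫ x, Real.exp (t * x ^ 2) ∂(gaussianReal 0 1) = Real.sqrt (1 / (1 - 2 * t)) := by
  have hp : ∀ x : ℝ, Real.exp (t * x ^ 2) * gaussianPDFReal 0 1 x =
      (Real.sqrt (2 * Real.pi))⁻¹ * Real.exp (-(1 / 2 - t) * x ^ 2) := by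
    intro x
    simp only [gaussianPDFReal, NNReal.coe_one, mul_one, sub_zero]
    rw [mul_left_comm, ← Real.exp_add]
    congr 2; ring
  constructor
  · rw [gaussianReal_integrable_iff]
    simp_rw [hp]
    exact (integrable_exp_neg_mul_sq (by linarith)).const_mul _
  · rw [integral_gaussianReal_eq_integral_smul one_ne_zero]
    simp_rw [smul_eq_mul, mul_comm (gaussianPDFReal 0 1 _), hp]
    rw [integral_const_mul, integral_gaussian, ← Real.sqrt_inv, ← Real.sqrt_mul (by positivity)]
    congr 1
    have : (1 - 2 * t) ≠ 0 := by linarith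
    have h2 : (1 / 2 - t) ≠ 0 := by intro h; apply this; linarith
    have := Real.pi_pos.ne'
    field_simp

lemma chi_upper {κ : Type*} [Fintype κ] [Nonempty κ] (s : ℝ) (hs : 0 < s) :
    ∫ x, Real.exp (s * rad x) ∂(stdG κ) ≤
      Real.exp (s * Real.sqrt (Fintype.card κ) + s ^ 2 / 2) := by
  set m : ℝ := Real.sqrt (Fintype.card κ) with hm
  have hm0 : 0 < m := Real.sqrt_pos.2 (by exact_mod_cast Fintype.card_pos)
  have hmm : m ^ 2 = Fintype.card κ := Real.sq_sqrt (by positivity)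
  set a := m + s with ha
  have ha0 : 0 < a := by positivity
  set t := s / (2 * a) with ht
  have ht2 : 1 - 2 * t = m / a := by rw [ht, ha]; field_simp; ring
  have ht1 : t < 1 / 2 := by
    have : 0 < m / a := by positivity
    linarith
  obtain ⟨hi, hv⟩ := gaussian_exp_sq t ht1
  have hle : ∀ x : κ → ℝ, Real.exp (s * rad x) ≤
      Real.exp (s * a / 2) * ∏ c, Real.exp (t * x c ^ 2) := by
    intro x
    rw [← Real.exp_sum, ← Real.exp_add, ← Finset.mul_sum, ← rad_sq]
    refine Real.exp_le_exp.2 ?_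
    have : s * a / 2 + t * rad x ^ 2 - s * rad x = s / (2 * a) * (rad x - a) ^ 2 := by
      rw [ht]; field_simp; ring
    have h2 : 0 ≤ s / (2 * a) * (rad x - a) ^ 2 := by positivity
    linarith
  have hprod := Integrable.fintype_prod (ι := κ) (f := fun (_ : κ) (x : ℝ) => Real.exp (t * x ^ 2))
    (μ := fun _ => gaussianReal 0 1) (fun _ => hi)
  calc _ ≤ ∫ x : κ → ℝ, Real.exp (s * a / 2) * ∏ c, Real.exp (t * x c ^ 2) ∂(stdG κ) :=
        integral_mono (exp_rad_integrable s) (hprod.const_mul _) hle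
    _ = Real.exp (s * a / 2) * (Real.sqrt (1 / (1 - 2 * t))) ^ (Fintype.card κ) := by
        rw [integral_const_mul]
        unfold stdG
        rw [integral_fintype_prod_eq_prod (f := fun (_ : κ) (x : ℝ) => Real.exp (t * x ^ 2))]
        simp [hv]
    _ ≤ Real.exp (s * a / 2) * (Real.exp (s / m / 2)) ^ (Fintype.card κ) := by
        gcongr
        rw [ht2, one_div_div]
        refine Real.sqrt_le_iff.2 ⟨(Real.exp_pos _).le, ?_⟩
        rw [← Real.exp_nat_mul]
        have := Real.add_one_le_exp (s / m)
        calc a / m = s / m + 1 := by rw [ha]; field_simp; ring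
          _ ≤ _ := this
          _ = _ := by congr 1; push_cast; ring
    _ = _ := by
        rw [← Real.exp_nat_mul, ← Real.exp_add, ← hmm, ha]
        congr 1; field_simp; ring

lemma rad_update_sq {κ : Type*} [Fintype κ] [DecidableEq κ] (x : κ → ℝ) (c : κ) (u : ℝ) :
    ∑ c', (Function.update x c u) c' ^ 2 = u ^ 2 + ∑ c' ∈ Finset.univ.erase c, x c' ^ 2 := by
  rw [← Finset.add_sum_erase Finset.univ _ (Finset.mem_univ c)]
  simp only [Function.update_self]
  congr 1
  refine Finset.sum_congr rfl fun i hi => ?_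
  rw [Function.update_of_ne (Finset.ne_of_mem_erase hi)]

lemma coord_exp_deriv (R t u : ℝ) (hR : 0 ≤ R) :
    HasDerivAt (fun u => u * Real.exp (-t * Real.sqrt (u ^ 2 + R)))
      (Real.exp (-t * Real.sqrt (u ^ 2 + R)) - t * (u ^ 2 / Real.sqrt (u ^ 2 + R)) *
        Real.exp (-t * Real.sqrt (u ^ 2 + R))) u := by
  by_cases h : u ^ 2 + R = 0
  · have hu : u = 0 := by nlinarith [sq_nonneg u]
    have hR0 : R = 0 := by nlinarith [sq_nonneg u]
    subst hu; subst hR0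
    rw [hasDerivAt_iff_tendsto_slope]
    have hc : Continuous (fun u : ℝ => Real.exp (-t * Real.sqrt (u ^ 2 + 0))) := by fun_prop
    have := (hc.tendsto 0).mono_left (nhdsWithin_le_nhds (s := {(0 : ℝ)}ᶜ))
    have h2 : Tendsto (slope (fun u : ℝ => u * Real.exp (-t * Real.sqrt (u ^ 2 + 0))) 0)
        (nhdsWithin 0 {0}ᶜ) (nhds (Real.exp (-t * Real.sqrt ((0 : ℝ) ^ 2 + 0)))) := by
      refine this.congr' ?_
      filter_upwards [self_mem_nhdsWithin] with y hy
      have hy' : y ≠ 0 := hy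
      rw [slope_def_field]
      field_simp
      ring
    simpa using h2
  · have h1 : HasDerivAt (fun u : ℝ => u ^ 2 + R) (2 * u) u := by
      have := (hasDerivAt_pow 2 u).add_const R
      simpa using this
    have h2 := ((h1.sqrt h).const_mul (-t)).exp
    refine ((hasDerivAt_id u).mul h2).congr_deriv ?_
    simp only [id]
    have : Real.sqrt (u ^ 2 + R) ≠ 0 := by
      rw [Real.sqrt_ne_zero']
      exact lt_of_le_of_ne (by positivity) (Ne.symm h)
    field_simp
    ring

lemma chi_ode {κ : Type*} [Fintype κ] [DecidableEq κ] (t : ℝ) :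
    ∫ x : κ → ℝ, (-rad x) ^ 2 * Real.exp (t * (-rad x)) ∂(stdG κ) =
      Fintype.card κ * ∫ x : κ → ℝ, Real.exp (t * (-rad x)) ∂(stdG κ) +
      t * ∫ x : κ → ℝ, (-rad x) * Real.exp (t * (-rad x)) ∂(stdG κ) := by
  have gE : ∀ x : κ → ℝ, Real.exp (-t * rad x) ≤ Real.exp (|t| * ∑ c, |x c|) := by
    intro x
    refine Real.exp_le_exp.2 ((le_abs_self _).trans ?_)
    rw [abs_mul, abs_neg, abs_of_nonneg (rad_nonneg x)]
    exact mul_le_mul_of_nonneg_left (rad_le x) (abs_nonneg _)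
  have gS : ∀ x : κ → ℝ, ∑ c, |x c| ≤ Real.exp (∑ c, |x c|) := fun x => by
    linarith [Real.add_one_le_exp (∑ c, |x c|)]
  have S0 : ∀ x : κ → ℝ, 0 ≤ ∑ c, |x c| := fun x => Finset.sum_nonneg fun _ _ => abs_nonneg _
  have cS : ∀ (x : κ → ℝ) c, |x c| ≤ ∑ c, |x c| := fun x c =>
    Finset.single_le_sum (f := fun c => |x c|) (fun _ _ => abs_nonneg _) (Finset.mem_univ c)
  have mE : Measurable (fun x : κ → ℝ => Real.exp (-t * rad x)) :=
    Real.measurable_exp.comp (rad_meas.const_mul _)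
  have GI : ∀ (w : (κ → ℝ) → ℝ), Measurable w → (∀ x, |w x| ≤ (∑ c, |x c|) ^ 2 + ∑ c, |x c| + 1) →
      Integrable (fun x => w x * Real.exp (-t * rad x)) (stdG κ) := by
    intro w mw hw
    refine integrable_of_growth _ (mw.mul mE) 3 (2 + |t|) fun x => ?_
    rw [abs_mul, abs_of_pos (Real.exp_pos _), add_mul, Real.exp_add, ← mul_assoc]
    refine mul_le_mul ((hw x).trans ?_) (gE x) (Real.exp_pos _).le (by positivity)
    have e2 : Real.exp (2 * ∑ c, |x c|) = Real.exp (∑ c, |x c|) ^ 2 := by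
      rw [← Real.exp_nat_mul]; norm_num
    rw [e2]
    nlinarith [gS x, S0 x, Real.add_one_le_exp (∑ c, |x c|)]
  have div_le : ∀ (x : κ → ℝ) c, x c ^ 2 / rad x ≤ ∑ c, |x c| := by
    intro x c
    rcases (rad_nonneg x).eq_or_lt with h | h
    · rw [← h]; simpa using S0 x
    · rw [div_le_iff₀ h]
      have := coord_le_rad x c
      rw [← sq_abs]
      nlinarith [cS x c, abs_nonneg (x c), S0 x]
  have div_nn : ∀ (x : κ → ℝ) c, 0 ≤ x c ^ 2 / rad x := fun x c =>
    div_nonneg (sq_nonneg _) (rad_nonneg x)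
  have mdiv : ∀ c, Measurable (fun x : κ → ℝ => x c ^ 2 / rad x) := fun c =>
    ((measurable_pi_apply c).pow_const 2).div rad_meas
  have IE : Integrable (fun x : κ → ℝ => Real.exp (-t * rad x)) (stdG κ) := by
    simpa using GI (fun _ => 1) measurable_const (fun x => by simp; positivity)
  have Idiv : ∀ c, Integrable (fun x : κ → ℝ => x c ^ 2 / rad x * Real.exp (-t * rad x)) (stdG κ) :=
    fun c => GI _ (mdiv c) (fun x => by
      rw [abs_of_nonneg (div_nn x c)]; nlinarith [div_le x c, sq_nonneg (∑ c, |x c|)])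
  have Ic : ∀ c, Integrable (fun x : κ → ℝ => x c * Real.exp (-t * rad x)) (stdG κ) :=
    fun c => GI _ (measurable_pi_apply c) (fun x => by
      nlinarith [cS x c, sq_nonneg (∑ c, |x c|)])
  have Icc : ∀ c, Integrable (fun x : κ → ℝ => x c * (x c * Real.exp (-t * rad x))) (stdG κ) :=
    fun c => by
      have := GI (fun x => x c ^ 2) ((measurable_pi_apply c).pow_const 2) (fun x => by
        rw [abs_pow]; nlinarith [cS x c, abs_nonneg (x c), S0 x])
      refine this.congr (ae_of_all _ fun x => ?_)
      simp only; ring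
  have st : ∀ c : κ, ∫ x, x c * (x c * Real.exp (-t * rad x)) ∂(stdG κ) =
      ∫ x, (Real.exp (-t * rad x) - t * (x c ^ 2 / rad x * Real.exp (-t * rad x))) ∂(stdG κ) := by
    intro c
    refine stein c (fun x => x c * Real.exp (-t * rad x)) _ ?_ (Ic c) (IE.sub ((Idiv c).const_mul t))
      (Icc c)
    intro x u
    have := coord_exp_deriv (∑ c' ∈ Finset.univ.erase c, x c' ^ 2) t u
      (Finset.sum_nonneg fun _ _ => sq_nonneg _)
    simp only [rad, rad_update_sq, Function.update_self]
    refine this.congr_deriv ?_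
    ring
  have hsum : ∀ x : κ → ℝ, ∑ c, x c ^ 2 / rad x = rad x := by
    intro x
    rw [← Finset.sum_div, ← rad_sq, sq]
    rcases (rad_nonneg x).eq_or_lt with h | h
    · rw [← h]; simp
    · field_simp
  have e1 : ∀ x : κ → ℝ, (-rad x) ^ 2 * Real.exp (t * (-rad x)) =
      ∑ c, x c * (x c * Real.exp (-t * rad x)) := by
    intro x
    rw [neg_sq, rad_sq, Finset.sum_mul]
    refine Finset.sum_congr rfl fun c _ => ?_
    rw [show t * -rad x = -t * rad x by ring]; ring
  simp_rw [e1]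
  rw [integral_finsetSum _ fun c _ => Icc c]
  simp_rw [st]
  have e2 : ∀ c : κ, ∫ x, (Real.exp (-t * rad x) - t * (x c ^ 2 / rad x * Real.exp (-t * rad x))) ∂(stdG κ)
      = ∫ x, Real.exp (-t * rad x) ∂(stdG κ) -
        t * ∫ x, x c ^ 2 / rad x * Real.exp (-t * rad x) ∂(stdG κ) := by
    intro c
    rw [integral_sub IE ((Idiv c).const_mul t), integral_const_mul]
  simp_rw [e2]
  rw [Finset.sum_sub_distrib, ← Finset.mul_sum, ← integral_finsetSum _ fun c _ => Idiv c]
  simp_rw [← Finset.sum_mul, hsum]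
  have e3 : ∫ x : κ → ℝ, -rad x * Real.exp (t * -rad x) ∂(stdG κ) =
      -∫ x : κ → ℝ, rad x * Real.exp (-t * rad x) ∂(stdG κ) := by
    rw [← integral_neg]; congr 1; funext x
    rw [show t * -rad x = -t * rad x by ring]; ring
  have e4 : ∀ x : κ → ℝ, t * -rad x = -t * rad x := fun x => by ring
  rw [e3]
  simp_rw [e4]
  simp
  ring

lemma chi_lower {κ : Type*} [Fintype κ] [DecidableEq κ] [Nonempty κ] (s : ℝ) (hs : 0 ≤ s) :
    ∫ x : κ → ℝ, Real.exp (-s * rad x) ∂(stdG κ) ≤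
      Real.exp (-s * (Real.sqrt (Fintype.card κ) - 1 / 2) + s ^ 2 / 4) := by
  set X : (κ → ℝ) → ℝ := fun x => -rad x with hX
  set m : ℝ := (Fintype.card κ : ℝ) with hm
  have hm1 : 1 ≤ m := by simp only [hm]; exact_mod_cast Fintype.card_pos
  set c : ℝ := Real.sqrt m - 1 / 2 with hc
  have hsq : Real.sqrt m ^ 2 = m := Real.sq_sqrt (by linarith)
  have hsq1 : 1 ≤ Real.sqrt m := Real.one_le_sqrt.2 hm1
  have hc0 : 0 < c := by rw [hc]; linarith
  have hcm : c ^ 2 ≤ m - 1 / 2 := by rw [hc]; nlinarith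
  have hIX : ∀ t : ℝ, Integrable (fun x => Real.exp (t * X x)) (stdG κ) := by
    intro t
    have := exp_rad_integrable (κ := κ) (-t)
    refine this.congr (ae_of_all _ fun x => ?_)
    simp only [hX]; congr 1; ring
  have hintr : ∀ t : ℝ, t ∈ interior (integrableExpSet X (stdG κ)) := by
    intro t
    have : integrableExpSet X (stdG κ) = Set.univ := Set.eq_univ_of_forall fun t => hIX t
    rw [this]; simp
  set M0 : ℝ → ℝ := fun t => ∫ x, Real.exp (t * X x) ∂(stdG κ) with hM0
  set M1 : ℝ → ℝ := fun t => ∫ x, X x * Real.exp (t * X x) ∂(stdG κ) with hM1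
  have d0 : ∀ t, HasDerivAt M0 (M1 t) t := by
    intro t
    have := hasDerivAt_integral_pow_mul_exp_real (hintr t) 0
    simpa using this
  have d1 : ∀ t, HasDerivAt M1 (m * M0 t + t * M1 t) t := by
    intro t
    have := hasDerivAt_integral_pow_mul_exp_real (hintr t) 1
    have h2 := chi_ode (κ := κ) t
    simp only [pow_one] at this
    refine this.congr_deriv ?_
    exact h2
  have p0 : ∀ t, 0 ≤ M0 t := fun t => integral_nonneg fun x => (Real.exp_pos _).le
  have n1 : ∀ t, M1 t ≤ 0 := fun t => integral_nonpos fun x =>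
    mul_nonpos_of_nonpos_of_nonneg (neg_nonpos.2 (rad_nonneg x)) (Real.exp_pos _).le
  have l0 : ∀ t, 0 ≤ t → M0 t ≤ 1 := by
    intro t ht
    have : M0 t ≤ ∫ x : κ → ℝ, (1 : ℝ) ∂(stdG κ) := by
      refine integral_mono (hIX t) (integrable_const _) fun x => ?_
      refine Real.exp_le_one_iff.2 ?_
      have := rad_nonneg x
      simp only [hX]; nlinarith
    simpa using this
  have v0 : M0 0 = 1 := by simp [hM0]
  -- the barrier function
  set Q : ℝ → ℝ := fun t => (M1 t + (c - t / 2) * M0 t) * Real.exp (-(c * t + t ^ 2 / 4)) with hQ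
  have dw : ∀ t : ℝ, HasDerivAt (fun t : ℝ => c - t / 2) (-(1 / 2)) t := fun t => by
    have := ((hasDerivAt_id t).div_const 2).const_sub c
    simpa using this
  have dQ : ∀ t, HasDerivAt Q (((m - 1 / 2 - c ^ 2 + t ^ 2 / 4) * M0 t) *
      Real.exp (-(c * t + t ^ 2 / 4))) t := by
    intro t
    have de : HasDerivAt (fun t : ℝ => -(c * t + t ^ 2 / 4)) (-(c + t / 2)) t := by
      have := (((hasDerivAt_id t).const_mul c).add ((hasDerivAt_pow 2 t).div_const 4)).fun_neg
      refine this.congr_deriv ?_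
      simp; ring
    refine (((d1 t).add ((dw t).mul (d0 t))).mul de.exp).congr_deriv ?_
    simp only [Pi.add_apply, Pi.mul_apply]
    ring
  have monoQ : Monotone Q := by
    refine monotone_of_deriv_nonneg (fun t => (dQ t).differentiableAt) fun t => ?_
    rw [(dQ t).deriv]
    have : 0 ≤ m - 1 / 2 - c ^ 2 + t ^ 2 / 4 := by nlinarith [sq_nonneg t]
    have := p0 t
    positivity
  have Qle : ∀ t, 0 ≤ t → Q t ≤ c * Real.exp (-(c * t)) := by
    intro t ht
    have h1 : M1 t + (c - t / 2) * M0 t ≤ c := by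
      nlinarith [n1 t, p0 t, l0 t ht]
    calc Q t ≤ c * Real.exp (-(c * t + t ^ 2 / 4)) :=
          mul_le_mul_of_nonneg_right h1 (Real.exp_pos _).le
      _ ≤ _ := by
          refine mul_le_mul_of_nonneg_left (Real.exp_le_exp.2 ?_) hc0.le
          nlinarith [sq_nonneg t]
  have Qneg : ∀ t, 0 ≤ t → Q t ≤ 0 := by
    intro t ht
    have lim : Tendsto (fun u : ℝ => c * Real.exp (-(c * u))) atTop (nhds (c * 0)) := by
      refine Tendsto.const_mul _ ?_
      exact Real.tendsto_exp_neg_atTop_nhds_zero.comp (tendsto_id.const_mul_atTop hc0)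
    rw [mul_zero] at lim
    refine ge_of_tendsto lim ?_
    filter_upwards [eventually_ge_atTop t] with u hu
    exact (monoQ hu).trans (Qle u (ht.trans hu))
  have anti : AntitoneOn (fun t => M0 t * Real.exp (c * t - t ^ 2 / 4)) (Set.Ici 0) := by
    have dd : ∀ t, HasDerivAt (fun t => M0 t * Real.exp (c * t - t ^ 2 / 4))
        ((M1 t + (c - t / 2) * M0 t) * Real.exp (c * t - t ^ 2 / 4)) t := by
      intro t
      have de : HasDerivAt (fun t : ℝ => c * t - t ^ 2 / 4) (c - t / 2) t := by
        have := (((hasDerivAt_id t).const_mul c).sub ((hasDerivAt_pow 2 t).div_const 4))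
        refine this.congr_deriv ?_
        simp; ring
      refine ((d0 t).mul de.exp).congr_deriv ?_
      ring
    refine antitoneOn_of_deriv_nonpos (convex_Ici 0)
      (fun t _ => (dd t).continuousAt.continuousWithinAt)
      (fun t _ => (dd t).differentiableAt.differentiableWithinAt) fun t ht => ?_
    rw [(dd t).deriv]
    rw [interior_Ici] at ht
    have h := Qneg t (le_of_lt ht)
    have h2 : M1 t + (c - t / 2) * M0 t ≤ 0 := by
      by_contra hcon
      push Not at hcon
      have : 0 < Q t := mul_pos hcon (Real.exp_pos _)
      linarith
    exact mul_nonpos_of_nonpos_of_nonneg h2 (Real.exp_pos _).le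
  have fin := anti (Set.mem_Ici.2 le_rfl) (Set.mem_Ici.2 hs) hs
  simp only [v0] at fin
  have fin2 : M0 s * Real.exp (c * s - s ^ 2 / 4) ≤ 1 := by simpa using fin
  have e0 : ∫ x : κ → ℝ, Real.exp (-s * rad x) ∂(stdG κ) = M0 s := by
    simp only [hM0, hX]; congr 1; funext x; congr 1; ring
  rw [e0]
  have : Real.exp (-s * c + s ^ 2 / 4) = (Real.exp (c * s - s ^ 2 / 4))⁻¹ := by
    rw [← Real.exp_neg]; congr 1; ring
  rw [this, ← one_div, le_div_iff₀ (Real.exp_pos _)]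
  exact fin2

lemma stdG_inr {κ κ' : Type*} [Fintype κ] [Fintype κ'] (f : (κ' → ℝ) → ℝ) :
    ∫ x, f (fun i => x (Sum.inr i)) ∂stdG (κ ⊕ κ') = ∫ x, f x ∂stdG κ' := by
  have := stdG_sum_prod (κ := κ) (κ' := κ') (fun _ => 1) f
  simpa using this

lemma stdG_inl {κ κ' : Type*} [Fintype κ] [Fintype κ'] (f : (κ → ℝ) → ℝ) :
    ∫ x, f (fun i => x (Sum.inl i)) ∂stdG (κ ⊕ κ') = ∫ x, f x ∂stdG κ := by
  have := stdG_sum_prod (κ := κ) (κ' := κ') f (fun _ => 1)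
  simpa using this

lemma stdG_unit (s : ℝ) : ∫ x, Real.exp (-s * x ()) ∂stdG Unit = Real.exp (s ^ 2 / 2) := by
  have h := integral_fintype_prod_eq_prod (𝕜 := ℝ) (μ := fun _ : Unit => gaussianReal 0 1)
    (fun _ => fun t : ℝ => Real.exp (-s * t))
  simp only [Finset.univ_unique, Finset.prod_singleton] at h
  have h2 := congrFun (mgf_id_gaussianReal (μ := 0) (v := 1)) (-s)
  simp only [mgf, id] at h2
  unfold stdG
  rw [h2] at h
  refine h.trans ?_
  simp

lemma dot_le_one {ι : Type*} [Fintype ι] (u w : ι → ℝ) (hu : rad u = 1) (hw : rad w = 1) :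
    ∑ i, u i * w i ≤ 1 := by
  have h1 := rad_sq u
  have h2 := rad_sq w
  rw [hu] at h1; rw [hw] at h2
  have : 0 ≤ ∑ i, (u i - w i) ^ 2 := Finset.sum_nonneg fun _ _ => sq_nonneg _
  simp only [sub_sq, Finset.sum_add_distrib, Finset.sum_sub_distrib, mul_assoc,
    ← Finset.mul_sum] at this
  linarith

lemma dot_le_rad {ι : Type*} [Fintype ι] (u w : ι → ℝ) (hw : rad w = 1) :
    |∑ i, u i * w i| ≤ rad u := by
  refine Real.le_sqrt_of_sq_le ?_
  rw [sq_abs]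
  have := Finset.sum_mul_sq_le_sq_mul_sq Finset.univ u w
  rwa [← rad_sq w, hw, one_pow, mul_one] at this

/-- The bilinear form `u ↦ uᵀ V G w`, as coefficient vector in `G`. -/
def cX {α ν β : Type*} [Fintype α] (V : Matrix α ν ℝ) (u : α → ℝ) (w : β → ℝ) : ν × β → ℝ :=
  fun c => (Vᵀ *ᵥ u) c.1 * w c.2

/-- Coefficients for `g·u + h·w`. -/
def cY {α β : Type*} (u : α → ℝ) (w : β → ℝ) : α ⊕ β → ℝ := Sum.elim u w

lemma cX_cov {α ν β : Type*} [Fintype α] [DecidableEq α] [Fintype ν] [Fintype β] (V : Matrix α ν ℝ)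
    (hV : V * Vᵀ = 1) (u u' : α → ℝ) (w w' : β → ℝ) :
    ∑ c, cX V u w c * cX V u' w' c = (∑ i, u i * u' i) * ∑ q, w q * w' q := by
  have h : (∑ i, u i * u' i) = ∑ p, (Vᵀ *ᵥ u) p * (Vᵀ *ᵥ u') p := by
    change u ⬝ᵥ u' = (Vᵀ *ᵥ u) ⬝ᵥ (Vᵀ *ᵥ u')
    rw [Matrix.dotProduct_mulVec, Matrix.vecMul_transpose, Matrix.mulVec_mulVec, hV, one_mulVec]
  rw [h, Finset.sum_mul_sum, ← Finset.sum_product']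
  refine Finset.sum_congr rfl fun c _ => ?_
  simp only [cX]; ring

lemma gordonG {α ν β I J : Type*} [Fintype α] [DecidableEq α] [Fintype ν] [DecidableEq ν]
    [Fintype β] [DecidableEq β] [Fintype I] [Fintype J] [DecidableEq I] [DecidableEq J]
    [Nonempty I] [Nonempty J]
    (V : Matrix α ν ℝ) (hV : V * Vᵀ = 1) (u : J × I → α → ℝ) (w : J → β → ℝ)
    (hu : ∀ k, rad (u k) = 1) (hw : ∀ j, rad (w j) = 1) (s : ℝ) (hs : 0 < s) :
    (∫ x, Real.exp (-s * minmax (linZ (fun k => cX V (u k) (w k.1)) x)) ∂stdG (ν × β))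
      * Real.exp (s ^ 2 / 2) ≤
    ∫ x, Real.exp (-s * minmax (linZ (fun k => cY (u k) (w k.1)) x)) ∂stdG (α ⊕ β) := by
  let A : J × I → ((ν × β) ⊕ (Unit ⊕ (α ⊕ β))) → ℝ := fun k =>
    Sum.elim (cX V (u k) (w k.1)) (Sum.elim (fun _ => 1) (fun _ => 0))
  let B : J × I → ((ν × β) ⊕ (Unit ⊕ (α ⊕ β))) → ℝ := fun k =>
    Sum.elim (fun _ => 0) (Sum.elim (fun _ => 0) (cY (u k) (w k.1)))
  have hAA : ∀ k l, ∑ c, A k c * A l c =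
      (∑ i, u k i * u l i) * (∑ q, w k.1 q * w l.1 q) + 1 := by
    intro k l
    rw [← cX_cov V hV]
    simp [A, Fintype.sum_sum_type]
  have hBB : ∀ k l, ∑ c, B k c * B l c =
      (∑ i, u k i * u l i) + (∑ q, w k.1 q * w l.1 q) := by
    intro k l
    simp [B, Fintype.sum_sum_type, cY]
  have key := gordon A B ?_ ?_ ?_ s hs
  · have e1 : ∀ x, Real.exp (-s * minmax (linZ A x)) =
        Real.exp (-s * minmax (linZ (fun k => cX V (u k) (w k.1)) (fun i => x (Sum.inl i)))) *
        (fun y : (Unit ⊕ (α ⊕ β)) → ℝ => Real.exp (-s * y (Sum.inl ())))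
          (fun i => x (Sum.inr i)) := by
      intro x
      dsimp only
      rw [← Real.exp_add, ← mul_add]
      congr 2
      unfold minmax
      have : ∀ j : J, (⨆ i : I, linZ A x (j, i)) =
          (⨆ i : I, linZ (fun k => cX V (u k) (w k.1)) (fun i => x (Sum.inl i)) (j, i))
            + x (Sum.inr (Sum.inl ())) := by
        intro j
        rw [ciSup_add (Set.finite_range _).bddAbove]
        congr 1; ext i
        simp [linZ, A, Fintype.sum_sum_type]
      simp_rw [this]
      rw [← ciInf_add (Set.finite_range _).bddBelow]
    have e2 : ∀ x, Real.exp (-s * minmax (linZ B x)) =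
        (fun y : (Unit ⊕ (α ⊕ β)) → ℝ => Real.exp (-s * minmax (linZ (fun k => cY (u k) (w k.1))
          (fun i => y (Sum.inr i))))) (fun i => x (Sum.inr i)) := by
      intro x
      dsimp only
      congr 3
      ext k
      simp [linZ, B, Fintype.sum_sum_type]
    simp_rw [e1, e2] at key
    rw [stdG_sum_prod (fun x => Real.exp (-s * minmax (linZ (fun k => cX V (u k) (w k.1)) x)))
      (fun y : (Unit ⊕ (α ⊕ β)) → ℝ => Real.exp (-s * y (Sum.inl ()))),
      stdG_inr (fun y : (Unit ⊕ (α ⊕ β)) → ℝ => Real.exp (-s * minmax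
        (linZ (fun k => cY (u k) (w k.1)) (fun i => y (Sum.inr i))))),
      stdG_inr (fun y => Real.exp (-s * minmax (linZ (fun k => cY (u k) (w k.1)) y))),
      stdG_inl (fun y : Unit → ℝ => Real.exp (-s * y ())), stdG_unit] at key
    exact key
  · intro k l
    simp [A, B, Fintype.sum_sum_type]
  · intro k l h
    rw [hAA, hBB, h]
    have := rad_sq (w k.1)
    rw [hw, one_pow] at this
    have h2 : ∑ q, w k.1 q * w k.1 q = 1 := by rw [this]; simp [sq]
    rw [h2]; ring
  · intro k l
    rw [hAA, hBB]
    have h1 := dot_le_one _ _ (hu k) (hu l)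
    have h2 := dot_le_one _ _ (hw k.1) (hw l.1)
    nlinarith

lemma tail_fin {α ν β I J : Type*} [Fintype α] [DecidableEq α] [Fintype ν] [DecidableEq ν]
    [Fintype β] [DecidableEq β] [Fintype I] [Fintype J] [DecidableEq I] [DecidableEq J]
    [Nonempty I] [Nonempty J]
    (V : Matrix α ν ℝ) (hV : V * Vᵀ = 1) (u : J × I → α → ℝ) (w : J → β → ℝ)
    (hu : ∀ k, rad (u k) = 1) (hw : ∀ j, rad (w j) = 1) (s : ℝ) (hs : 0 < s) (a c : ℝ)
    (hY : ∀ j, ∀ g : α → ℝ, ∃ i, a * rad g ≤ ∑ p, g p * u (j, i) p) :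
    stdG (ν × β) {x | ∃ j, ∀ i, linZ (fun k => cX V (u k) (w k.1)) x (j, i) < c} ≤
      ENNReal.ofReal (Real.exp (s * c - s ^ 2 / 2) *
        ((∫ g, Real.exp (-(s * a) * rad g) ∂stdG α) * ∫ h, Real.exp (s * rad h) ∂stdG β)) := by
  have h1 := gordonG V hV u w hu hw s hs
  have h2 : ∫ x, Real.exp (-s * minmax (linZ (fun k => cY (u k) (w k.1)) x)) ∂stdG (α ⊕ β) ≤
      (∫ g, Real.exp (-(s * a) * rad g) ∂stdG α) * ∫ h, Real.exp (s * rad h) ∂stdG β := by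
    rw [← stdG_sum_prod]
    refine integral_mono (minmax_integrable _ s) ?_ fun x => ?_
    · refine integrable_of_growth _ ?_ 1 (|s * a| + |s|) fun x => ?_
      · exact (Real.measurable_exp.comp ((rad_meas.comp (by fun_prop)).const_mul _)).mul
          (Real.measurable_exp.comp ((rad_meas.comp (by fun_prop)).const_mul _))
      · rw [← Real.exp_add, abs_of_pos (Real.exp_pos _), one_mul]
        refine Real.exp_le_exp.2 ?_
        have r1 := rad_le (fun i : α => x (Sum.inl i))
        have r2 := rad_le (fun i : β => x (Sum.inr i))
        rw [Fintype.sum_sum_type, add_mul]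
        have p1 : 0 ≤ ∑ i : α, |x (Sum.inl i)| := Finset.sum_nonneg fun _ _ => abs_nonneg _
        have p2 : 0 ≤ ∑ i : β, |x (Sum.inr i)| := Finset.sum_nonneg fun _ _ => abs_nonneg _
        refine add_le_add ?_ ?_
        · refine (mul_le_mul_of_nonneg_right (neg_le_abs _) (rad_nonneg _)).trans ?_
          exact mul_le_mul_of_nonneg_left (by linarith) (abs_nonneg _)
        · refine (mul_le_mul_of_nonneg_right (le_abs_self _) (rad_nonneg _)).trans ?_
          exact mul_le_mul_of_nonneg_left (by linarith) (abs_nonneg _)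
    · dsimp only
      rw [← Real.exp_add]
      refine Real.exp_le_exp.2 ?_
      have : a * rad (fun i : α => x (Sum.inl i)) - rad (fun i : β => x (Sum.inr i)) ≤
          minmax (linZ (fun k => cY (u k) (w k.1)) x) := by
        refine le_ciInf fun j => ?_
        obtain ⟨i, hi⟩ := hY j (fun i : α => x (Sum.inl i))
        refine le_trans ?_ (le_sup _ j i)
        have := (abs_le.1 (dot_le_rad (fun i : β => x (Sum.inr i)) (w j) (hw j))).1
        have e : linZ (fun k => cY (u k) (w k.1)) x (j, i) =
            (∑ p, x (Sum.inl p) * u (j, i) p) + ∑ q, x (Sum.inr q) * w j q := by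
          simp [linZ, cY, Fintype.sum_sum_type, mul_comm]
        rw [e]; linarith
      nlinarith
  set Z : (ν × β → ℝ) → ℝ := fun x => minmax (linZ (fun k => cX V (u k) (w k.1)) x) with hZ
  have hsub : {x | ∃ j, ∀ i, linZ (fun k => cX V (u k) (w k.1)) x (j, i) < c} ⊆
      {x | Real.exp (-s * c) ≤ Real.exp (-s * Z x)} := by
    rintro x ⟨j, hj⟩
    refine Real.exp_le_exp.2 ?_
    have : Z x ≤ c := (minmax_le _ j).trans (ciSup_le fun i => (hj i).le)
    nlinarith
  refine (measure_mono hsub).trans ?_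
  have hm := mul_meas_ge_le_integral_of_nonneg (μ := stdG (ν × β))
    (f := fun x => Real.exp (-s * Z x)) (Eventually.of_forall fun x => (Real.exp_pos _).le)
    (minmax_integrable _ s) (Real.exp (-s * c))
  rw [← ENNReal.ofReal_toReal (measure_ne_top (stdG (ν × β)) _)]
  refine ENNReal.ofReal_le_ofReal ?_
  change Measure.real _ _ ≤ _
  have hexp : Real.exp (s * c - s ^ 2 / 2) * Real.exp (s ^ 2 / 2) * Real.exp (-s * c) = 1 := by
    rw [← Real.exp_add, ← Real.exp_add, Real.exp_eq_one_iff]; ring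
  set M := (stdG (ν × β)).real {x | Real.exp (-s * c) ≤ Real.exp (-s * Z x)}
  have hE := Real.exp_pos (s * c - s ^ 2 / 2)
  have hE' := Real.exp_pos (s ^ 2 / 2)
  calc M = Real.exp (s * c - s ^ 2 / 2) * ((Real.exp (-s * c) * M) * Real.exp (s ^ 2 / 2)) := by
        linear_combination (-M) * hexp
    _ ≤ _ := by
        refine mul_le_mul_of_nonneg_left ?_ hE.le
        exact (mul_le_mul_of_nonneg_right hm hE'.le).trans (h1.trans h2)

lemma tail_sep {α ν β I S : Type*} [Fintype α] [DecidableEq α] [Fintype ν] [DecidableEq ν]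
    [Fintype β] [DecidableEq β] [Fintype I] [DecidableEq I] [Nonempty I]
    [TopologicalSpace S] [TopologicalSpace.SeparableSpace S] [Nonempty S]
    (V : Matrix α ν ℝ) (hV : V * Vᵀ = 1) (u : S → I → α → ℝ) (w : S → β → ℝ)
    (uc : Continuous u) (wc : Continuous w)
    (hu : ∀ k i, rad (u k i) = 1) (hw : ∀ j, rad (w j) = 1) (s : ℝ) (hs : 0 < s) (a c : ℝ)
    (hY : ∀ j, ∀ g : α → ℝ, ∃ i, a * rad g ≤ ∑ p, g p * u j i p) :
    stdG (ν × β) {x | ∃ j, ∀ i, ∑ e, cX V (u j i) (w j) e * x e < c} ≤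
      ENNReal.ofReal (Real.exp (s * c - s ^ 2 / 2) *
        ((∫ g, Real.exp (-(s * a) * rad g) ∂stdG α) * ∫ h, Real.exp (s * rad h) ∂stdG β)) := by
  obtain ⟨d, hd⟩ := TopologicalSpace.exists_dense_seq S
  let E : ℕ → Set (ν × β → ℝ) := fun k =>
    {x | ∃ j : Fin (k + 1), ∀ i, ∑ e, cX V (u (d j) i) (w (d j)) e * x e < c}
  have hE : Monotone E := by
    rintro k l hkl x ⟨j, hj⟩
    exact ⟨⟨j, by omega⟩, hj⟩
  have hsub : {x | ∃ j, ∀ i, ∑ e, cX V (u j i) (w j) e * x e < c} ⊆ ⋃ k, E k := by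
    rintro x ⟨j, hj⟩
    have ho : IsOpen {j | ∀ i, ∑ e, cX V (u j i) (w j) e * x e < c} := by
      rw [Set.ofPred_forall]
      refine isOpen_iInter_of_finite fun i => isOpen_lt ?_ continuous_const
      simp only [cX, mulVec, dotProduct]
      fun_prop
    obtain ⟨k, hk⟩ := hd.exists_mem_open ho ⟨j, hj⟩
    exact Set.mem_iUnion.2 ⟨k, ⟨k, by omega⟩, hk⟩
  refine (measure_mono hsub).trans ?_
  rw [hE.measure_iUnion]
  refine iSup_le fun k => ?_
  exact tail_fin V hV (fun p : Fin (k + 1) × I => u (d p.1) p.2) (fun j => w (d j))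
    (fun _ => hu _ _) (fun _ => hw _) s hs a c (fun j g => hY (d j) g)

lemma rad_cont {κ : Type*} [Fintype κ] : Continuous (rad : (κ → ℝ) → ℝ) := by
  unfold rad; fun_prop

/-- The unit sphere. -/
def sph (κ : Type*) [Fintype κ] : Set (κ → ℝ) := {v | rad v = 1}

lemma sph_compact (κ : Type*) [Fintype κ] : IsCompact (sph κ) := by
  refine Metric.isCompact_of_isClosed_isBounded ?_ ?_
  · exact isClosed_eq rad_cont continuous_const
  · refine (Metric.isBounded_closedBall (x := (0 : κ → ℝ)) (r := 1)).subset fun v hv => ?_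
    rw [mem_closedBall_zero_iff, pi_norm_le_iff_of_nonneg zero_le_one]
    intro i
    have := coord_le_rad v i
    rwa [show rad v = 1 from hv] at this

lemma rad_smul {κ : Type*} [Fintype κ] (a : ℝ) (v : κ → ℝ) : rad (a • v) = |a| * rad v := by
  unfold rad
  rw [← Real.sqrt_sq_eq_abs, ← Real.sqrt_mul (sq_nonneg a), Finset.mul_sum]
  simp [mul_pow]

lemma rad_normalize {κ : Type*} [Fintype κ] (v : κ → ℝ) (hv : rad v ≠ 0) :
    rad ((rad v)⁻¹ • v) = 1 := by
  rw [rad_smul, abs_of_nonneg (inv_nonneg.2 (rad_nonneg v)), inv_mul_cancel₀ hv]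

lemma sph_nonempty (κ : Type*) [Fintype κ] [DecidableEq κ] [Nonempty κ] : (sph κ).Nonempty := by
  obtain ⟨k⟩ := ‹Nonempty κ›
  refine ⟨Pi.single k 1, ?_⟩
  change rad _ = 1
  unfold rad
  rw [Finset.sum_eq_single k] <;> simp +contextual

lemma exists_net (α : Type*) [Fintype α] [DecidableEq α] [Nonempty α] (ε : ℝ) (hε : 0 < ε) :
    ∃ t : Finset (sph α), t.Nonempty ∧ ∀ g : α → ℝ, ∃ i ∈ t, (1 - ε) * rad g ≤ ∑ p, g p * i.1 p := by
  obtain ⟨t, ht⟩ := (sph_compact α).elim_finite_subcover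
    (fun u : sph α => {g : α → ℝ | 1 - ε < ∑ p, g p * u.1 p})
    (fun u => isOpen_lt continuous_const (by fun_prop)) (by
      intro g hg
      refine Set.mem_iUnion.2 ⟨⟨g, hg⟩, ?_⟩
      have h1 := rad_sq g
      rw [show rad g = 1 from hg] at h1
      have : ∑ p, g p * g p = 1 := by simp only [← sq]; linarith
      change 1 - ε < ∑ p, g p * g p
      rw [this]; linarith)
  have key : ∀ g ∈ sph α, ∃ i ∈ t, 1 - ε < ∑ p, g p * i.1 p := by
    intro g hg
    simpa using ht hg
  obtain ⟨g0, hg0⟩ := sph_nonempty α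
  obtain ⟨i0, hi0, _⟩ := key g0 hg0
  refine ⟨t, ⟨i0, hi0⟩, fun g => ?_⟩
  by_cases h : rad g = 0
  · refine ⟨i0, hi0, ?_⟩
    have := dot_le_rad g i0.1 i0.2
    rw [h] at this ⊢
    have := abs_le.1 this
    linarith
  · obtain ⟨i, hi, h2⟩ := key _ (rad_normalize g h)
    refine ⟨i, hi, ?_⟩
    have h3 : ∑ p, ((rad g)⁻¹ • g) p * i.1 p = (rad g)⁻¹ * ∑ p, g p * i.1 p := by
      rw [Finset.mul_sum]; simp [mul_assoc]
    rw [h3] at h2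
    have hp : 0 < rad g := lt_of_le_of_ne (rad_nonneg g) (Ne.symm h)
    have := mul_le_mul_of_nonneg_left h2.le hp.le
    rw [mul_inv_cancel_left₀ h] at this
    linarith

/-- The Gaussian matrix. -/
def gmat {ν β : Type*} (x : ν × β → ℝ) : Matrix ν β ℝ := fun p q => x (p, q)

lemma cX_sum {α ν β : Type*} [Fintype α] [Fintype ν] [Fintype β] (V : Matrix α ν ℝ)
    (u : α → ℝ) (w : β → ℝ) (x : ν × β → ℝ) :
    ∑ e, cX V u w e * x e = ∑ i, (V *ᵥ (gmat x *ᵥ w)) i * u i := by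
  have : ∑ i, (V *ᵥ (gmat x *ᵥ w)) i * u i = ∑ p, (Vᵀ *ᵥ u) p * (gmat x *ᵥ w) p := by
    change (V *ᵥ (gmat x *ᵥ w)) ⬝ᵥ u = (Vᵀ *ᵥ u) ⬝ᵥ (gmat x *ᵥ w)
    rw [Matrix.mulVec_transpose, ← Matrix.dotProduct_mulVec, dotProduct_comm]
  rw [this, Fintype.sum_prod_type]
  refine Finset.sum_congr rfl fun p _ => ?_
  simp only [cX, gmat, mulVec, dotProduct, Finset.mul_sum]
  refine Finset.sum_congr rfl fun q _ => ?_
  ring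

lemma tail_upper {α ν β : Type*} [Fintype α] [DecidableEq α] [Nonempty α] [Fintype ν]
    [DecidableEq ν] [Fintype β] [DecidableEq β] [Nonempty β]
    (V : Matrix α ν ℝ) (hV : V * Vᵀ = 1) (v : ℝ) (hv : 0 < v)
    (hx : √((Fintype.card β : ℝ) / Fintype.card α) + v < 1) :
    stdG (ν × β) {x | ∃ w ∈ sph β, (Fintype.card α : ℝ) *
        (1 + 3 * (√((Fintype.card β : ℝ) / Fintype.card α) + v)) ≤
        rad (V *ᵥ (gmat x *ᵥ w)) ^ 2} ≤
      ENNReal.ofReal (Real.exp (-(Fintype.card α : ℝ) * v ^ 2 / 2)) := by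
  set m : ℝ := (Fintype.card α : ℝ) with hm
  set b : ℝ := (Fintype.card β : ℝ) with hb
  have m0 : 0 < m := by simp [hm, Fintype.card_pos]
  have b0 : 0 < b := by simp [hb, Fintype.card_pos]
  have sm : √m ^ 2 = m := Real.sq_sqrt m0.le
  have sm0 : 0 < √m := Real.sqrt_pos.2 m0
  have hbm : √m * √(b / m) = √b := by
    rw [← Real.sqrt_mul m0.le]; congr 1; field_simp
  set y := √(b / m) with hy
  have y0 : 0 ≤ y := Real.sqrt_nonneg _
  have : Nonempty (sph α) := (sph_nonempty α).to_subtype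
  have : Nonempty (sph β) := (sph_nonempty β).to_subtype
  have t0 : 0 < √m * v := by positivity
  have key := tail_sep (S := sph α × sph β) (I := Unit) V hV (fun s _ => s.1.1) (fun s => s.2.1)
    (by fun_prop) (by fun_prop) (fun s _ => s.1.2) (fun s => s.2.2) (√m * v) t0 (-1)
    (-(√m + √b + √m * v)) (fun s g => ⟨(), by
      have := abs_le.1 (dot_le_rad g s.1.1 s.1.2); linarith [this.1]⟩)
  refine (measure_mono ?_).trans (key.trans (ENNReal.ofReal_le_ofReal ?_))
  · rintro x ⟨w, hw, h⟩
    set z := V *ᵥ (gmat x *ᵥ w) with hz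
    have hc : √m + √b + √m * v < rad z := by
      refine lt_of_pow_lt_pow_left₀ 2 (rad_nonneg z) (lt_of_lt_of_le ?_ h)
      have : (√m + √b + √m * v) ^ 2 = m * (1 + (y + v)) ^ 2 := by
        rw [← hbm, ← sm, Real.sqrt_sq sm0.le]; ring
      rw [this]
      refine mul_lt_mul_of_pos_left ?_ m0
      nlinarith
    have hr : 0 < rad z := lt_trans (by positivity) hc
    refine ⟨(⟨-((rad z)⁻¹ • z), ?_⟩, ⟨w, hw⟩), fun _ => ?_⟩
    · change rad _ = 1
      rw [← neg_smul, rad_smul, abs_neg, abs_of_pos (inv_pos.2 hr), inv_mul_cancel₀ hr.ne']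
    · rw [cX_sum]
      have : ∑ i, z i * (-((rad z)⁻¹ • z)) i = - rad z := by
        have h2 : ∑ i, z i * (-((rad z)⁻¹ • z)) i = -((rad z)⁻¹ * ∑ i, z i ^ 2) := by
          rw [Finset.mul_sum, ← Finset.sum_neg_distrib]
          refine Finset.sum_congr rfl fun i _ => ?_
          simp; ring
        rw [h2, ← rad_sq]; field_simp
      change ∑ i, z i * (-((rad z)⁻¹ • z)) i < _
      rw [this]; linarith
  · have c1 := chi_upper (κ := α) (√m * v) t0
    have c2 := chi_upper (κ := β) (√m * v) t0
    rw [mul_neg_one, neg_neg]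
    have : Real.exp (-m * v ^ 2 / 2) = Real.exp (√m * v * -(√m + √b + √m * v) - (√m * v) ^ 2 / 2) *
      (Real.exp (√m * v * √m + (√m * v) ^ 2 / 2) * Real.exp (√m * v * √b + (√m * v) ^ 2 / 2)) := by
      rw [← Real.exp_add, ← Real.exp_add]; congr 1
      nlinarith
    rw [this]
    gcongr

lemma tail_lower {α ν β : Type*} [Fintype α] [DecidableEq α] [Nonempty α] [Fintype ν]
    [DecidableEq ν] [Fintype β] [DecidableEq β] [Nonempty β]
    (V : Matrix α ν ℝ) (hV : V * Vᵀ = 1) (v : ℝ) (hv : 0 < v)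
    (hx : √((Fintype.card β : ℝ) / Fintype.card α) + v < 1) :
    stdG (ν × β) {x | ∃ w ∈ sph β, rad (V *ᵥ (gmat x *ᵥ w)) ^ 2 ≤ (Fintype.card α : ℝ) *
        (1 - 3 * (√((Fintype.card β : ℝ) / Fintype.card α) + v))} ≤
      ENNReal.ofReal (Real.exp (-(Fintype.card α : ℝ) * v ^ 2 / 2)) := by
  set m : ℝ := (Fintype.card α : ℝ) with hm
  set b : ℝ := (Fintype.card β : ℝ) with hb
  have m0 : 0 < m := by simp [hm, Fintype.card_pos]
  have b1 : 1 ≤ b := by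
    have : 1 ≤ Fintype.card β := Fintype.card_pos
    rw [hb]; exact_mod_cast this
  have sm : √m ^ 2 = m := Real.sq_sqrt m0.le
  have sm0 : 0 < √m := Real.sqrt_pos.2 m0
  have hbm : √m * √(b / m) = √b := by
    rw [← Real.sqrt_mul m0.le]; congr 1; field_simp
  have sb1 : 1 ≤ √b := Real.one_le_sqrt.2 b1
  set y := √(b / m) with hy
  have y0 : 0 ≤ y := Real.sqrt_nonneg _
  have : Nonempty (sph β) := (sph_nonempty β).to_subtype
  have t0 : 0 < √m * v := by positivity
  obtain ⟨U, hU, hnet⟩ := exists_net α (v / 2) (by linarith)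
  have : Nonempty U := hU.to_subtype
  classical
  have key := tail_sep (S := sph β) (I := U) V hV (fun _ i => i.1.1) (fun s => s.1)
    (by fun_prop) (by fun_prop) (fun _ i => i.1.2) (fun s => s.2) (√m * v) t0 (1 - v / 2)
    (√m * (1 - 3 / 2 * (y + v))) (fun s g => by
      obtain ⟨i, hi, h⟩ := hnet g
      exact ⟨⟨i, hi⟩, h⟩)
  refine (measure_mono ?_).trans (key.trans (ENNReal.ofReal_le_ofReal ?_))
  · rintro x ⟨w, hw, h⟩
    refine ⟨⟨w, hw⟩, fun i => ?_⟩
    rw [cX_sum]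
    set z := V *ᵥ (gmat x *ᵥ w) with hz
    have h3 := (abs_le.1 (dot_le_rad z i.1.1 i.1.2)).2
    refine h3.trans_lt ?_
    have hp : 0 ≤ 1 - 3 * (y + v) := by
      by_contra hneg
      push Not at hneg
      have := mul_neg_of_pos_of_neg m0 hneg
      nlinarith [sq_nonneg (rad z)]
    refine lt_of_pow_lt_pow_left₀ 2 (mul_nonneg sm0.le (by linarith)) (lt_of_le_of_lt h ?_)
    rw [mul_pow, sm]
    refine mul_lt_mul_of_pos_left ?_ m0
    have : 0 < (y + v) ^ 2 := by positivity
    nlinarith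
  · have hv1 : v < 1 := by linarith
    have t1 : 0 ≤ √m * v * (1 - v / 2) := mul_nonneg t0.le (by linarith)
    have c1 := chi_lower (κ := α) (√m * v * (1 - v / 2)) t1
    have c2 := chi_upper (κ := β) (√m * v) t0
    refine (mul_le_mul_of_nonneg_left (mul_le_mul c1 c2
      (integral_nonneg fun _ => (Real.exp_pos _).le) (Real.exp_pos _).le)
      (Real.exp_pos _).le).trans ?_
    rw [← Real.exp_add, ← Real.exp_add]
    refine Real.exp_le_exp.2 ?_
    rw [← hm, ← hb]
    set s := √m * v with hs
    have e1 : s * (√m * (1 - 3 / 2 * (y + v))) = s * √m - 3 / 2 * (s * √b) - 3 / 2 * s ^ 2 := by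
      rw [← hbm, hs]; ring
    have e2 : -m * v ^ 2 / 2 = - s ^ 2 / 2 := by rw [hs, mul_pow, sm]; ring
    have e3 : s * √m * v = s ^ 2 := by rw [hs]; ring
    rw [e1, e2]
    have a1 : s ≤ s * √b := by nlinarith
    have a2 : (s * (1 - v / 2)) ^ 2 ≤ s ^ 2 := by
      refine pow_le_pow_left₀ t1 ?_ 2
      nlinarith
    nlinarith [mul_pos t0 hv]

lemma rad_eq_norm {κ : Type*} [Fintype κ] (x : EuclideanSpace ℝ κ) : rad x.ofLp = ‖x‖ := by
  rw [EuclideanSpace.norm_eq, rad]; simp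

lemma spec_exists {β : Type*} [Fintype β] [DecidableEq β] [Nonempty β] (A : Matrix β β ℝ)
    (hA : Aᵀ = A) (T : ℝ) (hT : T ≤ specNorm A) :
    ∃ w ∈ sph β, T ≤ |(A *ᵥ w) ⬝ᵥ w| := by
  obtain ⟨w0, hw0, hmax⟩ := (sph_compact β).exists_isMaxOn (sph_nonempty β)
    (f := fun w => |(A *ᵥ w) ⬝ᵥ w|) (by
      refine Continuous.continuousOn ?_
      simp only [mulVec, dotProduct]
      fun_prop)
  refine ⟨w0, hw0, hT.trans ?_⟩
  unfold specNorm
  have hinner : ∀ x y : EuclideanSpace ℝ β,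
      inner ℝ (LinearMap.toContinuousLinearMap (Matrix.toEuclideanLin A) x) y =
        (A *ᵥ x.ofLp) ⬝ᵥ y.ofLp := by
    intro x y
    rw [LinearMap.coe_toContinuousLinearMap', Matrix.toLpLin_apply,
      EuclideanSpace.inner_eq_star_dotProduct]
    simp [dotProduct_comm]
  rw [ContinuousLinearMap.norm_eq_iSup_rayleighQuotient]
  · refine ciSup_le fun x => ?_
    unfold ContinuousLinearMap.rayleighQuotient ContinuousLinearMap.reApplyInnerSelf
    rw [hinner, ← rad_eq_norm]
    change |((A *ᵥ x.ofLp) ⬝ᵥ x.ofLp) / rad x.ofLp ^ 2| ≤ _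
    by_cases h : rad x.ofLp = 0
    · simp [h]
    · have h2 := hmax (rad_normalize _ h)
      change |(A *ᵥ ((rad x.ofLp)⁻¹ • x.ofLp)) ⬝ᵥ ((rad x.ofLp)⁻¹ • x.ofLp)| ≤ _ at h2
      rw [mulVec_smul, smul_dotProduct, dotProduct_smul] at h2
      refine le_of_eq_of_le ?_ h2
      congr 1
      simp only [smul_eq_mul]
      field_simp
  · intro x y
    have h1 := hinner x y
    have h2 := hinner y x
    rw [real_inner_comm] at h2
    change inner ℝ (LinearMap.toContinuousLinearMap (Matrix.toEuclideanLin A) x) y =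
      inner ℝ x (LinearMap.toContinuousLinearMap (Matrix.toEuclideanLin A) y)
    rw [h1, h2, dotProduct_comm, Matrix.dotProduct_mulVec, ← Matrix.mulVec_transpose, hA]

lemma closed_exists {X Y : Type*} [TopologicalSpace X] [TopologicalSpace Y] {K : Set Y}
    (hK : IsCompact K) (p : X → Y → Prop) (hp : IsClosed {z : X × Y | p z.1 z.2}) :
    IsClosed {x | ∃ y ∈ K, p x y} := by
  have := isCompact_iff_compactSpace.1 hK
  have h := isClosedMap_fst_of_compactSpace (X := X) (Y := K) {z : X × K | p z.1 z.2.1}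
    (hp.preimage (f := fun z : X × K => (z.1, z.2.1)) (by fun_prop))
  convert h using 1
  ext x
  simp

lemma rad_dot {κ : Type*} [Fintype κ] (x : κ → ℝ) : rad x ^ 2 = x ⬝ᵥ x := by
  rw [rad_sq]; simp [dotProduct, sq]

lemma gram_quad {n : ℕ} {β : Type*} [Fintype β] [DecidableEq β] (M : Matrix (Fin n) β ℝ) (a : ℝ)
    (w : β → ℝ) (hw : w ∈ sph β) :
    ((a • (Mᵀ * M) - 1) *ᵥ w) ⬝ᵥ w = a * rad (M *ᵥ w) ^ 2 - 1 := by
  have h1 : w ⬝ᵥ w = 1 := by rw [← rad_dot, show rad w = 1 from hw]; norm_num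
  rw [sub_mulVec, smul_mulVec, one_mulVec, sub_dotProduct, smul_dotProduct, h1, rad_dot,
    ← mulVec_mulVec, Matrix.mulVec_transpose, ← dotProduct_mulVec, smul_eq_mul]

lemma exists_rot {N : ℕ} (B : Finset (Fin N)) (G : Matrix (Fin N) {j // j ∈ B} ℝ)
    (hG : ∀ w ∈ sph {j // j ∈ B}, rad (G *ᵥ w) ≠ 0) :
    ∃ O : Matrix (Fin N) (Fin N) ℝ, O * Oᵀ = 1 ∧ ∀ w ∈ sph {j // j ∈ B},
      ∃ c, subCols O B *ᵥ w = G *ᵥ c ∧ rad (G *ᵥ c) = 1 := by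
  let L := Matrix.toEuclideanLin G
  have hL : Function.Injective L := by
    rw [← LinearMap.ker_eq_bot, LinearMap.ker_eq_bot']
    intro x hx
    by_contra h0
    have hr : rad x.ofLp ≠ 0 := by rw [rad_eq_norm]; simpa using h0
    apply hG _ (rad_normalize _ hr)
    rw [mulVec_smul]
    have : G *ᵥ x.ofLp = 0 := by
      have := congrArg WithLp.ofLp hx
      simpa [L, Matrix.toLpLin_apply] using this
    rw [this]; simp [rad]
  have hfr : Module.finrank ℝ L.range = Fintype.card {j // j ∈ B} := by
    rw [LinearMap.finrank_range_of_inj hL]; simp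
  let e := (stdOrthonormalBasis ℝ L.range).reindex
    ((finCongr hfr).trans (Fintype.equivFin _).symm)
  let v : Fin N → EuclideanSpace ℝ (Fin N) := fun j =>
    if h : j ∈ B then (e ⟨j, h⟩ : EuclideanSpace ℝ (Fin N)) else 0
  have hv : ∀ j : {j // j ∈ B}, v j.1 = (e j : EuclideanSpace ℝ (Fin N)) := by
    rintro ⟨j, h⟩
    simp [v, h]
  have hon : Orthonormal ℝ (Set.domRestrict {j | j ∈ B} v) := by
    have h1 : Orthonormal ℝ (fun j => (e j : EuclideanSpace ℝ (Fin N))) :=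
      e.orthonormal.comp_linearIsometry L.range.subtypeₗᵢ
    have : Set.domRestrict {j | j ∈ B} v = fun j => (e j : EuclideanSpace ℝ (Fin N)) := by
      funext j
      exact hv j
    rw [this]; exact h1
  obtain ⟨f, hf⟩ := hon.exists_orthonormalBasis_extension_of_card_eq (by simp)
  let O : Matrix (Fin N) (Fin N) ℝ := fun p j => (f j).ofLp p
  have hO : Oᵀ * O = 1 := by
    ext i j
    have h1 := orthonormal_iff_ite.1 f.orthonormal i j
    rw [EuclideanSpace.inner_eq_star_dotProduct] at h1
    rw [Matrix.mul_apply, Matrix.one_apply, ← h1]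
    refine Finset.sum_congr rfl fun p _ => ?_
    exact mul_comm _ _
  refine ⟨O, mul_eq_one_comm.1 hO, fun w hw => ?_⟩
  have hmem : (∑ j, w j • (e j : EuclideanSpace ℝ (Fin N))) ∈ L.range :=
    Submodule.sum_mem _ fun j _ => Submodule.smul_mem _ _ (e j).2
  obtain ⟨c, hc⟩ := hmem
  have hcol : subCols O B *ᵥ w = G *ᵥ c.ofLp := by
    have h1 : G *ᵥ c.ofLp = (∑ j, w j • (e j : EuclideanSpace ℝ (Fin N))).ofLp := by
      rw [← hc]; simp [L, Matrix.toLpLin_apply]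
    rw [h1]
    funext p
    simp only [mulVec, dotProduct, subCols, O, WithLp.ofLp_sum, WithLp.ofLp_smul,
      Finset.sum_apply, Pi.smul_apply, smul_eq_mul]
    refine Finset.sum_congr rfl fun j _ => ?_
    rw [hf j.1 j.2, hv j, mul_comm]
  refine ⟨c.ofLp, hcol, ?_⟩
  rw [← hcol]
  have hsub : (subCols O B)ᵀ * subCols O B = 1 := by
    ext i j
    have := congrFun (congrFun hO i.1) j.1
    simp only [Matrix.mul_apply, Matrix.one_apply, transpose_apply, subCols] at this ⊢
    rw [this]
    by_cases hij : i = j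
    · simp [hij]
    · rw [if_neg hij, if_neg fun h => hij (Subtype.ext h)]
  have h2 : rad (subCols O B *ᵥ w) ^ 2 = 1 := by
    rw [rad_dot, Matrix.dotProduct_mulVec, ← Matrix.mulVec_transpose, mulVec_mulVec, hsub,
      one_mulVec, ← rad_dot, show rad w = 1 from hw, one_pow]
  have := rad_nonneg (subCols O B *ᵥ w)
  nlinarith

lemma final_alg (n N x y z A Q r : ℝ) (hn : 0 < n) (hN : 0 < N) (hz : z < 1 / 3) (hx : 0 < x)
    (hy : 0 < y) (hr : 0 < r) (hrQ : r * Q = 1)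
    (a1 : A < n * (1 + 3 * x)) (a2 : n * (1 - 3 * x) < A)
    (q1 : Q < N * (1 + 3 * y)) (q2 : N * (1 - 3 * y) < Q) (q3 : N * (1 - 3 * z) < Q) :
    |N / n * (r * A) - 1| < (3 * x + 3 * y) / (1 - 3 * z) := by
  have hz' : 0 < 1 - 3 * z := by linarith
  have e : N / n * (r * A) - 1 = r * (N * (A / n) - Q) := by
    rw [mul_sub, hrQ]; field_simp
  have b1 : A / n < 1 + 3 * x := by rw [div_lt_iff₀ hn]; linarith
  have b2 : 1 - 3 * x < A / n := by rw [lt_div_iff₀ hn]; linarith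
  have hin : |N * (A / n) - Q| ≤ N * (3 * x + 3 * y) := by
    rw [abs_le]
    have c1 := mul_lt_mul_of_pos_left b1 hN
    have c2 := mul_lt_mul_of_pos_left b2 hN
    constructor <;> nlinarith
  have hrN : r * N < 1 / (1 - 3 * z) := by
    rw [lt_div_iff₀ hz', mul_assoc]
    exact (mul_lt_mul_of_pos_left q3 hr).trans_eq hrQ
  rw [e, abs_mul, abs_of_pos hr]
  calc r * |N * (A / n) - Q| ≤ r * (N * (3 * x + 3 * y)) := mul_le_mul_of_nonneg_left hin hr.le
    _ = (r * N) * (3 * x + 3 * y) := by ring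
    _ < 1 / (1 - 3 * z) * (3 * x + 3 * y) := mul_lt_mul_of_pos_right hrN (by linarith)
    _ = _ := by ring

/-- Some unit direction is stretched too much. -/
def hiP {α ν β : Type*} [Fintype α] [Fintype ν] [Fintype β] (a : ℝ) (V : Matrix α ν ℝ)
    (x : ν × β → ℝ) : Prop := ∃ w ∈ sph β, a ≤ rad (V *ᵥ (gmat x *ᵥ w)) ^ 2

/-- Some unit direction is contracted too much. -/
def loP {α ν β : Type*} [Fintype α] [Fintype ν] [Fintype β] (a : ℝ) (V : Matrix α ν ℝ)
    (x : ν × β → ℝ) : Prop := ∃ w ∈ sph β, rad (V *ᵥ (gmat x *ᵥ w)) ^ 2 ≤ a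

lemma rad_sq_cont (α ν β : Type*) [Fintype α] [Fintype ν] [Fintype β] :
    Continuous fun z : ((α → ν → ℝ) × (ν × β → ℝ)) × (β → ℝ) =>
      rad ((z.1.1 : Matrix α ν ℝ) *ᵥ (gmat z.1.2 *ᵥ z.2)) ^ 2 := by
  have h : Continuous fun z : ((α → ν → ℝ) × (ν × β → ℝ)) × (β → ℝ) =>
      ((z.1.1 : Matrix α ν ℝ) *ᵥ (gmat z.1.2 *ᵥ z.2)) := by
    refine continuous_pi fun i => ?_
    simp only [mulVec, dotProduct, gmat]
    fun_prop
  exact (rad_cont.comp h).pow 2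

lemma hiP_meas {α ν β : Type*} [Fintype α] [Fintype ν] [Fintype β] (a : ℝ) :
    MeasurableSet {z : Matrix α ν ℝ × (ν × β → ℝ) | hiP a z.1 z.2} := by
  have h : IsClosed {z : (α → ν → ℝ) × (ν × β → ℝ) | hiP a (z.1 : Matrix α ν ℝ) z.2} :=
    closed_exists (sph_compact β)
      (fun (z : (α → ν → ℝ) × (ν × β → ℝ)) w =>
        a ≤ rad ((z.1 : Matrix α ν ℝ) *ᵥ (gmat z.2 *ᵥ w)) ^ 2)
      (isClosed_le continuous_const (rad_sq_cont α ν β))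
  exact h.measurableSet

lemma loP_meas {α ν β : Type*} [Fintype α] [Fintype ν] [Fintype β] (a : ℝ) :
    MeasurableSet {z : Matrix α ν ℝ × (ν × β → ℝ) | loP a z.1 z.2} := by
  have h : IsClosed {z : (α → ν → ℝ) × (ν × β → ℝ) | loP a (z.1 : Matrix α ν ℝ) z.2} :=
    closed_exists (sph_compact β)
      (fun (z : (α → ν → ℝ) × (ν × β → ℝ)) w =>
        rad ((z.1 : Matrix α ν ℝ) *ᵥ (gmat z.2 *ᵥ w)) ^ 2 ≤ a)
      (isClosed_le (rad_sq_cont α ν β) continuous_const)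
  exact h.measurableSet

/-- The event for the submatrix. -/
def devSet {n N : ℕ} (B : Finset (Fin N)) (T a : ℝ) : Set (Matrix (Fin n) (Fin N) ℝ) :=
  {M | ∃ w ∈ sph {j // j ∈ B}, T ≤ |a * rad (subCols M B *ᵥ w) ^ 2 - 1|}

lemma devSet_meas {n N : ℕ} (B : Finset (Fin N)) (T a : ℝ) :
    MeasurableSet (devSet (n := n) B T a) := by
  have h : IsClosed {M : Fin n → Fin N → ℝ | ∃ w ∈ sph {j // j ∈ B},
      T ≤ |a * rad (subCols (M : Matrix (Fin n) (Fin N) ℝ) B *ᵥ w) ^ 2 - 1|} := by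
    refine closed_exists (sph_compact _)
      (fun (M : Fin n → Fin N → ℝ) w =>
        T ≤ |a * rad (subCols (M : Matrix (Fin n) (Fin N) ℝ) B *ᵥ w) ^ 2 - 1|)
      (isClosed_le continuous_const ?_)
    have : Continuous fun z : (Fin n → Fin N → ℝ) × ({j // j ∈ B} → ℝ) =>
        rad (subCols (z.1 : Matrix (Fin n) (Fin N) ℝ) B *ᵥ z.2) := by
      have h : Continuous fun z : (Fin n → Fin N → ℝ) × ({j // j ∈ B} → ℝ) =>
          (subCols (z.1 : Matrix (Fin n) (Fin N) ℝ) B *ᵥ z.2) := by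
        refine continuous_pi fun i => ?_
        simp only [mulVec, dotProduct, subCols]
        fun_prop
      exact rad_cont.comp h
    fun_prop
  exact h.measurableSet

/-- The union of the bad events. -/
def bad {n N : ℕ} {β : Type*} [Fintype β] (x y z : ℝ) (V : Matrix (Fin n) (Fin N) ℝ)
    (g : Fin N × β → ℝ) : Prop :=
  ((hiP (n * (1 + 3 * x)) V g ∨ loP (n * (1 - 3 * x)) V g) ∨
   (hiP (N * (1 + 3 * y)) (1 : Matrix (Fin N) (Fin N) ℝ) g ∨
    loP (N * (1 - 3 * y)) (1 : Matrix (Fin N) (Fin N) ℝ) g)) ∨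
   loP (N * (1 - 3 * z)) (1 : Matrix (Fin N) (Fin N) ℝ) g

lemma bad_meas {n N : ℕ} {β : Type*} [Fintype β] (x y z : ℝ) :
    MeasurableSet {p : Matrix (Fin n) (Fin N) ℝ × (Fin N × β → ℝ) | bad x y z p.1 p.2} := by
  have hm : Measurable fun p : Matrix (Fin n) (Fin N) ℝ × (Fin N × β → ℝ) =>
      ((1 : Matrix (Fin N) (Fin N) ℝ), p.2) := measurable_const.prodMk measurable_snd
  exact (((hiP_meas _).union (loP_meas _)).union
    ((hm (hiP_meas _)).union (hm (loP_meas _)))).union (hm (loP_meas _))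

lemma bad_prob {n N : ℕ} {β : Type*} [Fintype β] [DecidableEq β] [Nonempty β]
    (hn : 0 < n) (hN : 0 < N) (V : Matrix (Fin n) (Fin N) ℝ) (hV : V * Vᵀ = 1)
    (v₁ v₂ v₃ : ℝ) (hv₁ : 0 < v₁) (hv₂ : 0 < v₂) (hv₃ : 0 < v₃) (b : ℕ) (hb : Fintype.card β = b)
    (h₁ : √((b : ℝ) / n) + v₁ < 1) (h₂ : √((b : ℝ) / N) + v₂ < 1)
    (h₃ : √((b : ℝ) / N) + v₃ < 1 / 3) :
    stdG (Fin N × β) {g | bad (√((b : ℝ) / n) + v₁) (√((b : ℝ) / N) + v₂) (√((b : ℝ) / N) + v₃) V g}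
      ≤ ENNReal.ofReal (2 * Real.exp (-(n : ℝ) * v₁ ^ 2 / 2)
          + 2 * Real.exp (-(N : ℝ) * v₂ ^ 2 / 2) + Real.exp (-(N : ℝ) * v₃ ^ 2 / 2)) := by
  have : Nonempty (Fin n) := ⟨⟨0, hn⟩⟩
  have : Nonempty (Fin N) := ⟨⟨0, hN⟩⟩
  have one : (1 : Matrix (Fin N) (Fin N) ℝ) * (1 : Matrix (Fin N) (Fin N) ℝ)ᵀ = 1 := by simp
  have t1 := tail_upper (β := β) V hV v₁ hv₁ (by simpa [hb] using h₁)
  have t2 := tail_lower (β := β) V hV v₁ hv₁ (by simpa [hb] using h₁)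
  have t3 := tail_upper (β := β) (1 : Matrix (Fin N) (Fin N) ℝ) one v₂ hv₂ (by simpa [hb] using h₂)
  have t4 := tail_lower (β := β) (1 : Matrix (Fin N) (Fin N) ℝ) one v₂ hv₂ (by simpa [hb] using h₂)
  have t5 := tail_lower (β := β) (1 : Matrix (Fin N) (Fin N) ℝ) one v₃ hv₃
    (by have : √((b : ℝ) / N) + v₃ < 1 := by linarith
        simpa [hb] using this)
  rw [Fintype.card_fin, hb] at t1 t2 t3 t4 t5
  have e : ENNReal.ofReal (2 * Real.exp (-(n : ℝ) * v₁ ^ 2 / 2)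
          + 2 * Real.exp (-(N : ℝ) * v₂ ^ 2 / 2) + Real.exp (-(N : ℝ) * v₃ ^ 2 / 2)) =
      ((ENNReal.ofReal (Real.exp (-(n : ℝ) * v₁ ^ 2 / 2)) +
        ENNReal.ofReal (Real.exp (-(n : ℝ) * v₁ ^ 2 / 2))) +
       (ENNReal.ofReal (Real.exp (-(N : ℝ) * v₂ ^ 2 / 2)) +
        ENNReal.ofReal (Real.exp (-(N : ℝ) * v₂ ^ 2 / 2)))) +
        ENNReal.ofReal (Real.exp (-(N : ℝ) * v₃ ^ 2 / 2)) := by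
    rw [← ENNReal.ofReal_add, ← ENNReal.ofReal_add, ← ENNReal.ofReal_add, ← ENNReal.ofReal_add]
    · congr 1; ring
    all_goals positivity
  rw [e]
  refine (measure_union_le _ _).trans (add_le_add ?_ t5)
  refine (measure_union_le _ _).trans (add_le_add ?_ ?_)
  · exact (measure_union_le _ _).trans (add_le_add t1 t2)
  · exact (measure_union_le _ _).trans (add_le_add t3 t4)

lemma dev_le {Ω : Type*} [MeasurableSpace Ω] (P : Measure Ω) [IsProbabilityMeasure P]
    {n N : ℕ} (hn : 0 < n) (hN : 0 < N) (V : Ω → Matrix (Fin n) (Fin N) ℝ)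
    (hV : IsUniformStiefel P V) (B : Finset (Fin N)) (x y z : ℝ) (hx : 0 < x) (hy : 0 < y)
    (hz : z < 1 / 3) (g : Fin N × {j // j ∈ B} → ℝ) :
    P {ω | V ω ∈ devSet B ((3 * x + 3 * y) / (1 - 3 * z)) ((N : ℝ) / n)} ≤
      P {ω | bad x y z (V ω) g} := by
  have hn' : (0 : ℝ) < n := by exact_mod_cast hn
  have hN' : (0 : ℝ) < N := by exact_mod_cast hN
  by_cases hlo : loP (N * (1 - 3 * z)) (1 : Matrix (Fin N) (Fin N) ℝ) g
  · exact measure_mono fun ω _ => Or.inr hlo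
  have hq : ∀ w ∈ sph {j // j ∈ B}, N * (1 - 3 * z) < rad (gmat g *ᵥ w) ^ 2 := by
    intro w hw
    by_contra hcon
    exact hlo ⟨w, hw, by rw [one_mulVec]; exact not_lt.1 hcon⟩
  obtain ⟨O, hO, hrot⟩ := exists_rot B (gmat g) (by
    intro w hw h0
    have := hq w hw
    rw [h0] at this
    have : 0 < (N : ℝ) * (1 - 3 * z) := mul_pos hN' (by linarith)
    nlinarith)
  have hVm := hV.1
  have hVOm : Measurable fun ω => V ω * O := by
    refine measurable_pi_iff.2 fun i => measurable_pi_iff.2 fun j => ?_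
    have hij : ∀ k, Measurable fun ω => V ω i k := fun k =>
      (measurable_pi_apply k).comp ((measurable_pi_apply i).comp hVm)
    simp only [Matrix.mul_apply]
    exact Finset.measurable_fun_sum _ fun k _ => (hij k).mul_const _
  have hinv : P {ω | V ω ∈ devSet B ((3 * x + 3 * y) / (1 - 3 * z)) ((N : ℝ) / n)} =
      P {ω | V ω * O ∈ devSet B ((3 * x + 3 * y) / (1 - 3 * z)) ((N : ℝ) / n)} := by
    have h := congrArg (fun μ => μ (devSet B ((3 * x + 3 * y) / (1 - 3 * z)) ((N : ℝ) / n)))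
      (hV.2.2 O hO)
    rw [Measure.map_apply hVOm (devSet_meas _ _ _), Measure.map_apply hVm (devSet_meas _ _ _)] at h
    exact h.symm
  rw [hinv]
  refine measure_mono ?_
  rintro ω ⟨w, hw, hT⟩
  by_contra hbad
  have hnb : ¬ bad x y z (V ω) g := hbad
  unfold bad at hnb
  push Not at hnb
  obtain ⟨⟨⟨b1, b2⟩, b3, b4⟩, b5⟩ := hnb
  obtain ⟨c, hc, hc1⟩ := hrot w hw
  have hcol : subCols (V ω * O) B *ᵥ w = V ω *ᵥ (gmat g *ᵥ c) := by
    rw [← hc, mulVec_mulVec]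
    congr 1
  have hr : rad c ≠ 0 := by
    intro h0
    have : c = 0 := by
      funext j
      have := coord_le_rad c j
      rw [h0] at this
      simpa using this
    rw [this, mulVec_zero] at hc1
    simp [rad] at hc1
  have hrp : 0 < rad c := lt_of_le_of_ne (rad_nonneg c) (Ne.symm hr)
  set c' := (rad c)⁻¹ • c with hc'
  have hcc : c = rad c • c' := by rw [hc', smul_smul, mul_inv_cancel₀ hr, one_smul]
  have hs : c' ∈ sph {j // j ∈ B} := rad_normalize c hr
  have e1 : rad (V ω *ᵥ (gmat g *ᵥ c)) ^ 2 = rad c ^ 2 * rad (V ω *ᵥ (gmat g *ᵥ c')) ^ 2 := by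
    conv_lhs => rw [hcc, mulVec_smul, mulVec_smul, rad_smul, mul_pow, sq_abs]
  have e2 : rad c ^ 2 * rad (gmat g *ᵥ c') ^ 2 = 1 := by
    have : rad (gmat g *ᵥ c) = |rad c| * rad (gmat g *ᵥ c') := by
      conv_lhs => rw [hcc, mulVec_smul, rad_smul]
    rw [hc1] at this
    rw [← sq_abs (rad c), ← mul_pow, ← this, one_pow]
  have f1 : rad (V ω *ᵥ (gmat g *ᵥ c')) ^ 2 < n * (1 + 3 * x) := by
    by_contra h; exact b1 ⟨c', hs, not_lt.1 h⟩
  have f2 : n * (1 - 3 * x) < rad (V ω *ᵥ (gmat g *ᵥ c')) ^ 2 := by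
    by_contra h; exact b2 ⟨c', hs, not_lt.1 h⟩
  have f3 : rad (gmat g *ᵥ c') ^ 2 < N * (1 + 3 * y) := by
    by_contra h; exact b3 ⟨c', hs, by rw [one_mulVec]; exact not_lt.1 h⟩
  have f4 : N * (1 - 3 * y) < rad (gmat g *ᵥ c') ^ 2 := by
    by_contra h; exact b4 ⟨c', hs, by rw [one_mulVec]; exact not_lt.1 h⟩
  have := final_alg n N x y z _ _ _ hn' hN' hz hx hy (by positivity) e2 f1 f2 f3 f4 (hq c' hs)
  rw [← e1, ← hcol] at this
  linarith

/-- **Lemma S.1 (Jia & Rohe).** If `V` is uniform on the Stiefel manifold `V(n, N)`,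
`V_B` consists of `b` of its columns, and `N − b ≥ n`, then for admissible `v₁ v₂ v₃`
the spectral norm of `(N/n)·V_Bᵀ V_B − I_b` exceeds the stated threshold with
probability at most `2 exp(−n v₁²/2) + 2 exp(−N v₂²/2) + exp(−N v₃²/2)`. -/
theorem stiefel_submatrix_gram_concentration
    {Ω : Type*} [MeasurableSpace Ω] (P : Measure Ω) [IsProbabilityMeasure P]
    (n N b : ℕ) (V : Ω → Matrix (Fin n) (Fin N) ℝ)
    (hV : IsUniformStiefel P V)
    (B : Finset (Fin N)) (hB : B.card = b)
    (hNbn : n + b ≤ N)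
    (v₁ v₂ v₃ : ℝ) (hv₁ : 0 < v₁) (hv₂ : 0 < v₂) (hv₃ : 0 < v₃)
    (h₁ : Real.sqrt ((b : ℝ) / n) + v₁ < 1)
    (h₂ : Real.sqrt ((b : ℝ) / N) + v₂ < 1)
    (h₃ : Real.sqrt ((b : ℝ) / N) + v₃ < 1 / 3) :
    P {ω | (3 * (Real.sqrt ((b : ℝ) / n) + v₁) + 3 * (Real.sqrt ((b : ℝ) / N) + v₂))
            / (1 - 3 * (Real.sqrt ((b : ℝ) / N) + v₃))
          ≤ specNorm (((N : ℝ) / n) • ((subCols (V ω) B)ᵀ * subCols (V ω) B) - 1)}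
      ≤ ENNReal.ofReal (2 * Real.exp (-(n : ℝ) * v₁ ^ 2 / 2)
          + 2 * Real.exp (-(N : ℝ) * v₂ ^ 2 / 2) + Real.exp (-(N : ℝ) * v₃ ^ 2 / 2)) := by
  have p1 : 0 < √((b : ℝ) / n) + v₁ := by positivity
  have p2 : 0 < √((b : ℝ) / N) + v₂ := by positivity
  rcases Nat.eq_zero_or_pos n with hn0 | hn
  · refine prob_le_one.trans ?_
    rw [← ENNReal.ofReal_one]
    refine ENNReal.ofReal_le_ofReal ?_
    have e : Real.exp (-(n : ℝ) * v₁ ^ 2 / 2) = 1 := by simp [hn0]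
    rw [e]
    have := Real.exp_pos (-(N : ℝ) * v₂ ^ 2 / 2)
    have := Real.exp_pos (-(N : ℝ) * v₃ ^ 2 / 2)
    linarith
  have hN : 0 < N := by omega
  rcases B.eq_empty_or_nonempty with hBe | hBne
  · have hT : 0 < (3 * (√((b : ℝ) / n) + v₁) + 3 * (√((b : ℝ) / N) + v₂)) /
        (1 - 3 * (√((b : ℝ) / N) + v₃)) := div_pos (by linarith) (by linarith)
    subst hBe
    have hz : ∀ A : Matrix {j : Fin N // j ∈ (∅ : Finset (Fin N))}
        {j : Fin N // j ∈ (∅ : Finset (Fin N))} ℝ, specNorm A = 0 := by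
      intro A
      have : A = 0 := by ext i; exact absurd i.2 (Finset.notMem_empty _)
      rw [this]; simp [specNorm]
    have : ∀ ω, ¬ ((3 * (√((b : ℝ) / n) + v₁) + 3 * (√((b : ℝ) / N) + v₂)) /
        (1 - 3 * (√((b : ℝ) / N) + v₃)) ≤ specNorm (((N : ℝ) / n) •
          ((subCols (V ω) ∅)ᵀ * subCols (V ω) ∅) - 1)) := by
      intro ω h
      rw [hz] at h
      linarith
    have hem : {ω | (3 * (√((b : ℝ) / n) + v₁) + 3 * (√((b : ℝ) / N) + v₂)) /
        (1 - 3 * (√((b : ℝ) / N) + v₃)) ≤ specNorm (((N : ℝ) / n) •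
          ((subCols (V ω) ∅)ᵀ * subCols (V ω) ∅) - 1)} = ∅ :=
      Set.eq_empty_iff_forall_notMem.2 this
    rw [hem, measure_empty]
    exact zero_le
  have hne : Nonempty {j // j ∈ B} := hBne.to_subtype
  have hcard : Fintype.card {j // j ∈ B} = b := by simp [hB]
  have hVm := hV.1
  set x := √((b : ℝ) / n) + v₁ with hxdef
  set y := √((b : ℝ) / N) + v₂ with hydef
  set z := √((b : ℝ) / N) + v₃ with hzdef
  have step1 : P {ω | (3 * x + 3 * y) / (1 - 3 * z)
          ≤ specNorm (((N : ℝ) / n) • ((subCols (V ω) B)ᵀ * subCols (V ω) B) - 1)} ≤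
      P {ω | V ω ∈ devSet B ((3 * x + 3 * y) / (1 - 3 * z)) ((N : ℝ) / n)} := by
    refine measure_mono fun ω hω => ?_
    obtain ⟨w, hw, h⟩ := spec_exists _ (by
      simp [Matrix.transpose_mul]) _ hω
    rw [gram_quad _ _ _ hw] at h
    exact ⟨w, hw, h⟩
  refine step1.trans ?_
  have hS : MeasurableSet {p : Ω × (Fin N × {j // j ∈ B} → ℝ) | bad x y z (V p.1) p.2} :=
    (show Measurable fun p : Ω × (Fin N × {j // j ∈ B} → ℝ) => (V p.1, p.2) from
      (hVm.comp measurable_fst).prodMk measurable_snd) (bad_meas x y z)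
  calc P {ω | V ω ∈ devSet B ((3 * x + 3 * y) / (1 - 3 * z)) ((N : ℝ) / n)}
      = ∫⁻ _, P {ω | V ω ∈ devSet B ((3 * x + 3 * y) / (1 - 3 * z)) ((N : ℝ) / n)}
          ∂stdG (Fin N × {j // j ∈ B}) := by simp
    _ ≤ ∫⁻ g, P {ω | bad x y z (V ω) g} ∂stdG (Fin N × {j // j ∈ B}) :=
        lintegral_mono fun g => dev_le P hn hN V hV B x y z p1 p2 h₃ g
    _ = (P.prod (stdG (Fin N × {j // j ∈ B})))
          {p : Ω × (Fin N × {j // j ∈ B} → ℝ) | bad x y z (V p.1) p.2} :=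
        (Measure.prod_apply_symm hS).symm
    _ = ∫⁻ ω, stdG (Fin N × {j // j ∈ B}) {g | bad x y z (V ω) g} ∂P := Measure.prod_apply hS
    _ ≤ ∫⁻ _, ENNReal.ofReal (2 * Real.exp (-(n : ℝ) * v₁ ^ 2 / 2)
          + 2 * Real.exp (-(N : ℝ) * v₂ ^ 2 / 2) + Real.exp (-(N : ℝ) * v₃ ^ 2 / 2)) ∂P := by
        refine lintegral_mono_ae ?_
        filter_upwards [hV.2.1] with ω hω
        exact bad_prob hn hN (V ω) hω v₁ v₂ v₃ hv₁ hv₂ hv₃ b hcard h₁ h₂ h₃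
    _ = _ := by simp
end
end

section
/- Let V be an n×(p·d) random real matrix uniformly distributed on the Stiefel manifold V(n, p·d), with columns partitioned into p consecutive blocks of d columns. Let A, B ⊆ {1,…,p} be disjoint block-index sets with |A| + |B| = s, and suppose (p − s)·d ≥ n. Then for any t₁, t₂, t₃ > 0 with √(s d/n) + t₁ < 1, √(s/p) + t₂ < 1, and √(s/p) + t₃ < 1/3, one has P[ ‖(p d/n)·V_Aᵀ V_B‖ ≥ (3(√(s d/n) + t₁) + 3(√(s/p) + t₂)) / (1 − 3(√(s/p) + t₃)) ] ≤ 2·exp(−n t₁²/2) + 2·exp(−p d t₂²/2) + exp(−p d t₃²/2). -/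
open MeasureTheory ProbabilityTheory Filter Matrix
open scoped ENNReal NNReal

noncomputable section

/-- The submatrix of a block matrix `V` consisting of the column blocks indexed by `J`. -/
def blockCols {n p d : ℕ} (V : Matrix (Fin n) (Fin p × Fin d) ℝ) (J : Finset (Fin p)) :
    Matrix (Fin n) ({j // j ∈ J} × Fin d) ℝ :=
  fun i jk => V i (jk.1.1, jk.2)

/-- The `k`-th column block of a block matrix `V`. -/
def colBlock {n p d : ℕ} (V : Matrix (Fin n) (Fin p × Fin d) ℝ) (k : Fin p) :
    Matrix (Fin n) (Fin d) ℝ :=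
  fun i l => V i (k, l)


/-- `a (a+2) ⋯ (a+2k-2)`. -/
def risingTwo (a k : ℕ) : ℕ := ∏ j ∈ Finset.range k, (a + 2 * j)

lemma risingTwo_zero (a : ℕ) : risingTwo a 0 = 1 := by simp [risingTwo]

lemma risingTwo_succ (a k : ℕ) : risingTwo a (k + 1) = risingTwo a k * (a + 2 * k) := by
  simp [risingTwo, Finset.prod_range_succ]

lemma risingTwo_vandermonde (a b k : ℕ) :
    ∑ ij ∈ Finset.HasAntidiagonal.antidiagonal k, (k.choose ij.1) * (risingTwo a ij.1 * risingTwo b ij.2)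
      = risingTwo (a + b) k := by
  induction k with
  | zero => simp [risingTwo_zero]
  | succ k ih =>
    have h := Finset.sum_antidiagonal_choose_succ_mul (R := ℕ)
      (fun i j => risingTwo a i * risingTwo b j) k
    simp only [Nat.cast_id] at h
    rw [h, risingTwo_succ, ← ih, ← Finset.sum_add_distrib, Finset.sum_mul]
    refine Finset.sum_congr rfl fun ij hij => ?_
    have hk : ij.1 + ij.2 = k := Finset.HasAntidiagonal.mem_antidiagonal.1 hij
    have hc : k.choose ij.2 = k.choose ij.1 := by
      rw [← hk]; exact (Nat.choose_symm_add).symm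
    rw [hc, risingTwo_succ, risingTwo_succ, ← hk]
    ring

lemma gauss_moment_integral (k : ℕ) :
    ∫ x, x ^ (2 * k) ∂(gaussianReal 0 1) = (risingTwo 1 k : ℝ) := by
  have key : ∫ x, x ^ (2 * k) ∂(gaussianReal 0 1)
      = (√Real.pi)⁻¹ * (2 ^ k * Real.Gamma (k + 1 / 2)) := by
    rw [integral_gaussianReal_eq_integral_smul (by simp)]
    have h1 : ∀ x : ℝ, gaussianPDFReal 0 1 x • x ^ (2 * k)
        = (fun y : ℝ => (√(2 * Real.pi))⁻¹ * (y ^ ((2 * k : ℕ) : ℝ) * Real.exp (-(1 / 2) * y ^ (2 : ℝ)))) |x| := by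
      intro x
      simp only [gaussianPDFReal_def, smul_eq_mul, Real.rpow_natCast, Real.rpow_two, sq_abs, pow_mul]
      simp
      ring_nf
    rw [integral_congr_ae (ae_of_all _ h1), integral_comp_abs (f := fun y : ℝ => (√(2 * Real.pi))⁻¹ *
      (y ^ ((2 * k : ℕ) : ℝ) * Real.exp (-(1 / 2) * y ^ (2 : ℝ)))), integral_const_mul, integral_rpow_mul_exp_neg_mul_rpow (by norm_num)
      (by have : (0 : ℝ) ≤ ((2 * k : ℕ) : ℝ) := by positivity
          linarith) (by norm_num)]
    have e1 : (((2 * k : ℕ) : ℝ) + 1) / 2 = k + 1 / 2 := by push_cast; ring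
    have e2 : -(((2 * k : ℕ) : ℝ) + 1) / 2 = -(k + 1 / 2) := by push_cast; ring
    rw [e1, e2, one_div, Real.inv_rpow (by norm_num), Real.rpow_neg (by norm_num), inv_inv,
      Real.rpow_add (by norm_num), Real.rpow_natCast, Real.sqrt_mul (by norm_num)]
    rw [show (2 : ℝ) ^ (2 : ℝ)⁻¹ = √2 by rw [Real.sqrt_eq_rpow, one_div]]
    have : √(2 : ℝ) ≠ 0 := by positivity
    have : √Real.pi ≠ 0 := by positivity
    field_simp
  rw [key]
  clear key
  induction k with
  | zero =>
    have : √Real.pi ≠ 0 := by positivity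
    have h := Real.Gamma_one_half_eq
    simp [risingTwo_zero] at h ⊢
    rw [h]; field_simp
  | succ k ih =>
    rw [risingTwo_succ]; push_cast
    rw [← ih, show ((k : ℝ) + 1 + 1 / 2) = (k + 1 / 2) + 1 by ring,
      Real.Gamma_add_one (by positivity)]
    ring

lemma gauss_moment (k : ℕ) :
    ∫⁻ x, ENNReal.ofReal (x ^ (2 * k)) ∂(gaussianReal 0 1) = (risingTwo 1 k : ℝ≥0∞) := by
  have hint : Integrable (fun x : ℝ => x ^ (2 * k)) (gaussianReal 0 1) := by
    by_contra h
    have h0 := gauss_moment_integral k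
    rw [integral_undef h] at h0
    have : 0 < risingTwo 1 k := Finset.prod_pos fun i _ => by omega
    have h1 : (0 : ℝ) < (risingTwo 1 k : ℝ) := by exact_mod_cast this
    linarith
  rw [← ofReal_integral_eq_lintegral_ofReal hint
    (ae_of_all _ fun x => by simp only [pow_mul]; positivity), gauss_moment_integral]
  simp

/-- standard Gaussian on `ι → ℝ` -/
def gam (ι : Type*) [Fintype ι] : Measure (ι → ℝ) := Measure.pi (fun _ => gaussianReal 0 1)

instance {ι : Type*} [Fintype ι] : IsProbabilityMeasure (gam ι) := by
  unfold gam; infer_instance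

lemma gam_map_dot {ι : Type*} [Fintype ι] (w : ι → ℝ) :
    (gam ι).map (fun g => w ⬝ᵥ g) = (gaussianReal 0 1).map (fun x => √(w ⬝ᵥ w) * x) := by
  have h := IsGaussian.map_eq_gaussianReal (μ := stdGaussian (EuclideanSpace ℝ ι))
    (innerSL ℝ (WithLp.toLp 2 w))
  rw [integral_strongDual_stdGaussian, variance_dual_stdGaussian, ← map_pi_eq_stdGaussian,
    Measure.map_map (by fun_prop) (by fun_prop)] at h
  rw [gaussianReal_map_const_mul]
  have e : (fun g : ι → ℝ => w ⬝ᵥ g) = (⇑(innerSL ℝ (WithLp.toLp 2 w)) ∘ WithLp.toLp 2) := by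
    ext g
    simp [PiLp.inner_apply, dotProduct, mul_comm]
  rw [e, gam, h]
  congr 1
  · simp
  · ext
    have h0 : 0 ≤ ∑ x, w x ^ 2 := Finset.sum_nonneg fun i _ => sq_nonneg _
    simp [EuclideanSpace.norm_sq_eq, dotProduct, ← sq]
    rw [Real.sq_sqrt h0, max_eq_left h0]

lemma gam_dot_moment {ι : Type*} [Fintype ι] (w : ι → ℝ) (k : ℕ) :
    ∫⁻ g, ENNReal.ofReal ((w ⬝ᵥ g) ^ (2 * k)) ∂(gam ι)
      = risingTwo 1 k * ENNReal.ofReal ((w ⬝ᵥ w) ^ k) := by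
  have hw : 0 ≤ w ⬝ᵥ w := Finset.sum_nonneg fun i _ => mul_self_nonneg _
  have hm : Measurable (fun g : ι → ℝ => w ⬝ᵥ g) := by unfold dotProduct; fun_prop
  have h := lintegral_map (μ := gam ι) (f := fun x : ℝ => ENNReal.ofReal (x ^ (2 * k)))
    (by fun_prop) hm
  rw [← h, gam_map_dot, lintegral_map (by fun_prop) (by fun_prop)]
  have : ∀ x : ℝ, ENNReal.ofReal ((√(w ⬝ᵥ w) * x) ^ (2 * k))
      = ENNReal.ofReal ((w ⬝ᵥ w) ^ k) * ENNReal.ofReal (x ^ (2 * k)) := by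
    intro x
    rw [mul_pow, ENNReal.ofReal_mul (by positivity), pow_mul √_, Real.sq_sqrt hw]
  simp_rw [this]
  rw [lintegral_const_mul _ (by fun_prop), gauss_moment, mul_comm]

lemma gam_norm_moment_aux {ι : Type*} [Fintype ι] [DecidableEq ι] (s : Finset ι) (k : ℕ) :
    ∫⁻ g, (∑ i ∈ s, ENNReal.ofReal (g i ^ 2)) ^ k ∂(gam ι) = (risingTwo s.card k : ℝ≥0∞) := by
  induction s using Finset.induction_on generalizing k with
  | empty =>
    cases k with
    | zero => simp [risingTwo_zero]
    | succ k => simp [risingTwo, Finset.prod_range_succ']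
  | insert a s ha ih =>
    let X : ι → (ι → ℝ) → ℝ≥0∞ := fun i g => ENNReal.ofReal (g i ^ 2)
    have hX : ∀ i, Measurable (X i) := fun i => by fun_prop
    have hind : iIndepFun X (gam ι) :=
      iIndepFun_pi (μ := fun _ : ι => gaussianReal 0 1)
        (X := fun _ x => ENNReal.ofReal (x ^ 2)) (fun i => by fun_prop)
    have h2 := hind.indepFun_finsetSum_of_notMem hX ha
    have hsum : Measurable (∑ j ∈ s, X j) := by fun_prop
    have hone : ∀ j, ∫⁻ g, X a g ^ j ∂(gam ι) = risingTwo 1 j := by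
      intro j
      have := (measurePreserving_eval (fun _ : ι => gaussianReal 0 1) a).lintegral_comp
        (f := fun x : ℝ => ENNReal.ofReal (x ^ (2 * j))) (by fun_prop)
      rw [gauss_moment] at this
      rw [← this]
      refine lintegral_congr fun g => ?_
      simp only [X, Function.eval, pow_mul]
      rw [ENNReal.ofReal_pow (sq_nonneg (g a))]
    have hexp : ∀ g, (∑ i ∈ insert a s, ENNReal.ofReal (g i ^ 2)) ^ k
        = ∑ ij ∈ Finset.HasAntidiagonal.antidiagonal k, (k.choose ij.1 : ℝ≥0∞) *
          (((∑ j ∈ s, X j) g) ^ ij.1 * X a g ^ ij.2) := by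
      intro g
      rw [Finset.sum_insert ha, add_comm, (Commute.all _ _).add_pow']
      simp [X, nsmul_eq_mul]
    simp_rw [hexp]
    rw [lintegral_finsetSum _ (fun i _ => by fun_prop)]
    have hterm : ∀ ij : ℕ × ℕ, ∫⁻ g, (k.choose ij.1 : ℝ≥0∞) *
          (((∑ j ∈ s, X j) g) ^ ij.1 * X a g ^ ij.2) ∂(gam ι)
        = (k.choose ij.1 : ℝ≥0∞) * (risingTwo s.card ij.1 * risingTwo 1 ij.2) := by
      intro ij
      rw [lintegral_const_mul _ (by fun_prop)]
      have h3 := lintegral_mul_eq_lintegral_mul_lintegral_of_indepFun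
        (f := fun g => ((∑ j ∈ s, X j) g) ^ ij.1) (g := fun g => X a g ^ ij.2) (by fun_prop)
        (by fun_prop) (h2.comp (φ := fun x => x ^ ij.1) (ψ := fun x => x ^ ij.2)
          (by fun_prop) (by fun_prop))
      simp only [Pi.mul_apply] at h3
      rw [h3, hone]
      congr 2
      rw [← ih]
      refine lintegral_congr fun g => ?_
      simp [X]
    simp_rw [hterm]
    rw [Finset.card_insert_of_notMem ha, ← risingTwo_vandermonde]
    push_cast; rfl

lemma gam_norm_moment {ι : Type*} [Fintype ι] [DecidableEq ι] (s : Finset ι) (k : ℕ) :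
    ∫⁻ g, ENNReal.ofReal ((∑ i ∈ s, g i ^ 2) ^ k) ∂(gam ι) = (risingTwo s.card k : ℝ≥0∞) := by
  rw [← gam_norm_moment_aux]
  refine lintegral_congr fun g => ?_
  rw [ENNReal.ofReal_pow (Finset.sum_nonneg fun i _ => sq_nonneg _),
    ENNReal.ofReal_sum_of_nonneg (fun i _ => sq_nonneg _)]

lemma dot_self_nonneg {ι : Type*} [Fintype ι] (w : ι → ℝ) : 0 ≤ w ⬝ᵥ w :=
  Finset.sum_nonneg fun i _ => mul_self_nonneg _

lemma dot_self_eq_sum {ι : Type*} [Fintype ι] (w : ι → ℝ) : w ⬝ᵥ w = ∑ i, w i ^ 2 := by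
  simp [dotProduct, sq]

/-- Householder reflection exchanging two vectors of the same length. -/
lemma exists_householder {ι : Type*} [Fintype ι] [DecidableEq ι] (a a' : ι → ℝ)
    (h : a ⬝ᵥ a = a' ⬝ᵥ a') :
    ∃ O : Matrix ι ι ℝ, O * Oᵀ = 1 ∧ O *ᵥ a = a' ∧ ∀ b : ι → ℝ, b ⬝ᵥ a = b ⬝ᵥ a' → O *ᵥ b = b := by
  by_cases haa : a = a'
  · exact ⟨1, by simp, by simp [haa], by simp⟩
  set w := a - a' with hw
  have hw0 : w ⬝ᵥ w ≠ 0 := by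
    rw [Ne, dotProduct_self_eq_zero]
    exact sub_ne_zero.2 haa
  have happ : ∀ x : ι → ℝ, (1 - (2 / (w ⬝ᵥ w)) • vecMulVec w w) *ᵥ x
      = x - (2 / (w ⬝ᵥ w) * (w ⬝ᵥ x)) • w := by
    intro x
    rw [sub_mulVec, one_mulVec, smul_mulVec, vecMulVec_mulVec]
    ext i
    simp [mul_comm, mul_assoc, mul_left_comm]
  refine ⟨1 - (2 / (w ⬝ᵥ w)) • vecMulVec w w, ?_, ?_, ?_⟩
  · have ht : (1 - (2 / (w ⬝ᵥ w)) • vecMulVec w w)ᵀ = 1 - (2 / (w ⬝ᵥ w)) • vecMulVec w w := by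
      simp [transpose_sub, transpose_smul]
    rw [ht]
    simp only [Matrix.sub_mul, Matrix.mul_sub, Matrix.one_mul, Matrix.mul_one, smul_mul_assoc,
      mul_smul_comm, vecMulVec_mul_vecMulVec]
    ext i j
    simp [vecMulVec_apply]
    field_simp
    ring
  · rw [happ]
    have e1 : w ⬝ᵥ w = 2 * (w ⬝ᵥ a) := by
      rw [hw]
      simp only [sub_dotProduct, dotProduct_sub]
      rw [h, dotProduct_comm a a']; ring
    have : 2 / (w ⬝ᵥ w) * (w ⬝ᵥ a) = 1 := by
      rw [div_mul_eq_mul_div, ← e1, div_self hw0]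
    rw [this, one_smul, hw]; simp
  · intro b hb
    rw [happ]
    have : w ⬝ᵥ b = 0 := by
      rw [hw, sub_dotProduct, dotProduct_comm a, dotProduct_comm a', hb, sub_self]
    simp [this]

section stiefel

variable {Ω ι : Type*} [MeasurableSpace Ω] [Fintype ι] [DecidableEq ι]
  {P : Measure Ω} {n : ℕ} {V : Ω → Matrix (Fin n) ι ℝ}

lemma stiefel_inv (hV : IsUniformStiefel P V) (O : Matrix ι ι ℝ) (hO : O * Oᵀ = 1)
    (f : Matrix (Fin n) ι ℝ → ℝ≥0∞) (hf : Measurable f) :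
    ∫⁻ ω, f (V ω * O) ∂P = ∫⁻ ω, f (V ω) ∂P := by
  have hmul : Measurable (fun M : Matrix (Fin n) ι ℝ => M * O) := by
    refine measurable_pi_iff.2 fun i => measurable_pi_iff.2 fun j => ?_
    simp only [Matrix.mul_apply]
    refine Finset.measurable_sum _ fun l _ => Measurable.mul_const ?_ _
    exact (measurable_pi_apply l).comp (measurable_pi_apply i)
  rw [← lintegral_map hf hV.1, ← hV.2.2 O hO, lintegral_map hf (show Measurable (fun ω => V ω * O) from hmul.comp hV.1)]

lemma measurable_entry (i : Fin n) (j : ι) : Measurable (fun M : Matrix (Fin n) ι ℝ => M i j) :=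
  (measurable_pi_apply j).comp (measurable_pi_apply i)

lemma measurable_V_entry (hV : IsUniformStiefel P V) (i : Fin n) (j : ι) :
    Measurable (fun ω => V ω i j) := (measurable_entry i j).comp hV.1

lemma measurable_form (a b : ι → ℝ) :
    Measurable (fun M : Matrix (Fin n) ι ℝ => (M *ᵥ a) ⬝ᵥ (M *ᵥ b)) := by
  unfold dotProduct mulVec dotProduct
  have := measurable_entry (n := n) (ι := ι)
  fun_prop

lemma measurable_formV (hV : IsUniformStiefel P V) (a b : ι → ℝ) :
    Measurable (fun ω => (V ω *ᵥ a) ⬝ᵥ (V ω *ᵥ b)) := (measurable_form a b).comp hV.1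

/-- cross moment -/
def crossF (P : Measure Ω) (V : Ω → Matrix (Fin n) ι ℝ) (k : ℕ) (a b : ι → ℝ) : ℝ≥0∞ :=
  ∫⁻ ω, ENNReal.ofReal (((V ω *ᵥ a) ⬝ᵥ (V ω *ᵥ b)) ^ (2 * k)) ∂P

/-- norm moment -/
def normG (P : Measure Ω) (V : Ω → Matrix (Fin n) ι ℝ) (k : ℕ) (a : ι → ℝ) : ℝ≥0∞ :=
  ∫⁻ ω, ENNReal.ofReal (((V ω *ᵥ a) ⬝ᵥ (V ω *ᵥ a)) ^ k) ∂P

lemma crossF_inv (hV : IsUniformStiefel P V) (k : ℕ) (O : Matrix ι ι ℝ) (hO : O * Oᵀ = 1)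
    (a b : ι → ℝ) : crossF P V k (O *ᵥ a) (O *ᵥ b) = crossF P V k a b := by
  have h := stiefel_inv hV O hO (fun M => ENNReal.ofReal (((M *ᵥ a) ⬝ᵥ (M *ᵥ b)) ^ (2 * k)))
    (((measurable_form a b).pow_const _).ennreal_ofReal)
  simp only [← mulVec_mulVec] at h
  exact h

lemma normG_inv (hV : IsUniformStiefel P V) (k : ℕ) (O : Matrix ι ι ℝ) (hO : O * Oᵀ = 1)
    (a : ι → ℝ) : normG P V k (O *ᵥ a) = normG P V k a := by
  have h := stiefel_inv hV O hO (fun M => ENNReal.ofReal (((M *ᵥ a) ⬝ᵥ (M *ᵥ a)) ^ k))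
    (((measurable_form a a).pow_const _).ennreal_ofReal)
  simp only [← mulVec_mulVec] at h
  exact h

lemma crossF_comm (k : ℕ) (a b : ι → ℝ) : crossF P V k a b = crossF P V k b a := by
  unfold crossF; simp_rw [dotProduct_comm]

lemma crossF_smul (hV : IsUniformStiefel P V) (k : ℕ) (c : ℝ) (a b : ι → ℝ) :
    crossF P V k (c • a) b = ENNReal.ofReal ((c ^ 2) ^ k) * crossF P V k a b := by
  unfold crossF
  rw [← lintegral_const_mul _ (((measurable_formV hV a b).pow_const _).ennreal_ofReal)]
  refine lintegral_congr fun ω => ?_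
  rw [mulVec_smul, smul_dotProduct, smul_eq_mul, mul_pow,
    ENNReal.ofReal_mul (by rw [pow_mul]; positivity), pow_mul c]

lemma normG_smul (hV : IsUniformStiefel P V) (k : ℕ) (c : ℝ) (a : ι → ℝ) :
    normG P V k (c • a) = ENNReal.ofReal ((c ^ 2) ^ k) * normG P V k a := by
  unfold normG
  rw [← lintegral_const_mul _ (((measurable_formV hV a a).pow_const _).ennreal_ofReal)]
  refine lintegral_congr fun ω => ?_
  rw [mulVec_smul, smul_dotProduct, dotProduct_smul, smul_eq_mul, smul_eq_mul, ← mul_assoc, mul_pow,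
    ENNReal.ofReal_mul (pow_nonneg (mul_self_nonneg c) _), ← sq]

lemma dot_single_self (i : ι) : (Pi.single i (1 : ℝ)) ⬝ᵥ (Pi.single i (1 : ℝ)) = 1 := by simp

lemma normG_eq (hV : IsUniformStiefel P V) (k : ℕ) (i : ι) (a : ι → ℝ) :
    normG P V k a = ENNReal.ofReal ((a ⬝ᵥ a) ^ k) * normG P V k (Pi.single i 1) := by
  obtain ⟨O, hO, hOa, -⟩ := exists_householder a (√(a ⬝ᵥ a) • Pi.single i (1 : ℝ)) (by
    rw [smul_dotProduct, dotProduct_smul, dot_single_self]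
    simp [Real.mul_self_sqrt (dot_self_nonneg a)])
  rw [← normG_inv hV k O hO, hOa, normG_smul hV, Real.sq_sqrt (dot_self_nonneg a)]

lemma crossF_eq_left (hV : IsUniformStiefel P V) (k : ℕ) (i : ι) (a b : ι → ℝ)
    (hab : b ⬝ᵥ a = 0) (hb : b i = 0) :
    crossF P V k a b = ENNReal.ofReal ((a ⬝ᵥ a) ^ k) * crossF P V k (Pi.single i 1) b := by
  obtain ⟨O, hO, hOa, hOb⟩ := exists_householder a (√(a ⬝ᵥ a) • Pi.single i (1 : ℝ)) (by
    rw [smul_dotProduct, dotProduct_smul, dot_single_self]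
    simp [Real.mul_self_sqrt (dot_self_nonneg a)])
  rw [← crossF_inv hV k O hO, hOa, hOb b (by rw [hab]; simp [hb]), crossF_smul hV,
    Real.sq_sqrt (dot_self_nonneg a)]

lemma crossF_eq_right (hV : IsUniformStiefel P V) (k : ℕ) (i i' : ι) (hi : i ≠ i') (b : ι → ℝ)
    (hb : b i = 0) :
    crossF P V k (Pi.single i 1) b
      = ENNReal.ofReal ((b ⬝ᵥ b) ^ k) * crossF P V k (Pi.single i 1) (Pi.single i' 1) := by
  rw [crossF_comm, crossF_eq_left hV k i' b (Pi.single i 1) (by simp [hb])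
    (by simp [hi.symm]), crossF_comm]

lemma iso_moment (M : Matrix (Fin n) ι ℝ) (hM : M * Mᵀ = 1) (k : ℕ) :
    ∫⁻ g, ENNReal.ofReal (((M *ᵥ g) ⬝ᵥ (M *ᵥ g)) ^ k) ∂(gam ι) = (risingTwo n k : ℝ≥0∞) := by
  have hD : (risingTwo 1 k : ℝ≥0∞) ≠ 0 := by
    have : 0 < risingTwo 1 k := Finset.prod_pos fun i _ => by omega
    exact_mod_cast this.ne'
  have hD' : (risingTwo 1 k : ℝ≥0∞) ≠ ∞ := ENNReal.natCast_ne_top _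
  have h1 : (risingTwo 1 k : ℝ≥0∞) * ∫⁻ g, ENNReal.ofReal (((M *ᵥ g) ⬝ᵥ (M *ᵥ g)) ^ k) ∂(gam ι)
      = ∫⁻ g, ∫⁻ h, ENNReal.ofReal (((M *ᵥ g) ⬝ᵥ h) ^ (2 * k)) ∂(gam (Fin n)) ∂(gam ι) := by
    rw [← lintegral_const_mul _ (by unfold mulVec dotProduct; fun_prop)]
    refine lintegral_congr fun g => ?_
    rw [gam_dot_moment]
  rw [lintegral_lintegral_swap (by unfold mulVec dotProduct Function.uncurry; fun_prop)] at h1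
  have h2 : ∀ h : Fin n → ℝ, ∫⁻ g, ENNReal.ofReal (((M *ᵥ g) ⬝ᵥ h) ^ (2 * k)) ∂(gam ι)
      = risingTwo 1 k * ENNReal.ofReal ((∑ i, h i ^ 2) ^ k) := by
    intro h
    have e : ∀ g, (M *ᵥ g) ⬝ᵥ h = (Mᵀ *ᵥ h) ⬝ᵥ g := by
      intro g
      rw [dotProduct_comm, dotProduct_mulVec, mulVec_transpose]
    simp_rw [e]
    rw [gam_dot_moment, mulVec_transpose, ← dotProduct_mulVec, ← mulVec_transpose, mulVec_mulVec, hM, one_mulVec,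
      dot_self_eq_sum]
  simp_rw [h2] at h1
  rw [lintegral_const_mul _ (by fun_prop), gam_norm_moment, Finset.card_univ, Fintype.card_fin] at h1
  exact (ENNReal.mul_right_inj hD hD').1 h1

lemma normG_value [SFinite P] [IsProbabilityMeasure P] (hV : IsUniformStiefel P V) (k : ℕ) (i : ι) :
    (risingTwo (Fintype.card ι) k : ℝ≥0∞) * normG P V k (Pi.single i 1) = risingTwo n k := by
  have hm := measurable_V_entry hV
  have h1 : ∫⁻ g, normG P V k g ∂(gam ι)
      = (risingTwo (Fintype.card ι) k : ℝ≥0∞) * normG P V k (Pi.single i 1) := by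
    rw [lintegral_congr (fun g => normG_eq hV k i g)]
    simp_rw [dot_self_eq_sum]
    rw [lintegral_mul_const _ (by fun_prop), gam_norm_moment, Finset.card_univ]
  rw [← h1]
  unfold normG
  rw [lintegral_lintegral_swap (by
    unfold mulVec dotProduct Function.uncurry
    fun_prop)]
  rw [lintegral_congr_ae (g := fun _ => (risingTwo n k : ℝ≥0∞))]
  · simp
  · filter_upwards [hV.2.1] with ω hω
    exact iso_moment _ hω k

lemma sum_erase_moment (k : ℕ) (i : ι) :
    ∫⁻ g, ENNReal.ofReal ((Function.update g i 0 ⬝ᵥ Function.update g i 0) ^ k) ∂(gam ι)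
      = risingTwo (Fintype.card ι - 1) k := by
  rw [← Finset.card_univ, ← Finset.card_erase_of_mem (Finset.mem_univ i), ← gam_norm_moment]
  refine lintegral_congr fun g => ?_
  congr 2
  rw [dot_self_eq_sum, ← Finset.add_sum_erase _ _ (Finset.mem_univ i)]
  simp only [Function.update_self]
  rw [zero_pow (by norm_num), zero_add]
  refine Finset.sum_congr rfl fun j hj => ?_
  rw [Function.update_of_ne (Finset.ne_of_mem_erase hj)]

lemma crossF_value [IsProbabilityMeasure P] (hV : IsUniformStiefel P V) (k : ℕ) (i i' : ι)
    (hi : i ≠ i') :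
    (risingTwo (Fintype.card ι - 1) k : ℝ≥0∞) * crossF P V k (Pi.single i 1) (Pi.single i' 1)
      ≤ risingTwo 1 k * normG P V k (Pi.single i 1) := by
  have hm := measurable_V_entry hV
  have hupd : ∀ j, Measurable (fun g : ι → ℝ => Function.update g i 0 j) := by
    intro j
    by_cases h : j = i
    · subst h; simp
    · simp only [Function.update_of_ne h]; fun_prop
  have h1 : ∫⁻ g, crossF P V k (Pi.single i 1) (Function.update g i 0) ∂(gam ι)
      = (risingTwo (Fintype.card ι - 1) k : ℝ≥0∞)
        * crossF P V k (Pi.single i 1) (Pi.single i' 1) := by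
    rw [← sum_erase_moment k i, ← lintegral_mul_const _ (by unfold dotProduct; fun_prop)]
    refine lintegral_congr fun g => ?_
    rw [crossF_eq_right hV k i i' hi _ (by simp)]
  rw [← h1]
  unfold crossF
  rw [lintegral_lintegral_swap (by
    unfold mulVec dotProduct Function.uncurry
    fun_prop)]
  unfold normG
  rw [← lintegral_const_mul _ (((measurable_formV hV _ _).pow_const _).ennreal_ofReal)]
  refine lintegral_mono_ae ?_
  filter_upwards [hV.2.1] with ω hω
  set x := V ω *ᵥ Pi.single i 1 with hx
  have e : ∀ g, x ⬝ᵥ (V ω *ᵥ Function.update g i 0) = (Function.update ((V ω)ᵀ *ᵥ x) i 0) ⬝ᵥ g := by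
    intro g
    rw [dotProduct_mulVec, ← mulVec_transpose]
    unfold dotProduct
    refine Finset.sum_congr rfl fun j _ => ?_
    by_cases h : j = i
    · subst h; simp
    · simp [Function.update_of_ne h]
  simp_rw [e]
  rw [gam_dot_moment]
  gcongr
  · exact dot_self_nonneg _
  · calc _ ≤ ((V ω)ᵀ *ᵥ x) ⬝ᵥ ((V ω)ᵀ *ᵥ x) := by
          unfold dotProduct
          refine Finset.sum_le_sum fun j _ => ?_
          by_cases h : j = i
          · subst h; simpa using mul_self_nonneg _
          · simp [Function.update_of_ne h]
      _ = x ⬝ᵥ x := by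
          rw [dotProduct_mulVec, vecMul_transpose, mulVec_mulVec, hω, one_mulVec]

end stiefel

section numeric

lemma risingTwo_one_ge (k : ℕ) : ((k : ℝ) / 2) ^ k ≤ risingTwo 1 k := by
  induction k with
  | zero => simp [risingTwo_zero]
  | succ k ih =>
    rcases Nat.eq_zero_or_pos k with rfl | hk
    · norm_num [risingTwo]
    have hk' : (1 : ℝ) ≤ k := by exact_mod_cast hk
    rw [risingTwo_succ]
    push_cast
    have h1 : (((k : ℝ) + 1) / k) ^ k ≤ 3 := by
      have h2 : ((k : ℝ) + 1) / k ≤ Real.exp (1 / k) := by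
        have := Real.add_one_le_exp (1 / (k : ℝ))
        have e : ((k : ℝ) + 1) / k = 1 / k + 1 := by field_simp; ring
        rw [e]; exact this
      calc (((k : ℝ) + 1) / k) ^ k ≤ (Real.exp (1 / k)) ^ k := by gcongr
        _ = Real.exp 1 := by rw [← Real.exp_nat_mul]; congr 1; field_simp
        _ ≤ 3 := by have := Real.exp_one_lt_d9; linarith
    have h3 : (((k : ℝ) + 1) / 2) ^ (k + 1)
        = (((k : ℝ) + 1) / k) ^ k * ((k : ℝ) / 2) ^ k * (((k : ℝ) + 1) / 2) := by
      rw [pow_succ, ← mul_pow]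
      congr 2
      field_simp
    rw [h3]
    have h4 : 0 ≤ ((k : ℝ) / 2) ^ k := by positivity
    calc _ ≤ 3 * ((k : ℝ) / 2) ^ k * (((k : ℝ) + 1) / 2) := by gcongr
      _ = ((k : ℝ) / 2) ^ k * (3 * (((k : ℝ) + 1) / 2)) := by ring
      _ ≤ ((k : ℝ) / 2) ^ k * (1 + 2 * k) := by
          apply mul_le_mul_of_nonneg_left _ h4; linarith
      _ ≤ _ := by gcongr

lemma risingTwo_pair_le (a b k : ℕ) (T : ℝ) (hT : 2 * ((k : ℝ) - 1) ≤ T) :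
    (risingTwo a k : ℝ) * risingTwo b k ≤ (((a : ℝ) + b + T) ^ 2 / 4) ^ k := by
  unfold risingTwo
  push_cast
  rw [← Finset.prod_range_reflect (fun j : ℕ => ((b : ℝ) + 2 * (j : ℝ))), ← Finset.prod_mul_distrib]
  calc _ ≤ ∏ j ∈ Finset.range k, (((a : ℝ) + b + T) ^ 2 / 4) := by
        refine Finset.prod_le_prod (fun j _ => by positivity) fun j hj => ?_
        have hj' : j + 1 ≤ k := Finset.mem_range.1 hj
        have e : ((k - 1 - j : ℕ) : ℝ) = (k : ℝ) - 1 - j := by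
          rw [Nat.sub_sub, Nat.cast_sub (by omega)]; push_cast; ring
        have h0 : (0 : ℝ) ≤ ((k - 1 - j : ℕ) : ℝ) := by positivity
        have h1 : (0 : ℝ) ≤ a + 2 * j := by positivity
        have h2 : (0 : ℝ) ≤ b + 2 * ((k - 1 - j : ℕ) : ℝ) := by positivity
        have h3 : (a + 2 * (j : ℝ)) + (b + 2 * ((k - 1 - j : ℕ) : ℝ)) ≤ a + b + T := by
          rw [e]; linarith
        nlinarith [sq_nonneg ((a + 2 * (j : ℝ)) - (b + 2 * ((k - 1 - j : ℕ) : ℝ))),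
          pow_le_pow_left₀ (by positivity) h3 2]
    _ = _ := by rw [Finset.prod_const, Finset.card_range]

lemma risingTwo_le (n k : ℕ) (h : 2 * ((k : ℝ) - 1) ≤ n) : (risingTwo n k : ℝ) ≤ (2 * n) ^ k := by
  unfold risingTwo
  push_cast
  calc _ ≤ ∏ j ∈ Finset.range k, (2 * (n : ℝ)) := by
        refine Finset.prod_le_prod (fun j _ => by positivity) fun j hj => ?_
        have hj' : (j : ℝ) + 1 ≤ k := by exact_mod_cast Finset.mem_range.1 hj
        linarith
    _ = _ := by rw [Finset.prod_const, Finset.card_range]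

lemma risingTwo_pair_ge (N k : ℕ) (hN : 2 ≤ N) (hk : 2 ≤ k) :
    ((N : ℝ) ^ 2) ^ k ≤ risingTwo N k * risingTwo (N - 1) k := by
  obtain ⟨M, rfl⟩ : ∃ M, N = M + 2 := ⟨N - 2, by omega⟩
  suffices h : ((M + 2) ^ 2) ^ k ≤ risingTwo (M + 2) k * risingTwo (M + 2 - 1) k by exact_mod_cast h
  rw [show M + 2 - 1 = M + 1 by omega]
  induction k, hk using Nat.le_induction with
  | base =>
    simp only [risingTwo, Finset.prod_range_succ, Finset.prod_range_zero]
    nlinarith [Nat.zero_le M, Nat.zero_le (M ^ 2), Nat.zero_le (M ^ 3)]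
  | succ k hk ih =>
    rw [risingTwo_succ, risingTwo_succ, pow_succ]
    calc _ ≤ (risingTwo (M + 2) k * risingTwo (M + 1) k) * ((M + 2 + 2 * k) * (M + 1 + 2 * k)) := by
          refine Nat.mul_le_mul ih ?_
          rw [sq]
          exact Nat.mul_le_mul (by omega) (by omega)
      _ = _ := by ring

lemma numeric_bound (a b n N k : ℕ) (T : ℝ) (hm : (a : ℝ) + b ≤ T) (hT0 : 0 < T) (hTn : T ≤ n)
    (hk1 : T / 2 ≤ k) (hk2 : 2 * ((k : ℝ) - 1) ≤ T) (hk : 2 ≤ k) (hN : 2 ≤ N) :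
    (risingTwo a k : ℝ) * risingTwo b k * risingTwo n k
      ≤ Real.exp (-(T - (a + b)) / 2) * risingTwo 1 k * (9 * T * n / N ^ 2) ^ k
        * (risingTwo N k * risingTwo (N - 1) k) := by
  have hN0 : (0 : ℝ) < N := by exact_mod_cast (by omega : 0 < N)
  have hn0 : (0 : ℝ) < n := by linarith
  have h1 := risingTwo_pair_le a b k T hk2
  have h2 := risingTwo_le n k (by linarith)
  have h3 := risingTwo_one_ge k
  have h4 := risingTwo_pair_ge N k hN hk
  have h3' : (T / 4) ^ k ≤ (risingTwo 1 k : ℝ) :=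
    le_trans (pow_le_pow_left₀ (by positivity) (by linarith) k) h3
  have h6 : ((((a : ℝ) + b + T) / (2 * T)) ^ 2) ^ k ≤ Real.exp (-(T - (a + b)) / 2) := by
    have e1 : ((a : ℝ) + b + T) / (2 * T) ≤ Real.exp (-(T - (a + b)) / (2 * T)) := by
      have := Real.add_one_le_exp (-(T - (a + b)) / (2 * T))
      have e : ((a : ℝ) + b + T) / (2 * T) = -(T - (a + b)) / (2 * T) + 1 := by field_simp; ring
      rw [e]; exact this
    calc _ ≤ ((Real.exp (-(T - (a + b)) / (2 * T))) ^ 2) ^ k := by gcongr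
      _ = Real.exp (-((T - (a + b)) * (k / T))) := by
          rw [← pow_mul, ← Real.exp_nat_mul]; congr 1; push_cast; field_simp
      _ ≤ _ := by
          apply Real.exp_le_exp.2
          have : 1 / 2 ≤ (k : ℝ) / T := by rw [le_div_iff₀ hT0]; linarith
          have h0 : 0 ≤ T - (a + b) := by linarith
          nlinarith [mul_le_mul_of_nonneg_left this h0]
  calc _ ≤ (((a : ℝ) + b + T) ^ 2 / 4) ^ k * (2 * n) ^ k := by gcongr
    _ = (((a : ℝ) + b + T) ^ 2 / 4 * (2 * n)) ^ k := (mul_pow _ _ _).symm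
    _ ≤ ((((a : ℝ) + b + T) / (2 * T)) ^ 2 * (T / 4) * (9 * T * n / N ^ 2) * N ^ 2) ^ k := by
        refine pow_le_pow_left₀ (by positivity) ?_ k
        have e : (((a : ℝ) + b + T) / (2 * T)) ^ 2 * (T / 4) * (9 * T * n / N ^ 2) * N ^ 2
          = ((a : ℝ) + b + T) ^ 2 * n * (9 / 16) := by field_simp; ring
        rw [e]
        have : 0 ≤ ((a : ℝ) + b + T) ^ 2 * n := by positivity
        linarith
    _ = ((((a : ℝ) + b + T) / (2 * T)) ^ 2) ^ k * (T / 4) ^ k * (9 * T * n / N ^ 2) ^ k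
          * ((N : ℝ) ^ 2) ^ k := by rw [mul_pow, mul_pow, mul_pow]
    _ ≤ _ := by gcongr

end numeric

section masks

variable {Ω ι : Type*} [MeasurableSpace Ω] [Fintype ι] [DecidableEq ι]
  {P : Measure Ω} {n : ℕ} {V : Ω → Matrix (Fin n) ι ℝ}

/-- restriction of a vector to the coordinates in `S` -/
def mask (S : Finset ι) (g : ι → ℝ) : ι → ℝ := fun i => if i ∈ S then g i else 0

lemma mask_dot (S : Finset ι) (x y : ι → ℝ) : mask S x ⬝ᵥ y = x ⬝ᵥ mask S y := by
  unfold mask dotProduct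
  refine Finset.sum_congr rfl fun i _ => ?_
  dsimp only
  split_ifs <;> simp

lemma mask_dot_self (S : Finset ι) (x : ι → ℝ) : mask S x ⬝ᵥ mask S x = ∑ i ∈ S, x i ^ 2 := by
  rw [dot_self_eq_sum, ← Finset.sum_subset (Finset.subset_univ S)]
  · exact Finset.sum_congr rfl fun i hi => by simp [mask, hi]
  · intro i _ hi
    simp [mask, hi]

lemma measurable_mask (S : Finset ι) (j : ι) : Measurable (fun g : ι → ℝ => mask S g j) := by
  unfold mask
  split_ifs <;> fun_prop

/-- Gaussian-averaged bilinear moment -/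
def Phi (k : ℕ) (S T : Finset ι) (M : Matrix (Fin n) ι ℝ) : ℝ≥0∞ :=
  ∫⁻ g, ∫⁻ h, ENNReal.ofReal (((M *ᵥ mask S g) ⬝ᵥ (M *ᵥ mask T h)) ^ (2 * k)) ∂(gam ι) ∂(gam ι)

lemma measurable_Phi (hV : IsUniformStiefel P V) (k : ℕ) (S T : Finset ι) :
    Measurable (fun ω => Phi k S T (V ω)) := by
  have hm := measurable_V_entry hV
  have hS := measurable_mask S
  have hT := measurable_mask T
  unfold Phi
  refine Measurable.lintegral_prod_right' (f := fun q : Ω × (ι → ℝ) =>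
    ∫⁻ h, ENNReal.ofReal (((V q.1 *ᵥ mask S q.2) ⬝ᵥ (V q.1 *ᵥ mask T h)) ^ (2 * k)) ∂(gam ι)) ?_
  refine Measurable.lintegral_prod_right' (f := fun q : (Ω × (ι → ℝ)) × (ι → ℝ) =>
    ENNReal.ofReal (((V q.1.1 *ᵥ mask S q.1.2) ⬝ᵥ (V q.1.1 *ᵥ mask T q.2)) ^ (2 * k))) ?_
  unfold mulVec dotProduct
  fun_prop

lemma lintegral_Phi [IsProbabilityMeasure P] (hV : IsUniformStiefel P V) (k : ℕ) (S T : Finset ι)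
    (hST : Disjoint S T) (i i' : ι) (hi : i ∈ S) (hi' : i' ∈ T) :
    ∫⁻ ω, Phi k S T (V ω) ∂P
      = risingTwo S.card k * risingTwo T.card k * crossF P V k (Pi.single i 1) (Pi.single i' 1) := by
  have hm := measurable_V_entry hV
  have hS := measurable_mask S
  have hT := measurable_mask T
  unfold Phi
  rw [lintegral_lintegral_swap]
  swap
  · refine Measurable.aemeasurable ?_
    refine Measurable.lintegral_prod_right' (f := fun q : (Ω × (ι → ℝ)) × (ι → ℝ) =>
      ENNReal.ofReal (((V q.1.1 *ᵥ mask S q.1.2) ⬝ᵥ (V q.1.1 *ᵥ mask T q.2)) ^ (2 * k))) ?_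
    unfold mulVec dotProduct
    fun_prop
  have key : ∀ g : ι → ℝ, ∫⁻ ω, ∫⁻ h, ENNReal.ofReal
      (((V ω *ᵥ mask S g) ⬝ᵥ (V ω *ᵥ mask T h)) ^ (2 * k)) ∂(gam ι) ∂P
      = ENNReal.ofReal ((∑ i ∈ S, g i ^ 2) ^ k) *
        (risingTwo T.card k * crossF P V k (Pi.single i 1) (Pi.single i' 1)) := by
    intro g
    rw [lintegral_lintegral_swap (by unfold mulVec dotProduct Function.uncurry; fun_prop)]
    have h2 : ∀ h : ι → ℝ, ∫⁻ ω, ENNReal.ofReal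
        (((V ω *ᵥ mask S g) ⬝ᵥ (V ω *ᵥ mask T h)) ^ (2 * k)) ∂P
        = ENNReal.ofReal ((∑ i ∈ S, g i ^ 2) ^ k) * (ENNReal.ofReal ((∑ i ∈ T, h i ^ 2) ^ k) *
          crossF P V k (Pi.single i 1) (Pi.single i' 1)) := by
      intro h
      have hiT : i ∉ T := Finset.disjoint_left.1 hST hi
      have e := crossF_eq_left hV k i (mask S g) (mask T h) (by
        rw [mask_dot]
        unfold dotProduct mask
        refine Finset.sum_eq_zero fun j _ => ?_
        by_cases hj : j ∈ T
        · simp [hj, Finset.disjoint_right.1 hST hj]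
        · simp [hj]) (by simp [mask, hiT])
      rw [crossF_eq_right hV k i i' (fun h => hiT (h ▸ hi')) _ (by simp [mask, hiT]),
        mask_dot_self, mask_dot_self] at e
      exact e
    rw [lintegral_congr h2, lintegral_const_mul _ (by fun_prop), lintegral_mul_const _ (by fun_prop),
      gam_norm_moment]
  rw [lintegral_congr key, lintegral_mul_const _ (by fun_prop), gam_norm_moment, mul_assoc]

lemma Phi_lower (k : ℕ) (S T : Finset ι) (M : Matrix (Fin n) ι ℝ) (y : ι → ℝ)
    (hy : mask T y = y) :
    (risingTwo 1 k : ℝ≥0∞) * (risingTwo 1 k *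
      ENNReal.ofReal ((mask S (Mᵀ *ᵥ (M *ᵥ y)) ⬝ᵥ mask S (Mᵀ *ᵥ (M *ᵥ y))) ^ k))
      ≤ Phi k S T M * ENNReal.ofReal ((y ⬝ᵥ y) ^ k) := by
  have hS := measurable_mask S
  have hT := measurable_mask T
  have tr : ∀ (x : Fin n → ℝ) (g : ι → ℝ), x ⬝ᵥ (M *ᵥ g) = (Mᵀ *ᵥ x) ⬝ᵥ g := by
    intro x g
    rw [dotProduct_mulVec, mulVec_transpose]
  unfold Phi
  rw [← gam_dot_moment, ← lintegral_const_mul _ (by unfold dotProduct; fun_prop),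
    ← lintegral_mul_const']
  swap
  · exact ENNReal.ofReal_ne_top
  refine lintegral_mono fun g => ?_
  have e : ∀ h, (M *ᵥ mask S g) ⬝ᵥ (M *ᵥ mask T h) = mask T (Mᵀ *ᵥ (M *ᵥ mask S g)) ⬝ᵥ h := by
    intro h
    rw [tr, mask_dot]
  simp_rw [e]
  rw [gam_dot_moment, mul_assoc, ← ENNReal.ofReal_mul (pow_nonneg (dot_self_nonneg _) _)]
  gcongr
  rw [← mul_pow, pow_mul]
  refine pow_le_pow_left₀ (sq_nonneg _) ?_ k
  set z := mask T (Mᵀ *ᵥ (M *ᵥ mask S g)) with hz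
  have e2 : mask S (Mᵀ *ᵥ (M *ᵥ y)) ⬝ᵥ g = z ⬝ᵥ y := by
    rw [hz, mask_dot, mask_dot, hy, ← tr, ← tr, dotProduct_comm]
  rw [e2, dot_self_eq_sum, dot_self_eq_sum]
  exact Finset.sum_mul_sq_le_sq_mul_sq _ _ _

end masks

lemma opnorm_pow_le {E F : Type*} [NormedAddCommGroup E] [NormedSpace ℝ E] [NormedAddCommGroup F]
    [NormedSpace ℝ F] (L : E →L[ℝ] F) (k : ℕ) (hk : k ≠ 0) (K : ℝ) (hK : 0 ≤ K)
    (h : ∀ x, (‖L x‖ ^ 2) ^ k ≤ K * (‖x‖ ^ 2) ^ k) : (‖L‖ ^ 2) ^ k ≤ K := by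
  have h2k : 2 * k ≠ 0 := by omega
  set ρ := K ^ (((2 * k : ℕ) : ℝ)⁻¹) with hρ
  have hρ0 : 0 ≤ ρ := Real.rpow_nonneg hK _
  have hρk : (ρ ^ 2) ^ k = K := by
    rw [← pow_mul, hρ, Real.rpow_inv_natCast_pow hK h2k]
  have hL : ‖L‖ ≤ ρ := by
    refine L.opNorm_le_bound hρ0 fun x => ?_
    have := h x
    rw [← hρk, ← mul_pow, ← mul_pow, ← pow_mul, ← pow_mul] at this
    exact le_of_pow_le_pow_left₀ h2k (by positivity) this
  rw [← hρk]
  gcongr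

section final

variable {n p d : ℕ}

lemma sum_block (A : Finset (Fin p)) (f : Fin p × Fin d → ℝ) :
    ∑ q : {j // j ∈ A} × Fin d, f (q.1.1, q.2) = ∑ i ∈ A ×ˢ Finset.univ, f i := by
  rw [Fintype.sum_prod_type, Finset.sum_product]
  exact Finset.sum_coe_sort A (fun j => ∑ l, f (j, l))

/-- zero extension -/
def extB (B : Finset (Fin p)) (x : {j // j ∈ B} × Fin d → ℝ) : Fin p × Fin d → ℝ :=
  fun q => if h : q.1 ∈ B then x (⟨q.1, h⟩, q.2) else 0

lemma extB_apply (B : Finset (Fin p)) (x : {j // j ∈ B} × Fin d → ℝ) (q : {j // j ∈ B} × Fin d) :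
    extB B x (q.1.1, q.2) = x q := by
  simp [extB]

lemma mask_extB (B : Finset (Fin p)) (x : {j // j ∈ B} × Fin d → ℝ) :
    mask (B ×ˢ Finset.univ) (extB B x) = extB B x := by
  funext q
  by_cases h : q.1 ∈ B <;> simp [mask, extB, h]

lemma extB_dot (B : Finset (Fin p)) (x : {j // j ∈ B} × Fin d → ℝ) :
    extB B x ⬝ᵥ extB B x = ∑ q, x q ^ 2 := by
  rw [← mask_extB, mask_dot_self, ← sum_block]
  exact Finset.sum_congr rfl fun q _ => by rw [extB_apply]

lemma block_mulVec (M : Matrix (Fin n) (Fin p × Fin d) ℝ) (B : Finset (Fin p))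
    (x : {j // j ∈ B} × Fin d → ℝ) : blockCols M B *ᵥ x = M *ᵥ extB B x := by
  funext i
  have h1 : (M *ᵥ extB B x) i = ∑ q ∈ B ×ˢ Finset.univ, M i q * extB B x q := by
    rw [Finset.sum_subset (Finset.subset_univ _)]
    · rfl
    · intro q _ hq
      have : q.1 ∉ B := by simpa using hq
      simp [extB, this]
  rw [h1, ← sum_block]
  refine Finset.sum_congr rfl fun q _ => ?_
  rw [extB_apply]
  rfl

lemma spec_pow_le (M : Matrix (Fin n) (Fin p × Fin d) ℝ) (A B : Finset (Fin p)) (k : ℕ)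
    (hk : k ≠ 0) :
    ENNReal.ofReal ((risingTwo 1 k : ℝ) ^ 2 *
        (specNorm ((blockCols M A)ᵀ * blockCols M B) ^ 2) ^ k)
      ≤ Phi k (A ×ˢ Finset.univ) (B ×ˢ Finset.univ) M := by
  set F := Phi k (A ×ˢ Finset.univ) (B ×ˢ Finset.univ) M with hF
  by_cases hT : F = ⊤
  · rw [hT]; exact le_top
  have hD : (0 : ℝ) < risingTwo 1 k := by
    have : 0 < risingTwo 1 k := Finset.prod_pos fun i _ => by omega
    exact_mod_cast this
  have h := opnorm_pow_le
    (LinearMap.toContinuousLinearMap (Matrix.toEuclideanLin ((blockCols M A)ᵀ * blockCols M B)))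
    k hk (F.toReal / (risingTwo 1 k : ℝ) ^ 2) (by positivity) ?_
  · change (specNorm ((blockCols M A)ᵀ * blockCols M B) ^ 2) ^ k ≤ _ at h
    rw [ENNReal.ofReal_le_iff_le_toReal hT]
    rw [le_div_iff₀ (by positivity)] at h
    linarith
  · intro x
    have h1 := Phi_lower k (A ×ˢ Finset.univ) (B ×ˢ Finset.univ) M (extB B x.ofLp) (mask_extB B _)
    rw [mask_dot_self, extB_dot, ← sum_block, ← hF] at h1
    have e1 : ‖x‖ ^ 2 = ∑ q, x.ofLp q ^ 2 := EuclideanSpace.real_norm_sq_eq x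
    have e2 : ‖(LinearMap.toContinuousLinearMap
        (Matrix.toEuclideanLin ((blockCols M A)ᵀ * blockCols M B))) x‖ ^ 2
        = ∑ q : {j // j ∈ A} × Fin d, (Mᵀ *ᵥ (M *ᵥ extB B x.ofLp)) (q.1.1, q.2) ^ 2 := by
      rw [EuclideanSpace.real_norm_sq_eq]
      refine Finset.sum_congr rfl fun q _ => ?_
      congr 1
      change (((blockCols M A)ᵀ * blockCols M B) *ᵥ x.ofLp) q = _
      rw [← mulVec_mulVec, block_mulVec]
      rfl
    rw [e1, e2]
    have hx : 0 ≤ (∑ q, x.ofLp q ^ 2) ^ k := pow_nonneg (Finset.sum_nonneg fun _ _ => sq_nonneg _) _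
    have hz : 0 ≤ (∑ q : {j // j ∈ A} × Fin d, (Mᵀ *ᵥ (M *ᵥ extB B x.ofLp)) (q.1.1, q.2) ^ 2) ^ k :=
      pow_nonneg (Finset.sum_nonneg fun _ _ => sq_nonneg _) _
    have h2 := ENNReal.toReal_mono (ENNReal.mul_ne_top hT ENNReal.ofReal_ne_top) h1
    simp only [ENNReal.toReal_mul, ENNReal.toReal_natCast, ENNReal.toReal_ofReal hx,
      ENNReal.toReal_ofReal hz] at h2
    rw [div_mul_eq_mul_div, le_div_iff₀ (by positivity)]
    linarith

lemma specNorm_smul {m l : Type*} [Fintype m] [Fintype l] [DecidableEq l] (c : ℝ) (hc : 0 ≤ c)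
    (M : Matrix m l ℝ) : specNorm (c • M) = c * specNorm M := by
  unfold specNorm
  rw [map_smul, map_smul, norm_smul, Real.norm_of_nonneg hc]

lemma specNorm_nonneg {m l : Type*} [Fintype m] [Fintype l] [DecidableEq l]
    (M : Matrix m l ℝ) : 0 ≤ specNorm M := norm_nonneg _

lemma specNorm_zero {m l : Type*} [Fintype m] [Fintype l] [DecidableEq l] :
    specNorm (0 : Matrix m l ℝ) = 0 := by
  unfold specNorm
  simp

/-- the moment-method bound in the non-degenerate case -/
lemma main_bound {Ω : Type*} [MeasurableSpace Ω] (P : Measure Ω) [IsProbabilityMeasure P]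
    (V : Ω → Matrix (Fin n) (Fin p × Fin d) ℝ) (hV : IsUniformStiefel P V)
    (A B : Finset (Fin p)) (hAB : Disjoint A B) (hA : A.Nonempty) (hB : B.Nonempty) (hd : 0 < d)
    (T : ℝ) (hm : ((A.card + B.card) * d : ℕ) ≤ T) (hTn : T ≤ n) (hT2 : 2 < T) :
    P {ω | (9 * T * n / ((p * d : ℕ) : ℝ) ^ 2) ≤
        specNorm ((blockCols (V ω) A)ᵀ * blockCols (V ω) B) ^ 2}
      ≤ ENNReal.ofReal (Real.exp (-(T - ((A.card + B.card) * d : ℕ)) / 2)) := by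
  obtain ⟨a₀, ha₀⟩ := hA
  obtain ⟨b₀, hb₀⟩ := hB
  set k := ⌈T / 2⌉₊ with hkdef
  have hk1 : T / 2 ≤ k := Nat.le_ceil _
  have hk2 : 2 * ((k : ℝ) - 1) ≤ T := by
    have := Nat.ceil_lt_add_one (a := T / 2) (by linarith)
    linarith
  have hk : 2 ≤ k := by
    have : (1 : ℝ) < k := by linarith
    exact_mod_cast this
  have hab : a₀ ≠ b₀ := fun h => Finset.disjoint_left.1 hAB ha₀ (h ▸ hb₀)
  have hp : 2 ≤ p := by
    have h1 := a₀.2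
    have h2 := b₀.2
    have h3 : a₀.1 ≠ b₀.1 := fun h => hab (Fin.ext h)
    omega
  have hN : 2 ≤ p * d := by nlinarith
  set N := p * d with hNdef
  have hn0 : (0 : ℝ) < n := by linarith
  have hN0 : (0 : ℝ) < N := by exact_mod_cast (by omega : 0 < N)
  set S : Finset (Fin p × Fin d) := A ×ˢ Finset.univ with hS
  set S' : Finset (Fin p × Fin d) := B ×ˢ Finset.univ with hS'
  have hdis : Disjoint S S' := by
    rw [Finset.disjoint_left]
    intro q hq hq'
    simp only [hS, hS', Finset.mem_product, Finset.mem_univ, and_true] at hq hq'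
    exact Finset.disjoint_left.1 hAB hq hq'
  set i : Fin p × Fin d := (a₀, ⟨0, hd⟩)
  set i' : Fin p × Fin d := (b₀, ⟨0, hd⟩)
  have hi : i ∈ S := by simp [hS, i, ha₀]
  have hi' : i' ∈ S' := by simp [hS', i', hb₀]
  have hii : i ≠ i' := fun h => hab (congrArg Prod.fst h)
  have hcard : Fintype.card (Fin p × Fin d) = N := by simp [hNdef]
  have hcS : S.card = A.card * d := by simp [hS]
  have hcS' : S'.card = B.card * d := by simp [hS']
  have hI := lintegral_Phi hV k S S' hdis i i' hi hi'
  have hC := crossF_value hV k i i' hii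
  have hG := normG_value hV k i
  rw [hcard] at hC hG
  rw [hcS, hcS'] at hI
  set C := crossF P V k (Pi.single i 1) (Pi.single i' 1)
  set G := normG P V k (Pi.single i 1)
  have rpos : ∀ x, 0 < x → 0 < risingTwo x k := fun x hx => Finset.prod_pos fun i _ => by omega
  have hD := rpos 1 one_pos
  have hQN := rpos N (by omega)
  have hQN1 := rpos (N - 1) (by omega)
  have hnum := numeric_bound (A.card * d) (B.card * d) n N k T
    (by push_cast at hm ⊢; linarith) (by linarith) hTn hk1 hk2 hk hN
  have eexp : ((A.card * d : ℕ) : ℝ) + ((B.card * d : ℕ) : ℝ) = (((A.card + B.card) * d : ℕ) : ℝ) := by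
    push_cast; ring
  rw [eexp] at hnum
  set ε := Real.exp (-(T - ((A.card + B.card) * d : ℕ)) / 2)
  set r := (9 * T * n / (N : ℝ) ^ 2) with hr
  have hr0 : 0 < r := by positivity
  set c := (risingTwo 1 k : ℝ) ^ 2 * r ^ k with hc
  have hD' : (0 : ℝ) < risingTwo 1 k := by exact_mod_cast hD
  have hc0 : 0 < c := by positivity
  -- Markov
  have hsub : {ω | r ≤ specNorm ((blockCols (V ω) A)ᵀ * blockCols (V ω) B) ^ 2}
      ⊆ {ω | ENNReal.ofReal c ≤ Phi k S S' (V ω)} := by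
    intro ω hω
    refine le_trans (ENNReal.ofReal_le_ofReal ?_) (spec_pow_le (V ω) A B k (by omega))
    have hω' : r ≤ specNorm ((blockCols (V ω) A)ᵀ * blockCols (V ω) B) ^ 2 := hω
    rw [hc]
    gcongr
  have hmk := mul_meas_ge_le_lintegral (μ := P) (measurable_Phi hV k S S') (ENNReal.ofReal c)
  rw [hI] at hmk
  -- combine
  have key : ∀ q : ℝ≥0∞, ENNReal.ofReal c * q ≤ risingTwo (A.card * d) k * risingTwo (B.card * d) k * C →
      q ≤ ENNReal.ofReal ε := by
    intro q hq
    have hnumE : (risingTwo (A.card * d) k : ℝ≥0∞) * risingTwo (B.card * d) k * risingTwo n k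
        ≤ ENNReal.ofReal ε * risingTwo 1 k * ENNReal.ofReal (r ^ k)
          * (risingTwo N k * risingTwo (N - 1) k) := by
      have := ENNReal.ofReal_le_ofReal hnum
      rw [ENNReal.ofReal_mul (by positivity), ENNReal.ofReal_mul (by positivity),
        ENNReal.ofReal_mul (by positivity), ENNReal.ofReal_mul (by positivity),
        ENNReal.ofReal_mul (by positivity), ENNReal.ofReal_mul (by positivity)] at this
      simpa only [ENNReal.ofReal_natCast] using this
    have ecE : ENNReal.ofReal c = (risingTwo 1 k : ℝ≥0∞) * risingTwo 1 k * ENNReal.ofReal (r ^ k) := by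
      rw [hc, ENNReal.ofReal_mul (by positivity), sq, ENNReal.ofReal_mul (by positivity),
        ENNReal.ofReal_natCast]
    set W : ℝ≥0∞ := ENNReal.ofReal c * (risingTwo N k * risingTwo (N - 1) k) with hW
    have hW0 : W ≠ 0 := by
      refine mul_ne_zero (by simpa using hc0) (mul_ne_zero ?_ ?_)
      · exact_mod_cast hQN.ne'
      · exact_mod_cast hQN1.ne'
    have hWt : W ≠ ⊤ := ENNReal.mul_ne_top ENNReal.ofReal_ne_top
      (ENNReal.mul_ne_top (ENNReal.natCast_ne_top _) (ENNReal.natCast_ne_top _))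
    refine (ENNReal.mul_le_mul_iff_right hW0 hWt).1 ?_
    calc W * q = (ENNReal.ofReal c * q) * (risingTwo N k * risingTwo (N - 1) k) := by
          rw [hW]; ring
      _ ≤ (risingTwo (A.card * d) k * risingTwo (B.card * d) k * C)
          * (risingTwo N k * risingTwo (N - 1) k) := by gcongr
      _ = (risingTwo (A.card * d) k * risingTwo (B.card * d) k * risingTwo N k)
          * (risingTwo (N - 1) k * C) := by ring
      _ ≤ (risingTwo (A.card * d) k * risingTwo (B.card * d) k * risingTwo N k)
          * (risingTwo 1 k * G) := by gcongr
      _ = (risingTwo (A.card * d) k * risingTwo (B.card * d) k * (risingTwo N k * G))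
          * risingTwo 1 k := by ring
      _ = (risingTwo (A.card * d) k * risingTwo (B.card * d) k * risingTwo n k)
          * risingTwo 1 k := by rw [hG]
      _ ≤ (ENNReal.ofReal ε * risingTwo 1 k * ENNReal.ofReal (r ^ k)
          * (risingTwo N k * risingTwo (N - 1) k)) * risingTwo 1 k := by gcongr
      _ = W * ENNReal.ofReal ε := by rw [hW, ecE]; ring
  exact (measure_mono hsub).trans (key _ hmk)

end final
/-- **Lemma S.2.** Cross-Gram concentration between disjoint column-block sets of a
uniform Stiefel matrix. -/
theorem stiefel_cross_gram_concentration
    {Ω : Type*} [MeasurableSpace Ω] (P : Measure Ω) [IsProbabilityMeasure P]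
    (n p d s : ℕ) (V : Ω → Matrix (Fin n) (Fin p × Fin d) ℝ)
    (hV : IsUniformStiefel P V)
    (A B : Finset (Fin p)) (hAB : Disjoint A B) (hs : A.card + B.card = s)
    (hpsd : n ≤ (p - s) * d)
    (t₁ t₂ t₃ : ℝ) (ht₁ : 0 < t₁) (ht₂ : 0 < t₂) (ht₃ : 0 < t₃)
    (h₁ : Real.sqrt ((s * d : ℕ) / (n : ℝ)) + t₁ < 1)
    (h₂ : Real.sqrt ((s : ℝ) / p) + t₂ < 1)
    (h₃ : Real.sqrt ((s : ℝ) / p) + t₃ < 1 / 3) :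
    P {ω | (3 * (Real.sqrt ((s * d : ℕ) / (n : ℝ)) + t₁) + 3 * (Real.sqrt ((s : ℝ) / p) + t₂))
            / (1 - 3 * (Real.sqrt ((s : ℝ) / p) + t₃))
          ≤ specNorm (((p * d : ℕ) / (n : ℝ)) • ((blockCols (V ω) A)ᵀ * blockCols (V ω) B))}
      ≤ ENNReal.ofReal (2 * Real.exp (-(n : ℝ) * t₁ ^ 2 / 2)
          + 2 * Real.exp (-((p * d : ℕ) : ℝ) * t₂ ^ 2 / 2)
          + Real.exp (-((p * d : ℕ) : ℝ) * t₃ ^ 2 / 2)) := by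
  set x := Real.sqrt ((s * d : ℕ) / (n : ℝ)) with hx
  set y := Real.sqrt ((s : ℝ) / p) with hy
  have hx0 : 0 ≤ x := Real.sqrt_nonneg _
  have hy0 : 0 ≤ y := Real.sqrt_nonneg _
  have hden : 0 < 1 - 3 * (y + t₃) := by linarith
  have hden1 : 1 - 3 * (y + t₃) ≤ 1 := by linarith
  have hthr : 3 * (x + t₁) ≤ (3 * (x + t₁) + 3 * (y + t₂)) / (1 - 3 * (y + t₃)) := by
    rw [le_div_iff₀ hden]
    nlinarith
  -- degenerate cases: the cross Gram matrix vanishes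
  have degen : (∀ ω, (((p * d : ℕ) / (n : ℝ)) • ((blockCols (V ω) A)ᵀ * blockCols (V ω) B)) = 0) →
      P {ω | (3 * (x + t₁) + 3 * (y + t₂)) / (1 - 3 * (y + t₃))
          ≤ specNorm (((p * d : ℕ) / (n : ℝ)) • ((blockCols (V ω) A)ᵀ * blockCols (V ω) B))} = 0 := by
    intro h
    rw [show {ω | (3 * (x + t₁) + 3 * (y + t₂)) / (1 - 3 * (y + t₃))
          ≤ specNorm (((p * d : ℕ) / (n : ℝ)) • ((blockCols (V ω) A)ᵀ * blockCols (V ω) B))} = ∅ from ?_]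
    · exact measure_empty
    · refine Set.eq_empty_of_forall_notMem fun ω hω => ?_
      have hω' : (3 * (x + t₁) + 3 * (y + t₂)) / (1 - 3 * (y + t₃))
          ≤ specNorm (((p * d : ℕ) / (n : ℝ)) • ((blockCols (V ω) A)ᵀ * blockCols (V ω) B)) := hω
      rw [h ω, specNorm_zero] at hω'
      linarith
  rcases Nat.eq_zero_or_pos n with hn | hn
  · rw [degen fun ω => by simp [hn]]
    exact zero_le
  have hd : 0 < d := by
    rcases Nat.eq_zero_or_pos d with h | h
    · rw [h] at hpsd; omega
    · exact h
  rcases A.eq_empty_or_nonempty with hA | hA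
  · rw [degen fun ω => by
      ext q
      exact absurd q.1.2 (by simp [hA])]
    exact zero_le
  rcases B.eq_empty_or_nonempty with hB | hB
  · rw [degen fun ω => by
      ext q q'
      exact absurd q'.1.2 (by simp [hB])]
    exact zero_le
  have hn0 : (0 : ℝ) < n := by exact_mod_cast hn
  have hs2 : 2 ≤ s := by have := hA.card_pos; have := hB.card_pos; omega
  have hsd : 2 ≤ s * d := by nlinarith
  have hsd' : (2 : ℝ) ≤ (s * d : ℕ) := by exact_mod_cast hsd
  have hxx : n * x ^ 2 = (s * d : ℕ) := by
    rw [hx, Real.sq_sqrt (by positivity)]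
    field_simp
  have hpp : 0 < p := lt_of_le_of_lt (Nat.zero_le _) hA.choose.2
  have hN0 : (0 : ℝ) < (p * d : ℕ) := by exact_mod_cast Nat.mul_pos hpp hd
  have hT1 : ((s * d : ℕ) : ℝ) + n * t₁ ^ 2 ≤ n * (x + t₁) ^ 2 := by
    rw [← hxx]
    have : 0 ≤ (n : ℝ) * (x * t₁) := by positivity
    nlinarith
  have hnt : 0 < (n : ℝ) * t₁ ^ 2 := by positivity
  have hTn : (n : ℝ) * (x + t₁) ^ 2 ≤ n := by
    have : (x + t₁) ^ 2 ≤ 1 := by nlinarith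
    nlinarith
  have hb := main_bound P V hV A B hAB hA hB hd (n * (x + t₁) ^ 2) (by rw [hs]; linarith) hTn
    (by linarith)
  rw [hs] at hb
  refine le_trans (measure_mono ?_) (hb.trans (ENNReal.ofReal_le_ofReal ?_))
  · intro ω hω
    have hω' : (3 * (x + t₁) + 3 * (y + t₂)) / (1 - 3 * (y + t₃))
          ≤ specNorm (((p * d : ℕ) / (n : ℝ)) • ((blockCols (V ω) A)ᵀ * blockCols (V ω) B)) := hω
    rw [specNorm_smul _ (by positivity)] at hω'
    have h4 := hthr.trans hω'
    change 9 * (n * (x + t₁) ^ 2) * n / ((p * d : ℕ) : ℝ) ^ 2 ≤ _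
    have h5 : 3 * (x + t₁) * n / ((p * d : ℕ) : ℝ)
        ≤ specNorm ((blockCols (V ω) A)ᵀ * blockCols (V ω) B) := by
      rw [div_mul_eq_mul_div, le_div_iff₀ hn0] at h4
      rw [div_le_iff₀ hN0]
      linarith
    calc 9 * (n * (x + t₁) ^ 2) * n / ((p * d : ℕ) : ℝ) ^ 2
        = (3 * (x + t₁) * n / ((p * d : ℕ) : ℝ)) ^ 2 := by rw [div_pow]; ring
      _ ≤ _ := pow_le_pow_left₀ (by positivity) h5 2
  · have e1 : Real.exp (-(n * (x + t₁) ^ 2 - (s * d : ℕ)) / 2) ≤ Real.exp (-(n : ℝ) * t₁ ^ 2 / 2) := by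
      apply Real.exp_le_exp.2
      linarith
    have e2 := Real.exp_pos (-(n : ℝ) * t₁ ^ 2 / 2)
    have e3 := Real.exp_pos (-((p * d : ℕ) : ℝ) * t₂ ^ 2 / 2)
    have e4 := Real.exp_pos (-((p * d : ℕ) : ℝ) * t₃ ^ 2 / 2)
    linarith
end
end
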